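/- Assume R is unmixed of dimension d ≥ 2. Then the following are equivalent: (1) R is Cohen-Macaulay; (2) f_0(q, R) ≤ r_d(R) for some C-parameter ideal q of R contained in m^{g(R)}; (3) e_1(q :_R m, R) − e_1(q, R) ≤ r_d(R) for some C-parameter ideal q of R contained in m^{g(R)}. -/

import Mathlib

/-! Preliminary definitions: lengths, dimensions, (C-)systems of parameters, Hilbert
coefficients, irreducible multiplicities, local cohomology invariants, stable values,
unmixedness, the unmixed component, and the g-invariant. -/

open CategoryTheory CategoryTheory.Limits Opposite IsLocalRing

universe u

noncomputable section

section Definitions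

variable (R : Type u) [CommRing R]

/-- The length of an `R`-module, defined as the Krull dimension of its submodule lattice. -/
def moduleLength (M : Type u) [AddCommGroup M] [Module R M] : WithBot ℕ∞ :=
  Order.krullDim (Submodule R M)

/-- The Krull dimension of an `R`-module `M`, i.e. `dim (R / Ann M)`. -/
def moduleDim (M : Type u) [AddCommGroup M] [Module R M] : WithBot ℕ∞ :=
  ringKrullDim (R ⧸ Module.annihilator R M)

/-- The colon submodule `(N :_M I) = {x : M | I • x ⊆ N}`. -/
def modColon {M : Type u} [AddCommGroup M] [Module R M] (N : Submodule R M) (I : Ideal R) :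
    Submodule R M where
  carrier := {x | ∀ r ∈ I, r • x ∈ N}
  add_mem' := by
    intro a b ha hb r hr
    simpa [smul_add] using N.add_mem (ha r hr) (hb r hr)
  zero_mem' := by
    intro r hr
    simpa using N.zero_mem
  smul_mem' := by
    intro c a ha r hr
    rw [smul_comm]
    exact N.smul_mem c (ha r hr)

/-- `x : Fin s → R` is a system of parameters of the module `M`:
`s = dim M`, the `x i` are nonunits, and `M/(x)M` has finite length. -/
def IsSOP (M : Type u) [AddCommGroup M] [Module R M] {s : ℕ} (x : Fin s → R) : Prop :=
  moduleDim R M = (s : WithBot ℕ∞) ∧ (∀ i, x i ∈ nonunits R) ∧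
    IsFiniteLength R (M ⧸ (Ideal.span (Set.range x) • (⊤ : Submodule R M)))

/-- The ideal `b(M)`: the intersection, over all systems of parameters `x` of `M` and all `i`,
of `Ann_R ((0) :_{M/(x_1,...,x_{i-1})M} x_i)`. -/
def bIdeal (M : Type u) [AddCommGroup M] [Module R M] : Ideal R :=
  ⨅ (s : ℕ) (x : Fin s → R) (_ : IsSOP R M x) (i : Fin s),
    (Submodule.torsionBy R
      (M ⧸ (Ideal.span (x '' {j | j < i}) • (⊤ : Submodule R M))) (x i)).annihilator

/-- `x` is a C-system of parameters of `M`: a system of parameters such that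
`x i ∈ b(M/(x_{i+1},...,x_s)M)^3` for every `i` (for `i = s` the quotient is `M` itself). -/
def IsCSOP (M : Type u) [AddCommGroup M] [Module R M] {s : ℕ} (x : Fin s → R) : Prop :=
  IsSOP R M x ∧ ∀ i : Fin s,
    x i ∈ (bIdeal R (M ⧸ (Ideal.span (x '' {j | i < j}) • (⊤ : Submodule R M)))) ^ 3

/-- A parameter ideal of `R`. -/
def IsParamIdeal (q : Ideal R) : Prop :=
  ∃ (s : ℕ) (x : Fin s → R), IsSOP R R x ∧ q = Ideal.span (Set.range x)

/-- A C-parameter ideal of `R`: an ideal generated by a C-system of parameters of `R`. -/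
def IsCParamIdeal (q : Ideal R) : Prop :=
  ∃ (s : ℕ) (x : Fin s → R), IsCSOP R R x ∧ q = Ideal.span (Set.range x)

/-- A C-parameter ideal of a module `M`. -/
def IsCParamIdealMod (M : Type u) [AddCommGroup M] [Module R M] (q : Ideal R) : Prop :=
  ∃ (s : ℕ) (x : Fin s → R), IsCSOP R M x ∧ q = Ideal.span (Set.range x)

/-- `e` is the family of Hilbert coefficients of `M` (of dimension `s`) with respect to `I`:
`ℓ(M/I^{n+1}M) = ∑_{i=0}^{s} (-1)^i (e i) binom(n+s-i, s-i)` for all large `n`. -/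
def IsHilbCoeffMod (I : Ideal R) (M : Type u) [AddCommGroup M] [Module R M] (s : ℕ)
    (e : ℕ → ℤ) : Prop :=
  ∃ N : ℕ, ∀ n ≥ N, ∃ L : ℕ,
    moduleLength R (M ⧸ (I ^ (n + 1) • (⊤ : Submodule R M))) = (L : WithBot ℕ∞) ∧
    (L : ℤ) = ∑ i ∈ Finset.range (s + 1),
      (-1) ^ i * e i * ((n + s - i).choose (s - i) : ℤ)

/-- `e` is the family of Hilbert coefficients of `R` (of dimension `d`) with respect to `I`;
`e 1` is the Chern number of `I`. -/
def IsHilbCoeff (I : Ideal R) (d : ℕ) (e : ℕ → ℤ) : Prop :=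
  IsHilbCoeffMod R I R d e

variable [IsLocalRing R]

/-- The colon ideal `(q :_R m)`. -/
def colonIdeal (q : Ideal R) : Ideal R :=
  modColon R q (maximalIdeal R)

/-- The index of reducibility `ir_M(q) = ℓ((qM :_M m)/qM)`. -/
def irMod (M : Type u) [AddCommGroup M] [Module R M] (q : Ideal R) : WithBot ℕ∞ :=
  moduleLength R
    ↥(Submodule.map (q • (⊤ : Submodule R M)).mkQ
      (modColon R (q • (⊤ : Submodule R M)) (maximalIdeal R)))

/-- `NN` is the stable value `𝒩(M)` of `M`: the common index of reducibility of all
C-parameter ideals of `M`. -/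
def IsStableValueMod (M : Type u) [AddCommGroup M] [Module R M] (NN : ℕ) : Prop :=
  ∀ q : Ideal R, IsCParamIdealMod R M q → irMod R M q = (NN : WithBot ℕ∞)

/-- `NN` is the stable value `𝒩(R)` of `R`. -/
def IsStableValue (NN : ℕ) : Prop :=
  ∀ q : Ideal R, IsCParamIdeal R q → irMod R R q = (NN : WithBot ℕ∞)

/-- `f` is the family of coefficients of the polynomial giving the index of reducibility,
`ir_M(I^{n+1}) = ℓ((I^{n+1}M :_M m)/I^{n+1}M) = ∑_{i=0}^{s-1} (-1)^i (f i) binom(n+s-1-i, s-1-i)`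
for all large `n`; `f 0` is the irreducible multiplicity of `M` with respect to `I`. -/
def IsIrrCoeffMod (I : Ideal R) (M : Type u) [AddCommGroup M] [Module R M] (s : ℕ)
    (f : ℕ → ℤ) : Prop :=
  ∃ N : ℕ, ∀ n ≥ N, ∃ L : ℕ,
    irMod R M (I ^ (n + 1)) = (L : WithBot ℕ∞) ∧
    (L : ℤ) = ∑ i ∈ Finset.range s,
      (-1) ^ i * f i * ((n + s - 1 - i).choose (s - 1 - i) : ℤ)

/-- Ring version of `IsIrrCoeffMod`. -/
def IsIrrCoeff (I : Ideal R) (d : ℕ) (f : ℕ → ℤ) : Prop :=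
  IsIrrCoeffMod R I R d f

/-- The local cohomology module `H^i_m(M)`. -/
def Hmod (M : Type u) [AddCommGroup M] [Module R M] (i : ℕ) : ModuleCat.{u} R :=
  (localCohomology (maximalIdeal R) i).obj (ModuleCat.of R M)

/-- `r_i(M) = ℓ((0) :_{H^i_m(M)} m)`, the length of the socle of `H^i_m(M)`. -/
def rLengthMod (M : Type u) [AddCommGroup M] [Module R M] (i : ℕ) : WithBot ℕ∞ :=
  moduleLength R ↥(Submodule.torsionBySet R ↥(Hmod R M i) ((maximalIdeal R : Ideal R) : Set R))

/-- `r_i(R)`. -/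
def rLength (i : ℕ) : WithBot ℕ∞ := rLengthMod R R i

/-- `M` is a Cohen-Macaulay `R`-module: `H^i_m(M) = 0` for all `i < dim M`. -/
def IsCMMod (M : Type u) [AddCommGroup M] [Module R M] : Prop :=
  ∀ i : ℕ, (i : WithBot ℕ∞) < moduleDim R M → Subsingleton ↥(Hmod R M i)

/-- `R` is a Cohen-Macaulay local ring: `H^i_m(R) = 0` for all `i < dim R`. -/
def IsCMLocal : Prop :=
  ∀ i : ℕ, (i : WithBot ℕ∞) < ringKrullDim R → Subsingleton ↥(Hmod R R i)

/-- `R` is a generalized Cohen-Macaulay local ring: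
`H^i_m(R)` has finite length for all `i < dim R`. -/
def IsGeneralizedCM : Prop :=
  ∀ i : ℕ, (i : WithBot ℕ∞) < ringKrullDim R → IsFiniteLength R ↥(Hmod R R i)

/-- `R` is a Gorenstein local ring: Cohen-Macaulay of type `r_d(R) = 1`, `d = dim R`. -/
def IsGorensteinLocal : Prop :=
  IsCMLocal R ∧ ∀ d : ℕ, ringKrullDim R = (d : WithBot ℕ∞) → rLength R d = (1 : WithBot ℕ∞)

/-- `R` is unmixed: `dim R̂/p = dim R̂` for every associated prime `p` of the
`m`-adic completion `R̂` of `R`. -/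
def IsUnmixedRing : Prop :=
  ∀ p ∈ associatedPrimes (AdicCompletion (maximalIdeal R) R) (AdicCompletion (maximalIdeal R) R),
    ringKrullDim ((AdicCompletion (maximalIdeal R) R) ⧸ p) =
      ringKrullDim (AdicCompletion (maximalIdeal R) R)

/-- `M` is unmixed: `dim R̂/p = dim M̂` for every associated prime `p` of the
`m`-adic completion `M̂` of `M`, viewed over `R̂`. -/
def IsUnmixedMod (M : Type u) [AddCommGroup M] [Module R M] : Prop :=
  ∀ p ∈ associatedPrimes (AdicCompletion (maximalIdeal R) R) (AdicCompletion (maximalIdeal R) M),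
    ringKrullDim ((AdicCompletion (maximalIdeal R) R) ⧸ p) =
      moduleDim (AdicCompletion (maximalIdeal R) R) (AdicCompletion (maximalIdeal R) M)

/-- `H^0_m(M)`, described as the submodule of elements killed by a power of `m`. -/
def H0Sub (M : Type u) [AddCommGroup M] [Module R M] : Submodule R M :=
  ⨆ n : ℕ, Submodule.torsionBySet R M (((maximalIdeal R) ^ n : Ideal R) : Set R)

/-- The unmixed component `u = U_R(0)` of `R`: the largest ideal of dimension `< dim R`. -/
def unmixedComponent : Ideal R := sSup {J : Ideal R | moduleDim R ↥J < ringKrullDim R}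

end Definitions

section CMImage

/-- `R` is a homomorphic image of a Cohen-Macaulay (Noetherian) local ring. -/
def IsHomImageOfCM (R : Type u) [CommRing R] : Prop :=
  ∃ (A : Type u) (_ : CommRing A) (_ : IsLocalRing A) (_ : IsNoetherianRing A),
    IsCMLocal A ∧ ∃ f : A →+* R, Function.Surjective f

end CMImage

section GInvariant

variable (R : Type u) [CommRing R] [IsLocalRing R] [IsNoetherianRing R]

/-- The canonical homomorphism from `Ext^p(R/q, R)` (the term of the directed system indexed by
the ideal `q` with `J ≤ rad q`) into the local cohomology module `H^p_J(R)`, given by the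
structure of `H^p_J(R)` as an inductive limit. -/
def canonicalToLocalCohomology (J q : Ideal R) (h : J ≤ q.radical) (p : ℕ) :
    ((localCohomology.diagram (localCohomology.selfLERadicalDiagram J) p).obj
        (op (⟨q, h⟩ : localCohomology.SelfLERadical J))).obj (ModuleCat.of R R) ⟶
      (localCohomology J p).obj (ModuleCat.of R R) :=
  haveI := localCohomology.hasColimitDiagram.{u, u} (localCohomology.selfLERadicalDiagram J) p
  (colimit.ι (localCohomology.diagram (localCohomology.selfLERadicalDiagram J) p)
      (op (⟨q, h⟩ : localCohomology.SelfLERadical J))).app (ModuleCat.of R R) ≫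
    (localCohomology.isoSelfLERadical J p).hom.app (ModuleCat.of R R)

/-- A map of `R`-modules is surjective on socles. -/
def SurjectiveOnSocles {A B : ModuleCat.{u} R} (φ : A ⟶ B) : Prop :=
  ∀ y ∈ Submodule.torsionBySet R ↥B ((maximalIdeal R : Ideal R) : Set R),
    ∃ z ∈ Submodule.torsionBySet R ↥A ((maximalIdeal R : Ideal R) : Set R), φ z = y

/-- The defining property of the g-invariant: for every system of parameters `x` of `R`
contained in `m^(n₀)` and every `p`, the canonical homomorphism into the local cohomology
module `H^p_m(R)` is surjective on the socles. -/
def GProperty (n₀ : ℕ) : Prop :=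
  ∀ (s : ℕ) (x : Fin s → R), IsSOP R R x → (∀ i, x i ∈ maximalIdeal R ^ n₀) →
    ∀ (h : maximalIdeal R ≤ (Ideal.span (Set.range x)).radical) (p : ℕ),
      SurjectiveOnSocles R
        (canonicalToLocalCohomology R (maximalIdeal R) (Ideal.span (Set.range x)) h p)

/-- The g-invariant `g(R)`: the least `n₀` satisfying `GProperty`. -/
def gInvariant : ℕ := sInf {n₀ : ℕ | GProperty R n₀}

end GInvariant

end

noncomputable section

section HomologyDual

variable {D : Type*} [Category* D] [Abelian D] (K : ChainComplex D ℕ) {A : D}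

/-- The morphism on homology induced by a morphism on chains that kills boundaries. -/
def homologyDesc {n : ℕ} (k : K.X n ⟶ A) (hk : K.d (n + 1) n ≫ k = 0) : K.homology n ⟶ A :=
  K.homologyι n ≫ K.descOpcycles k (n + 1) (ChainComplex.prev _ _) hk

theorem homologyDesc_add {n : ℕ} (k l : K.X n ⟶ A) (hk : K.d (n + 1) n ≫ k = 0)
    (hl : K.d (n + 1) n ≫ l = 0) :
    homologyDesc K (k + l) (by simp [hk, hl]) = homologyDesc K k hk + homologyDesc K l hl := by
  unfold homologyDesc
  refine Eq.trans ?_ (Preadditive.comp_add _ _ _ _ _ _)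
  congr 1
  rw [← cancel_epi (K.pOpcycles _)]
  simp

theorem homologyDesc_comp {n : ℕ} (k : K.X n ⟶ A) (hk : K.d (n + 1) n ≫ k = 0)
    {B : D} (t : A ⟶ B) :
    homologyDesc K k hk ≫ t = homologyDesc K (k ≫ t) (by simp [reassoc_of% hk]) := by
  unfold homologyDesc
  rw [Category.assoc]
  congr 1
  rw [← cancel_epi (K.pOpcycles _)]
  simp

theorem homologyMap_homologyDesc {L : ChainComplex D ℕ} (φ : L ⟶ K) {n : ℕ} (k : K.X n ⟶ A)
    (hk : K.d (n + 1) n ≫ k = 0) :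
    HomologicalComplex.homologyMap φ n ≫ homologyDesc K k hk =
      homologyDesc L (φ.f n ≫ k) (by simp [← φ.comm_assoc, hk]) := by
  unfold homologyDesc
  rw [HomologicalComplex.homologyι_naturality_assoc]
  congr 1
  rw [← cancel_epi (L.pOpcycles _)]
  simp

theorem homologyDesc_surjective [Injective A] {n : ℕ} (E : K.homology n ⟶ A) :
    ∃ (k : K.X n ⟶ A) (hk : K.d (n + 1) n ≫ k = 0), homologyDesc K k hk = E := by
  refine ⟨K.pOpcycles n ≫ Injective.factorThru E (K.homologyι n), by simp, ?_⟩
  unfold homologyDesc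
  conv_rhs => rw [← Injective.comp_factorThru E (K.homologyι n)]
  congr 1
  rw [← cancel_epi (K.pOpcycles _)]
  simp

theorem homologyDesc_succ_eq_zero_iff [Injective A] {n : ℕ} (k : K.X (n + 1) ⟶ A)
    (hk : K.d (n + 1 + 1) (n + 1) ≫ k = 0) :
    homologyDesc K k hk = 0 ↔ ∃ g : K.X n ⟶ A, K.d (n + 1) n ≫ g = k := by
  constructor
  · intro h
    have hex := (ShortComplex.exact_of_f_is_kernel
      (ShortComplex.mk _ _ (K.homologyι_comp_fromOpcycles (n + 1) n))
      (K.homologyIsKernel (n + 1) n (ChainComplex.next_nat_succ _)))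
    refine ⟨hex.descToInjective (K.descOpcycles k _ (ChainComplex.prev _ _) hk) h, ?_⟩
    rw [← K.p_fromOpcycles, Category.assoc]
    refine (congrArg (K.pOpcycles (n + 1) ≫ ·) (hex.comp_descToInjective _ h)).trans ?_
    simp
  · rintro ⟨g, rfl⟩
    exact K.homologyι_descOpcycles_eq_zero_of_boundary _ _ _ g rfl

theorem homologyDesc_zero_eq_zero_iff (k : K.X 0 ⟶ A) (hk : K.d 1 0 ≫ k = 0) :
    homologyDesc K k hk = 0 ↔ k = 0 := by
  constructor
  · intro h
    have : IsIso (K.homologyι 0) := K.isIso_homologyι 0 0 (by simp) (by simp)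
    have h2 : K.descOpcycles k 1 (ChainComplex.prev _ _) hk = 0 := by
      rw [← cancel_epi (K.homologyι 0)]
      simpa [homologyDesc] using h
    rw [← K.p_descOpcycles k 1 (ChainComplex.prev _ _) hk, h2, comp_zero]
  · rintro rfl
    unfold homologyDesc
    have h : K.descOpcycles (0 : K.X 0 ⟶ A) 1 (ChainComplex.prev _ _) hk = 0 := by
      rw [← cancel_epi (K.pOpcycles _)]
      simp
    exact (congrArg _ h).trans comp_zero

end HomologyDual

section ExtComparison

variable {R : Type u} [CommRing R]

theorem smul_extMk {X Y : ModuleCat.{u} R} (P : ProjectiveResolution X) {n : ℕ}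
    (f : P.complex.X n ⟶ Y) (hf : P.complex.d (n + 1) n ≫ f = 0) (r : R) :
    r • P.extMk f (n + 1) rfl hf = P.extMk (r • f) (n + 1) rfl (by simp [hf]) := by
  rw [Abelian.Ext.smul_eq_comp_mk₀, P.extMk_comp_mk₀]
  simp only [Linear.comp_smul, Category.comp_id]

theorem extMk_zero_eq_zero_iff {X Y : ModuleCat.{u} R} (P : ProjectiveResolution X)
    (f : P.complex.X 0 ⟶ Y) (hf : P.complex.d 1 0 ≫ f = 0) :
    P.extMk f 1 rfl hf = 0 ↔ f = 0 := by
  constructor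
  · intro h
    rw [← P.extEquivCohomologyClass.apply_eq_iff_eq,
      P.extEquivCohomologyClass_extMk, P.extEquivCohomologyClass_zero,
      CochainComplex.HomComplex.CohomologyClass.mk_eq_zero_iff,
      CochainComplex.HomComplex.Cocycle.toSingleMk_mem_coboundaries_iff _ _ _ _ _ 1 (by simp)] at h
    obtain ⟨g, hg⟩ := h
    have h1 : IsZero (P.cochainComplex.X 1) :=
      P.cochainComplex.isZero_of_isStrictlyLE 0 1 (by lia)
    rw [h1.eq_of_src g 0, comp_zero] at hg
    rw [← cancel_epi (P.cochainComplexXIso (-(0 : ℕ)) 0 rfl).hom, comp_zero]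
    exact hg.symm
  · rintro rfl
    exact P.extMk_zero 1 rfl

/-- The complex of homomorphisms to `Y` as a chain complex in the opposite category. -/
abbrev opHomComplex {X : ModuleCat.{u} R} (P : ProjectiveResolution X) (Y : ModuleCat.{u} R) :
    ChainComplex (ModuleCat.{u} R)ᵒᵖ ℕ :=
  (((linearYoneda R (ModuleCat.{u} R)).obj Y).rightOp.mapHomologicalComplex _).obj P.complex

/-- A cochain, as a morphism in the opposite category. -/
def opCochain {X Y : ModuleCat.{u} R} (P : ProjectiveResolution X) {n : ℕ}
    (f : P.complex.X n ⟶ Y) : (opHomComplex P Y).X n ⟶ op (ModuleCat.of R R) :=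
  Quiver.Hom.op (X := ModuleCat.of R R) (Y := ((linearYoneda R (ModuleCat.{u} R)).obj Y).obj
        (op (P.complex.X n))) (ModuleCat.ofHom (LinearMap.toSpanSingleton R _ f))

theorem opCochain_surjective {X Y : ModuleCat.{u} R} (P : ProjectiveResolution X) {n : ℕ}
    (k : (opHomComplex P Y).X n ⟶ op (ModuleCat.of R R)) :
    ∃ f : P.complex.X n ⟶ Y, opCochain P f = k := by
  refine ⟨k.unop.hom (1 : R), ?_⟩
  apply Quiver.Hom.unop_inj
  ext
  exact one_smul R (k.unop.hom (1 : R))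

theorem opCochain_injective {X Y : ModuleCat.{u} R} (P : ProjectiveResolution X) {n : ℕ}
    {f g : P.complex.X n ⟶ Y} (h : opCochain P f = opCochain P g) : f = g := by
  have h2 : (1 : R) • f = (1 : R) • g := congrArg (fun t => t.unop.hom (1 : R)) h
  simpa using h2

theorem d_opCochain {X Y : ModuleCat.{u} R} (P : ProjectiveResolution X) {n m : ℕ}
    (f : P.complex.X n ⟶ Y) :
    (opHomComplex P Y).d m n ≫ opCochain P f = opCochain P (P.complex.d m n ≫ f) := by
  apply Quiver.Hom.unop_inj
  ext
  change P.complex.d m n ≫ ((1 : R) • f) = (1 : R) • (P.complex.d m n ≫ f)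
  simp

theorem opCochain_add {X Y : ModuleCat.{u} R} (P : ProjectiveResolution X) {n : ℕ}
    (f g : P.complex.X n ⟶ Y) : opCochain P (f + g) = opCochain P f + opCochain P g := by
  apply Quiver.Hom.unop_inj
  ext
  change (1 : R) • (f + g) = (1 : R) • f + (1 : R) • g
  simp

theorem opCochain_zero {X Y : ModuleCat.{u} R} (P : ProjectiveResolution X) {n : ℕ} :
    opCochain P (0 : P.complex.X n ⟶ Y) = 0 := by
  apply Quiver.Hom.unop_inj
  ext
  change (1 : R) • (0 : P.complex.X n ⟶ Y) = 0
  simp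

theorem opCochain_smul {X Y : ModuleCat.{u} R} (P : ProjectiveResolution X) {n : ℕ}
    (f : P.complex.X n ⟶ Y) (r : R) : opCochain P (r • f) = opCochain P f ≫
      (Quiver.Hom.op (X := ModuleCat.of R R) (Y := ModuleCat.of R R)
        (ModuleCat.ofHom (r • LinearMap.id))) := by
  apply Quiver.Hom.unop_inj
  ext
  change (1 : R) • (r • f) = (r • (1 : R)) • f
  simp

theorem d_opCochain_eq_zero {X Y : ModuleCat.{u} R} (P : ProjectiveResolution X) {n : ℕ}
    {f : P.complex.X n ⟶ Y} (hf : P.complex.d (n + 1) n ≫ f = 0) :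
    (opHomComplex P Y).d (n + 1) n ≫ opCochain P f = 0 := by
  rw [d_opCochain, hf, opCochain_zero]

/-- Mathlib's computation of the derived functor through a projective resolution. -/
def leftDerivedIso {X : ModuleCat.{u} R} (P : ProjectiveResolution X) (Y : ModuleCat.{u} R)
    (n : ℕ) : (((linearYoneda R (ModuleCat.{u} R)).obj Y).rightOp.leftDerived n).obj X ≅
      (opHomComplex P Y).homology n :=
  P.isoLeftDerivedObj ((linearYoneda R (ModuleCat.{u} R)).obj Y).rightOp n

theorem leftDerivedIso_naturality {X X' Y : ModuleCat.{u} R} {P : ProjectiveResolution X}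
    {P' : ProjectiveResolution X'} {g : X' ⟶ X} (φ : P'.Hom P g) (n : ℕ) :
    (((linearYoneda R (ModuleCat.{u} R)).obj Y).rightOp.leftDerived n).map g ≫
      (leftDerivedIso P Y n).hom = (leftDerivedIso P' Y n).hom ≫
        HomologicalComplex.homologyMap ((((linearYoneda R
          (ModuleCat.{u} R)).obj Y).rightOp.mapHomologicalComplex _).map φ.hom) n :=
  ProjectiveResolution.isoLeftDerivedObj_hom_naturality g P' P φ.hom
      (by simpa using φ.hom_f_zero_comp_π_f_zero) _ n

/-- The class in the derived-functor `Ext` of a cocycle, as a morphism into `op R`. -/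
def oldHom {X Y : ModuleCat.{u} R} (P : ProjectiveResolution X) {n : ℕ}
    (f : P.complex.X n ⟶ Y) (hf : P.complex.d (n + 1) n ≫ f = 0) :
    (((linearYoneda R (ModuleCat.{u} R)).obj Y).rightOp.leftDerived n).obj X ⟶
      op (ModuleCat.of R R) :=
  (leftDerivedIso P Y n).hom ≫
    homologyDesc (opHomComplex P Y) (opCochain P f) (d_opCochain_eq_zero P hf)

/-- The class in the derived-functor `Ext` of a cocycle. -/
def oldEl {X Y : ModuleCat.{u} R} (P : ProjectiveResolution X) {n : ℕ}
    (f : P.complex.X n ⟶ Y) (hf : P.complex.d (n + 1) n ≫ f = 0) :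
    ((_root_.Ext R (ModuleCat.{u} R) n).obj (op X)).obj Y :=
  (oldHom P f hf).unop.hom (1 : R)

theorem oldEl_add {X Y : ModuleCat.{u} R} (P : ProjectiveResolution X) {n : ℕ}
    (f g : P.complex.X n ⟶ Y) (hf : P.complex.d (n + 1) n ≫ f = 0)
    (hg : P.complex.d (n + 1) n ≫ g = 0) :
    oldEl P (f + g) (by simp [hf, hg]) = oldEl P f hf + oldEl P g hg := by
  have : oldHom P (f + g) (by simp [hf, hg]) = oldHom P f hf + oldHom P g hg := by
    unfold oldHom
    simp only [opCochain_add]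
    rw [homologyDesc_add _ _ _ (d_opCochain_eq_zero P hf) (d_opCochain_eq_zero P hg)]
    exact Preadditive.comp_add _ _ _ _ _ _
  unfold oldEl
  rw [this]
  rfl

theorem oldEl_smul {X Y : ModuleCat.{u} R} (P : ProjectiveResolution X) {n : ℕ}
    (f : P.complex.X n ⟶ Y) (hf : P.complex.d (n + 1) n ≫ f = 0) (r : R) :
    oldEl P (r • f) (by simp [hf]) = r • oldEl P f hf := by
  have : oldHom P (r • f) (by simp [hf]) = oldHom P f hf ≫
      (Quiver.Hom.op (X := ModuleCat.of R R) (Y := ModuleCat.of R R)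
        (ModuleCat.ofHom (r • LinearMap.id))) := by
    unfold oldHom
    simp only [opCochain_smul]
    rw [← homologyDesc_comp _ _ (d_opCochain_eq_zero P hf)]
    exact (Category.assoc _ _ _).symm
  unfold oldEl
  rw [this]
  change (oldHom P f hf).unop.hom (r • (1 : R)) = _
  rw [map_smul]
  rfl

instance : Injective (op (ModuleCat.of R R)) :=
  have : Projective (ModuleCat.of R R) := inferInstance
  inferInstance

theorem oldEl_surjective {X Y : ModuleCat.{u} R} (P : ProjectiveResolution X) {n : ℕ}
    (e : ((_root_.Ext R (ModuleCat.{u} R) n).obj (op X)).obj Y) :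
    ∃ (f : P.complex.X n ⟶ Y) (hf : P.complex.d (n + 1) n ≫ f = 0), oldEl P f hf = e := by
  let E : (((linearYoneda R (ModuleCat.{u} R)).obj Y).rightOp.leftDerived n).obj X ⟶
      op (ModuleCat.of R R) := Quiver.Hom.op (X := ModuleCat.of R R)
        (ModuleCat.ofHom (LinearMap.toSpanSingleton R _ e))
  obtain ⟨k, hk, hkE⟩ := homologyDesc_surjective (opHomComplex P Y)
    ((leftDerivedIso P Y n).inv ≫ E)
  obtain ⟨f, rfl⟩ := opCochain_surjective P k
  have hf : P.complex.d (n + 1) n ≫ f = 0 := by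
    apply opCochain_injective P
    rw [← d_opCochain, hk, opCochain_zero]
  refine ⟨f, hf, ?_⟩
  have : oldHom P f hf = E := by
    unfold oldHom
    rw [hkE]
    exact Iso.hom_inv_id_assoc _ _
  unfold oldEl
  rw [this]
  exact one_smul R e

theorem oldEl_eq_zero_iff_oldHom {X Y : ModuleCat.{u} R} (P : ProjectiveResolution X) {n : ℕ}
    (f : P.complex.X n ⟶ Y) (hf : P.complex.d (n + 1) n ≫ f = 0) :
    oldEl P f hf = 0 ↔
      homologyDesc (opHomComplex P Y) (opCochain P f) (d_opCochain_eq_zero P hf) = 0 := by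
  constructor
  · intro h
    have h2 : oldHom P f hf = 0 := by
      apply Quiver.Hom.unop_inj
      ext
      exact h
    unfold oldHom at h2
    exact (Preadditive.IsIso.comp_left_eq_zero _ _).1 h2
  · intro h
    unfold oldEl oldHom
    rw [h]
    rw [comp_zero]
    rfl

theorem oldEl_eq_zero_iff {X Y : ModuleCat.{u} R} (P : ProjectiveResolution X) {n : ℕ}
    (f : P.complex.X n ⟶ Y) (hf : P.complex.d (n + 1) n ≫ f = 0) :
    oldEl P f hf = 0 ↔ P.extMk f (n + 1) rfl hf = 0 := by
  rw [oldEl_eq_zero_iff_oldHom]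
  cases n with
  | zero =>
    rw [homologyDesc_zero_eq_zero_iff, extMk_zero_eq_zero_iff]
    constructor
    · intro h
      exact opCochain_injective P (h.trans (opCochain_zero P).symm)
    · rintro rfl
      exact opCochain_zero P
  | succ n =>
    rw [homologyDesc_succ_eq_zero_iff, P.extMk_eq_zero_iff _ _ _ _ n rfl]
    constructor
    · rintro ⟨g, hg⟩
      obtain ⟨g, rfl⟩ := opCochain_surjective P g
      exact ⟨g, opCochain_injective P (by rw [← d_opCochain, hg])⟩
    · rintro ⟨g, rfl⟩
      exact ⟨opCochain P g, d_opCochain P g⟩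

theorem oldEl_naturality {X X' Y : ModuleCat.{u} R} {P : ProjectiveResolution X}
    {P' : ProjectiveResolution X'} {g : X' ⟶ X} (φ : P'.Hom P g) {n : ℕ}
    (f : P.complex.X n ⟶ Y) (hf : P.complex.d (n + 1) n ≫ f = 0) :
    (((_root_.Ext R (ModuleCat.{u} R) n).map g.op).app Y).hom (oldEl P f hf) =
      oldEl P' (φ.hom.f n ≫ f) (by simp [← φ.hom.comm_assoc, hf]) := by
  have key : (((linearYoneda R (ModuleCat.{u} R)).obj Y).rightOp.leftDerived n).map g ≫
      oldHom P f hf = oldHom P' (φ.hom.f n ≫ f) (by simp [← φ.hom.comm_assoc, hf]) := by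
    unfold oldHom
    rw [← Category.assoc, leftDerivedIso_naturality φ, Category.assoc]
    congr 1
    refine (homologyMap_homologyDesc (opHomComplex P Y) _ _ _).trans ?_
    congr 1
  unfold oldEl
  rw [← key]
  rfl

end ExtComparison

section Comparison

variable {R : Type u} [CommRing R]

/-- A lift of a morphism to the canonical projective resolutions. -/
def resolutionHom {X X' : ModuleCat.{u} R} (P' : ProjectiveResolution X')
    (P : ProjectiveResolution X) (g : X' ⟶ X) : P'.Hom P g where
  hom := ProjectiveResolution.lift g P' P
  hom_f_zero_comp_π_f_zero := by
    have := HomologicalComplex.congr_hom (ProjectiveResolution.lift_commutes g P' P) 0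
    rw [HomologicalComplex.comp_f, HomologicalComplex.comp_f] at this
    rw [this]

theorem extComparison_aux (X Y : ModuleCat.{u} R) (n : ℕ) (e : Abelian.Ext X Y n) :
    ∃ x : ((_root_.Ext R (ModuleCat.{u} R) n).obj (op X)).obj Y,
      ∃ (f : (ProjectiveResolution.of X).complex.X n ⟶ Y)
        (hf : (ProjectiveResolution.of X).complex.d (n + 1) n ≫ f = 0),
        (ProjectiveResolution.of X).extMk f (n + 1) rfl hf = e ∧
        oldEl (ProjectiveResolution.of X) f hf = x := by
  obtain ⟨f, hf, h⟩ := (ProjectiveResolution.of X).extMk_surjective e (n + 1) rfl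
  exact ⟨_, f, hf, h, rfl⟩

/-- The comparison map between the two models of `Ext`, as a function. -/
def extComparisonFun (X Y : ModuleCat.{u} R) (n : ℕ) (e : Abelian.Ext X Y n) :
    ((_root_.Ext R (ModuleCat.{u} R) n).obj (op X)).obj Y :=
  (extComparison_aux X Y n e).choose

theorem oldEl_congr {X Y : ModuleCat.{u} R} (P : ProjectiveResolution X) {n : ℕ}
    (f g : P.complex.X n ⟶ Y) (hf : P.complex.d (n + 1) n ≫ f = 0)
    (hg : P.complex.d (n + 1) n ≫ g = 0)
    (h : P.extMk f (n + 1) rfl hf = P.extMk g (n + 1) rfl hg) : oldEl P f hf = oldEl P g hg := by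
  have h1 : oldEl P (f - g) (by simp [hf, hg]) = 0 := by
    rw [oldEl_eq_zero_iff, ← P.sub_extMk _ _ _ _ hf hg, h, sub_self]
  have h2 := oldEl_add P (f - g) g (by simp [hf, hg]) hg
  have h3 : ∀ k (hk : P.complex.d (n + 1) n ≫ k = 0), k = f → oldEl P k hk = oldEl P f hf := by
    rintro k hk rfl
    rfl
  exact (h3 _ _ (sub_add_cancel f g)).symm.trans (h2.trans (by rw [h1, zero_add]))

theorem extComparisonFun_extMk {X Y : ModuleCat.{u} R} {n : ℕ}
    (f : (ProjectiveResolution.of X).complex.X n ⟶ Y)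
    (hf : (ProjectiveResolution.of X).complex.d (n + 1) n ≫ f = 0) :
    extComparisonFun X Y n ((ProjectiveResolution.of X).extMk f (n + 1) rfl hf) =
      oldEl (ProjectiveResolution.of X) f hf := by
  obtain ⟨g, hg, h1, h2⟩ := (extComparison_aux X Y n
    ((ProjectiveResolution.of X).extMk f (n + 1) rfl hf)).choose_spec
  exact h2.symm.trans (oldEl_congr _ _ _ _ _ h1)

/-- The comparison between the two models of `Ext`. -/
def extComparison (X Y : ModuleCat.{u} R) (n : ℕ) :
    Abelian.Ext X Y n ≃ₗ[R] ((_root_.Ext R (ModuleCat.{u} R) n).obj (op X)).obj Y :=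
  LinearEquiv.ofBijective
    { toFun := extComparisonFun X Y n
      map_add' := by
        intro a b
        obtain ⟨f, hf, rfl⟩ := (ProjectiveResolution.of X).extMk_surjective a (n + 1) rfl
        obtain ⟨g, hg, rfl⟩ := (ProjectiveResolution.of X).extMk_surjective b (n + 1) rfl
        rw [ProjectiveResolution.add_extMk, extComparisonFun_extMk, extComparisonFun_extMk,
          extComparisonFun_extMk, oldEl_add _ f g hf hg]
      map_smul' := by
        intro r a
        obtain ⟨f, hf, rfl⟩ := (ProjectiveResolution.of X).extMk_surjective a (n + 1) rfl
        rw [smul_extMk, extComparisonFun_extMk, extComparisonFun_extMk, oldEl_smul _ f hf]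
        rfl }
    (by
      constructor
      · rw [← LinearMap.ker_eq_bot, LinearMap.ker_eq_bot']
        intro a ha
        obtain ⟨f, hf, rfl⟩ := (ProjectiveResolution.of X).extMk_surjective a (n + 1) rfl
        change extComparisonFun X Y n _ = 0 at ha
        rwa [extComparisonFun_extMk, oldEl_eq_zero_iff] at ha
      · intro x
        obtain ⟨f, hf, rfl⟩ := oldEl_surjective (ProjectiveResolution.of X) x
        exact ⟨_, extComparisonFun_extMk f hf⟩)

theorem extComparison_naturality {X X' : ModuleCat.{u} R} (Y : ModuleCat.{u} R) (g : X' ⟶ X)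
    (n : ℕ) (e : Abelian.Ext X Y n) :
    (((_root_.Ext R (ModuleCat.{u} R) n).map g.op).app Y).hom (extComparison X Y n e) =
      extComparison X' Y n ((Abelian.Ext.mk₀ g).comp e (zero_add n)) := by
  obtain ⟨f, hf, rfl⟩ := (ProjectiveResolution.of X).extMk_surjective e (n + 1) rfl
  rw [ProjectiveResolution.mk₀_comp_extMk f _ _ hf
    (resolutionHom (ProjectiveResolution.of X') (ProjectiveResolution.of X) g)]
  change _ = extComparisonFun X' Y n _
  rw [extComparisonFun_extMk, ← oldEl_naturality _ f hf]
  exact congrArg _ (extComparisonFun_extMk f hf)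

end Comparison

section LocalCohomologyModel

variable {R : Type u} [CommRing R]

/-- The projection between quotients of the ring. -/
def quotFac {I J : Ideal R} (h : I ≤ J) : ModuleCat.of R (R ⧸ I) ⟶ ModuleCat.of R (R ⧸ J) :=
  ModuleCat.ofHom (Submodule.mapQ _ _ LinearMap.id h)

theorem quotFac_comp {I J K : Ideal R} (h : I ≤ J) (h' : J ≤ K) :
    quotFac h ≫ quotFac h' = quotFac (h.trans h') := by
  ext
  rfl

theorem quotFac_self {I : Ideal R} (h : I ≤ I) : quotFac h = 𝟙 _ := by
  ext
  rfl

/-- Restriction of extension classes along a projection of quotients of the ring. -/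
def extPull {I J : Ideal R} (h : I ≤ J) (M : ModuleCat.{u} R) (i : ℕ) :
    Abelian.Ext (ModuleCat.of R (R ⧸ J)) M i →ₗ[R] Abelian.Ext (ModuleCat.of R (R ⧸ I)) M i :=
  (Abelian.Ext.mk₀ (quotFac h)).precompOfLinear R M (zero_add i)

theorem extPull_apply {I J : Ideal R} (h : I ≤ J) (M : ModuleCat.{u} R) (i : ℕ)
    (e : Abelian.Ext (ModuleCat.of R (R ⧸ J)) M i) :
    extPull h M i e = (Abelian.Ext.mk₀ (quotFac h)).comp e (zero_add i) := rfl

theorem extPull_extPull {I J K : Ideal R} (h : I ≤ J) (h' : J ≤ K) (M : ModuleCat.{u} R) (i : ℕ)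
    (e : Abelian.Ext (ModuleCat.of R (R ⧸ K)) M i) :
    extPull h M i (extPull h' M i e) = extPull (h.trans h') M i e := by
  simp only [extPull_apply]
  rw [Abelian.Ext.mk₀_comp_mk₀_assoc, quotFac_comp]

theorem extPull_self {I : Ideal R} (h : I ≤ I) (M : ModuleCat.{u} R) (i : ℕ)
    (e : Abelian.Ext (ModuleCat.of R (R ⧸ I)) M i) : extPull h M i e = e := by
  rw [extPull_apply, quotFac_self, Abelian.Ext.mk₀_id_comp]

theorem extPull_comp {I J : Ideal R} (h : I ≤ J) {M N : ModuleCat.{u} R} {i k j : ℕ}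
    (hij : i + k = j) (β : Abelian.Ext M N k) (e : Abelian.Ext (ModuleCat.of R (R ⧸ J)) M i) :
    extPull h N j (e.comp β hij) = (extPull h M i e).comp β hij := by
  simp only [extPull_apply]
  rw [Abelian.Ext.comp_assoc _ _ _ _ _ (by lia)]

variable (J : Ideal R)

instance extPull_directedSystem (M : ModuleCat.{u} R) (i : ℕ) :
    DirectedSystem (fun n : ℕ => Abelian.Ext (ModuleCat.of R (R ⧸ J ^ n)) M i)
      (fun _ _ h => extPull (Ideal.pow_le_pow_right h) M i) where
  map_self _ _ := extPull_self _ _ _ _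
  map_map _ _ _ _ _ _ := extPull_extPull _ _ _ _ _

/-- Local cohomology as the direct limit of `Ext (R / J ^ n, M)`. -/
abbrev LC (M : ModuleCat.{u} R) (i : ℕ) : Type u :=
  Module.DirectLimit (fun n : ℕ => Abelian.Ext (ModuleCat.of R (R ⧸ J ^ n)) M i)
    (fun _ _ h => extPull (Ideal.pow_le_pow_right h) M i)

/-- The class in local cohomology of an extension class. -/
def LC.cls (M : ModuleCat.{u} R) (i n : ℕ) :
    Abelian.Ext (ModuleCat.of R (R ⧸ J ^ n)) M i →ₗ[R] LC J M i :=
  Module.DirectLimit.of R ℕ (fun n : ℕ => Abelian.Ext (ModuleCat.of R (R ⧸ J ^ n)) M i)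
    (fun _ _ h => extPull (Ideal.pow_le_pow_right h) M i) n

variable {J}

theorem LC.exists_cls {M : ModuleCat.{u} R} {i : ℕ} (x : LC J M i) :
    ∃ n e, LC.cls J M i n e = x :=
  Module.DirectLimit.exists_of (R := R) (ι := ℕ) x

theorem LC.cls_extPull {M : ModuleCat.{u} R} {i n n' : ℕ} (h : n ≤ n')
    (e : Abelian.Ext (ModuleCat.of R (R ⧸ J ^ n)) M i) :
    LC.cls J M i n' (extPull (Ideal.pow_le_pow_right h) M i e) = LC.cls J M i n e :=
  Module.DirectLimit.of_f (hij := h)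

theorem LC.cls_eq_zero_iff {M : ModuleCat.{u} R} {i n : ℕ}
    (e : Abelian.Ext (ModuleCat.of R (R ⧸ J ^ n)) M i) :
    LC.cls J M i n e = 0 ↔
      ∃ n', ∃ h : n ≤ n', extPull (Ideal.pow_le_pow_right h) M i e = 0 := by
  constructor
  · intro h
    exact Module.DirectLimit.of.zero_exact h
  · rintro ⟨n', h, h0⟩
    rw [← LC.cls_extPull h, h0, map_zero]

/-- Postcomposition with an extension class on local cohomology. -/
def LC.post {M N : ModuleCat.{u} R} {k : ℕ} (β : Abelian.Ext M N k) {i j : ℕ} (hij : i + k = j) :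
    LC J M i →ₗ[R] LC J N j :=
  Module.DirectLimit.map
    (fun n => β.postcompOfLinear R (ModuleCat.of R (R ⧸ J ^ n)) hij)
    (fun n n' h => by
      ext e
      exact (extPull_comp _ hij β e).symm)

theorem LC.post_cls {M N : ModuleCat.{u} R} {k : ℕ} (β : Abelian.Ext M N k) {i j : ℕ}
    (hij : i + k = j) (n : ℕ) (e : Abelian.Ext (ModuleCat.of R (R ⧸ J ^ n)) M i) :
    LC.post (J := J) β hij (LC.cls J M i n e) = LC.cls J N j n (e.comp β hij) :=
  Module.DirectLimit.map_apply_of _ _ _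

theorem LC.exact₂ {S : ShortComplex (ModuleCat.{u} R)} (hS : S.ShortExact) {i : ℕ}
    (x : LC J S.X₂ i) (hx : LC.post (Abelian.Ext.mk₀ S.g) (add_zero i) x = 0) :
    ∃ y, LC.post (Abelian.Ext.mk₀ S.f) (add_zero i) y = x := by
  obtain ⟨n, e, rfl⟩ := LC.exists_cls x
  rw [LC.post_cls, LC.cls_eq_zero_iff] at hx
  obtain ⟨n', h, h0⟩ := hx
  rw [extPull_comp] at h0
  obtain ⟨e', he'⟩ := Abelian.Ext.covariant_sequence_exact₂ _ hS _ h0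
  exact ⟨LC.cls J _ _ n' e', by rw [LC.post_cls, he', LC.cls_extPull h]⟩

theorem LC.exact₃ {S : ShortComplex (ModuleCat.{u} R)} (hS : S.ShortExact) {i : ℕ}
    (x : LC J S.X₃ i) (hx : LC.post hS.extClass (rfl : i + 1 = i + 1) x = 0) :
    ∃ y, LC.post (Abelian.Ext.mk₀ S.g) (add_zero i) y = x := by
  obtain ⟨n, e, rfl⟩ := LC.exists_cls x
  rw [LC.post_cls, LC.cls_eq_zero_iff] at hx
  obtain ⟨n', h, h0⟩ := hx
  rw [extPull_comp] at h0
  obtain ⟨e', he'⟩ := Abelian.Ext.covariant_sequence_exact₃ _ hS _ _ h0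
  exact ⟨LC.cls J _ _ n' e', by rw [LC.post_cls, he', LC.cls_extPull h]⟩

theorem LC.exact₁ {S : ShortComplex (ModuleCat.{u} R)} (hS : S.ShortExact) {i : ℕ}
    (x : LC J S.X₁ (i + 1)) (hx : LC.post (Abelian.Ext.mk₀ S.f) (add_zero (i + 1)) x = 0) :
    ∃ y, LC.post hS.extClass (rfl : i + 1 = i + 1) y = x := by
  obtain ⟨n, e, rfl⟩ := LC.exists_cls x
  rw [LC.post_cls, LC.cls_eq_zero_iff] at hx
  obtain ⟨n', h, h0⟩ := hx
  rw [extPull_comp] at h0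
  obtain ⟨e', he'⟩ := Abelian.Ext.covariant_sequence_exact₁ _ hS _ h0 rfl
  exact ⟨LC.cls J _ _ n' e', by rw [LC.post_cls, he', LC.cls_extPull h]⟩

end LocalCohomologyModel

section Link

variable {R : Type u} [CommRing R] [IsNoetherianRing R] (J : Ideal R)

instance selfLERadical_isCofiltered : IsCofiltered (localCohomology.SelfLERadical J) where
  cone_objs X Y := ⟨⟨X.obj ⊓ Y.obj, by
      change J ≤ (X.obj ⊓ Y.obj).radical
      rw [Ideal.radical_inf]
      exact le_inf X.property Y.property⟩,
    ObjectProperty.homMk (homOfLE inf_le_left), ObjectProperty.homMk (homOfLE inf_le_right),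
    trivial⟩
  cone_maps X Y f g := ⟨X, 𝟙 X, rfl⟩

/-- Local cohomology as a cocone over the diagram of all ideals whose radical contains `J`. -/
def lcCocone (i : ℕ) :
    Cocone (localCohomology.diagram (localCohomology.selfLERadicalDiagram J) i) :=
  haveI := localCohomology.hasColimitDiagram.{u, u} (localCohomology.selfLERadicalDiagram J) i
  (colimit.cocone _).extend (localCohomology.isoSelfLERadical J i).hom

/-- The cocone `lcCocone` is a colimit. -/
def lcCoconeIsColimit (i : ℕ) : IsColimit (lcCocone J i) :=
  haveI := localCohomology.hasColimitDiagram.{u, u} (localCohomology.selfLERadicalDiagram J) i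
  (colimit.isColimit _).ofIsoColimit
    (Cocone.ext (localCohomology.isoSelfLERadical J i) (fun _ => rfl))

theorem canonical_surjective (p : ℕ) (y : (localCohomology J p).obj (ModuleCat.of R R)) :
    ∃ q h x, canonicalToLocalCohomology R J q h p x = y := by
  obtain ⟨⟨⟨q, h⟩⟩, x, hx⟩ := Concrete.isColimit_exists_rep _
    (isColimitOfPreserves ((evaluation (ModuleCat.{u} R) (ModuleCat.{u} R)).obj
      (ModuleCat.of R R)) (lcCoconeIsColimit J p)) y
  exact ⟨q, h, x, hx⟩

theorem canonical_extPull {q q' : Ideal R} (h : J ≤ q.radical) (h' : J ≤ q'.radical) (hq : q ≤ q')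
    (p : ℕ) (e : Abelian.Ext (ModuleCat.of R (R ⧸ q')) (ModuleCat.of R R) p) :
    canonicalToLocalCohomology R J q h p (extComparison (ModuleCat.of R (R ⧸ q)) (ModuleCat.of R R) p (extPull hq _ p e)) =
      canonicalToLocalCohomology R J q' h' p (extComparison (ModuleCat.of R (R ⧸ q')) (ModuleCat.of R R) p e) := by
  let g : (⟨q, h⟩ : localCohomology.SelfLERadical J) ⟶ ⟨q', h'⟩ :=
    ObjectProperty.homMk (homOfLE hq)
  have := congrArg (fun t => t.app (ModuleCat.of R R)) ((lcCocone J p).w g.op)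
  have := congrArg (fun t => t.hom (extComparison (ModuleCat.of R (R ⧸ q')) (ModuleCat.of R R) p e)) this
  rw [extPull_apply, ← extComparison_naturality]
  exact this

theorem canonical_eq_zero {q : Ideal R} (h : J ≤ q.radical)
    (p : ℕ) (e : Abelian.Ext (ModuleCat.of R (R ⧸ q)) (ModuleCat.of R R) p)
    (he : canonicalToLocalCohomology R J q h p (extComparison (ModuleCat.of R (R ⧸ q)) (ModuleCat.of R R) p e) = 0) :
    ∃ q', ∃ hq : q' ≤ q, J ≤ q'.radical ∧ extPull hq _ p e = 0 := by
  obtain ⟨⟨⟨q', h'⟩⟩, f, g, hfg⟩ := Concrete.isColimit_exists_of_rep_eq _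
    (isColimitOfPreserves ((evaluation (ModuleCat.{u} R) (ModuleCat.{u} R)).obj
      (ModuleCat.of R R)) (lcCoconeIsColimit J p)) (i := op ⟨q, h⟩) (j := op ⟨q, h⟩)
      (extComparison _ _ p e) (0 : ((_root_.Ext R (ModuleCat.{u} R) p).obj
        (op (ModuleCat.of R (R ⧸ q)))).obj (ModuleCat.of R R)) (he.trans (map_zero _).symm)
  have hq : q' ≤ q := f.unop.hom.down.down
  refine ⟨q', hq, h', ?_⟩
  apply (extComparison _ _ p).injective
  rw [extPull_apply, ← extComparison_naturality, map_zero]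
  exact hfg.trans (map_zero _)

omit [IsNoetherianRing R] in
theorem le_radical_pow (n : ℕ) : J ≤ (J ^ n).radical := fun x hx =>
  ⟨n, Ideal.pow_mem_pow hx n⟩

/-- The map from the power model of local cohomology to local cohomology. -/
def lcToHmod (p : ℕ) :
    LC J (ModuleCat.of R R) p →ₗ[R] (localCohomology J p).obj (ModuleCat.of R R) :=
  Module.DirectLimit.lift R ℕ (fun n : ℕ => Abelian.Ext (ModuleCat.of R (R ⧸ J ^ n)) _ p)
    (fun _ _ h => extPull (Ideal.pow_le_pow_right h) _ p)
    (fun n => (canonicalToLocalCohomology R J (J ^ n) (le_radical_pow J n) p).hom ∘ₗ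
      (extComparison (ModuleCat.of R (R ⧸ J ^ n)) (ModuleCat.of R R) p).toLinearMap)
    (fun _ _ h e => canonical_extPull J (le_radical_pow J _) (le_radical_pow J _)
      (Ideal.pow_le_pow_right h) p e)

theorem lcToHmod_cls (p n : ℕ) (e : Abelian.Ext (ModuleCat.of R (R ⧸ J ^ n)) _ p) :
    lcToHmod J p (LC.cls J _ p n e) =
      canonicalToLocalCohomology R J (J ^ n) (le_radical_pow J n) p
        (extComparison (ModuleCat.of R (R ⧸ J ^ n)) (ModuleCat.of R R) p e) :=
  Module.DirectLimit.lift_of _ _ _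

theorem lcToHmod_cls_extPull (p : ℕ) {n : ℕ} {q : Ideal R} (hq : J ^ n ≤ q) (h : J ≤ q.radical)
    (e : Abelian.Ext (ModuleCat.of R (R ⧸ q)) (ModuleCat.of R R) p) :
    lcToHmod J p (LC.cls J _ p n (extPull hq _ p e)) =
      canonicalToLocalCohomology R J q h p
        (extComparison (ModuleCat.of R (R ⧸ q)) (ModuleCat.of R R) p e) := by
  rw [lcToHmod_cls, canonical_extPull]

theorem lcToHmod_injective (p : ℕ) : Function.Injective (lcToHmod J p) := by
  rw [← LinearMap.ker_eq_bot, LinearMap.ker_eq_bot']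
  intro x hx
  obtain ⟨n, e, rfl⟩ := LC.exists_cls x
  rw [lcToHmod_cls] at hx
  obtain ⟨q', hq, h', h0⟩ := canonical_eq_zero J _ p e hx
  obtain ⟨k, hk⟩ := Ideal.exists_pow_le_of_le_radical_of_fg h' (IsNoetherian.noetherian J)
  rw [LC.cls_eq_zero_iff]
  refine ⟨max n k, le_max_left _ _, ?_⟩
  have hk' : J ^ max n k ≤ q' := (Ideal.pow_le_pow_right (le_max_right _ _)).trans hk
  rw [← extPull_extPull hk' hq, h0, map_zero]

theorem lcToHmod_surjective (p : ℕ) : Function.Surjective (lcToHmod J p) := by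
  intro y
  obtain ⟨q, h, x, rfl⟩ := canonical_surjective J p y
  obtain ⟨e, rfl⟩ := (extComparison (ModuleCat.of R (R ⧸ q)) (ModuleCat.of R R) p).surjective x
  obtain ⟨k, hk⟩ := Ideal.exists_pow_le_of_le_radical_of_fg h (IsNoetherian.noetherian J)
  exact ⟨_, lcToHmod_cls_extPull J p hk h e⟩

/-- Local cohomology of the ring agrees with the power model. -/
def lcEquiv (p : ℕ) :
    LC J (ModuleCat.of R R) p ≃ₗ[R] (localCohomology J p).obj (ModuleCat.of R R) :=
  LinearEquiv.ofBijective (lcToHmod J p) ⟨lcToHmod_injective J p, lcToHmod_surjective J p⟩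

end Link

section LCBasic

variable {R : Type u} [CommRing R] (J : Ideal R)
variable {M N P : Type u} [AddCommGroup M] [Module R M] [AddCommGroup N] [Module R N]
  [AddCommGroup P] [Module R P]

/-- Local cohomology of an unbundled module. -/
abbrev LCH (M : Type u) [AddCommGroup M] [Module R M] (i : ℕ) : Type u :=
  LC J (ModuleCat.of R M) i

/-- Functoriality of local cohomology. -/
def LCH.map (f : M →ₗ[R] N) (i : ℕ) : LCH J M i →ₗ[R] LCH J N i :=
  LC.post (Abelian.Ext.mk₀ (ModuleCat.ofHom f)) (add_zero i)

variable {J}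

theorem LCH.map_cls (f : M →ₗ[R] N) (i n : ℕ)
    (e : Abelian.Ext (ModuleCat.of R (R ⧸ J ^ n)) (ModuleCat.of R M) i) :
    LCH.map J f i (LC.cls J _ i n e) =
      LC.cls J _ i n (e.comp (Abelian.Ext.mk₀ (ModuleCat.ofHom f)) (add_zero i)) :=
  LC.post_cls _ _ _ _

theorem LCH.map_comp (g : N →ₗ[R] P) (f : M →ₗ[R] N) (i : ℕ) (x : LCH J M i) :
    LCH.map J (g ∘ₗ f) i x = LCH.map J g i (LCH.map J f i x) := by
  obtain ⟨n, e, rfl⟩ := LC.exists_cls x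
  rw [LCH.map_cls, LCH.map_cls, LCH.map_cls, Abelian.Ext.comp_assoc_of_third_deg_zero,
    Abelian.Ext.mk₀_comp_mk₀, ModuleCat.ofHom_comp]

theorem LCH.map_smul_id (r : R) (i : ℕ) (x : LCH J M i) :
    LCH.map J (r • (LinearMap.id : M →ₗ[R] M)) i x = r • x := by
  obtain ⟨n, e, rfl⟩ := LC.exists_cls x
  rw [LCH.map_cls, ← map_smul, Abelian.Ext.smul_eq_comp_mk₀]
  rfl

theorem LCH.map_id (i : ℕ) (x : LCH J M i) :
    LCH.map J (LinearMap.id : M →ₗ[R] M) i x = x := by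
  have := LCH.map_smul_id (1 : R) i x
  rwa [one_smul, one_smul] at this

theorem ext_smul_eq_zero {I : Ideal R} {r : R} (hr : r ∈ I) {X : ModuleCat.{u} R} {i : ℕ}
    (e : Abelian.Ext (ModuleCat.of R (R ⧸ I)) X i) : r • e = 0 := by
  have h : r • 𝟙 (ModuleCat.of R (R ⧸ I)) = 0 := by
    ext
    change r • Submodule.Quotient.mk (p := I) (1 : R) = 0
    rw [← Submodule.Quotient.mk_smul, Submodule.Quotient.mk_eq_zero]
    simpa using hr
  rw [← Abelian.Ext.mk₀_id_comp e, ← Abelian.Ext.smul_comp, ← Abelian.Ext.mk₀_smul, h,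
    Abelian.Ext.mk₀_zero, Abelian.Ext.zero_comp]

theorem LC.torsion {X : ModuleCat.{u} R} {i : ℕ} (x : LC J X i) :
    ∃ n, ∀ r ∈ J ^ n, r • x = 0 := by
  obtain ⟨n, e, rfl⟩ := LC.exists_cls x
  refine ⟨n, fun r hr => ?_⟩
  rw [← map_smul, ext_smul_eq_zero hr, map_zero]

theorem LCH.subsingleton_of_bijective_smul {r : R} (hr : r ∈ J)
    (h : Function.Bijective (r • (LinearMap.id : M →ₗ[R] M))) (i : ℕ) :
    Subsingleton (LCH J M i) := by
  have inj : ∀ x : LCH J M i, r • x = 0 → x = 0 := by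
    intro x hx
    let e := LinearEquiv.ofBijective _ h
    have h1 : LCH.map J e.symm.toLinearMap i (LCH.map J (r • LinearMap.id) i x) = x := by
      rw [← LCH.map_comp]
      have : e.symm.toLinearMap ∘ₗ (r • LinearMap.id) = LinearMap.id := by
        ext y
        exact e.symm_apply_apply y
      rw [this, LCH.map_id]
    rw [LCH.map_smul_id, hx, map_zero] at h1
    exact h1.symm
  refine subsingleton_of_forall_eq 0 fun x => ?_
  obtain ⟨n, hn⟩ := LC.torsion x
  have := hn _ (Ideal.pow_mem_pow hr n)
  clear hn
  induction n with
  | zero => simpa using this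
  | succ n ih => exact ih (inj _ (by rwa [smul_smul, ← pow_succ']))

theorem LCH.subsingleton_of_injective [hM : Injective (ModuleCat.of R M)] (i : ℕ) :
    Subsingleton (LCH J M (i + 1)) := by
  refine subsingleton_of_forall_eq 0 fun x => ?_
  obtain ⟨n, e, rfl⟩ := LC.exists_cls x
  rw [Abelian.Ext.eq_zero_of_injective e, map_zero]

theorem LC.les {S : ShortComplex (ModuleCat.{u} R)} (hS : S.ShortExact) (i : ℕ) :
    Function.Exact (LC.post (J := J) (Abelian.Ext.mk₀ S.f) (add_zero i))
      (LC.post (J := J) (Abelian.Ext.mk₀ S.g) (add_zero i)) ∧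
    ∃ δ : LC J S.X₃ i →ₗ[R] LC J S.X₁ (i + 1),
      Function.Exact (LC.post (J := J) (Abelian.Ext.mk₀ S.g) (add_zero i)) δ ∧
      Function.Exact δ (LC.post (J := J) (Abelian.Ext.mk₀ S.f) (add_zero (i + 1))) := by
  refine ⟨fun x => ⟨fun h => LC.exact₂ hS x h, ?_⟩, LC.post hS.extClass rfl,
    fun x => ⟨fun h => LC.exact₃ hS x h, ?_⟩, fun x => ⟨fun h => LC.exact₁ hS x h, ?_⟩⟩
  · rintro ⟨y, rfl⟩
    obtain ⟨n, e, rfl⟩ := LC.exists_cls y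
    rw [LC.post_cls, LC.post_cls, Abelian.Ext.comp_assoc_of_third_deg_zero,
      Abelian.Ext.mk₀_comp_mk₀, S.zero, Abelian.Ext.mk₀_zero, Abelian.Ext.comp_zero, map_zero]
  · rintro ⟨y, rfl⟩
    obtain ⟨n, e, rfl⟩ := LC.exists_cls y
    rw [LC.post_cls, LC.post_cls, Abelian.Ext.comp_assoc_of_second_deg_zero, hS.comp_extClass,
      Abelian.Ext.comp_zero, map_zero]
  · rintro ⟨y, rfl⟩
    obtain ⟨n, e, rfl⟩ := LC.exists_cls y
    rw [LC.post_cls, LC.post_cls, Abelian.Ext.comp_assoc_of_third_deg_zero, hS.extClass_comp,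
      Abelian.Ext.comp_zero, map_zero]

/-- The long exact sequence of local cohomology. -/
theorem LCH.les {f : M →ₗ[R] N} {g : N →ₗ[R] P} (hf : Function.Injective f)
    (hfg : Function.Exact f g) (hg : Function.Surjective g) (i : ℕ) :
    Function.Exact (LCH.map J f i) (LCH.map J g i) ∧ ∃ δ : LCH J P i →ₗ[R] LCH J M (i + 1),
      Function.Exact (LCH.map J g i) δ ∧ Function.Exact δ (LCH.map J f (i + 1)) :=
  LC.les (S := ModuleCat.shortComplexOfCompEqZero f g hfg.linearMap_comp_eq_zero)
    (ModuleCat.shortComplex_shortExact _ hfg hf hg) i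

theorem LCH.subsingleton_congr (e : M ≃ₗ[R] N) (i : ℕ) (h : Subsingleton (LCH J N i)) :
    Subsingleton (LCH J M i) := by
  refine subsingleton_of_forall_eq 0 fun x => ?_
  have : LCH.map J e.symm.toLinearMap i (LCH.map J e.toLinearMap i x) = x := by
    rw [← LCH.map_comp]
    simp only [LinearEquiv.comp_coe, LinearEquiv.self_trans_symm, LinearEquiv.refl_toLinearMap]
    exact LCH.map_id _ _
  rw [← this, Subsingleton.elim (LCH.map J e.toLinearMap i x) 0, map_zero]

/-- Evaluation at the unit of the degree zero local cohomology. -/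
def LCH.eval (M : Type u) [AddCommGroup M] [Module R M] : LCH J M 0 →ₗ[R] M :=
  Module.DirectLimit.lift R ℕ
    (fun n : ℕ => Abelian.Ext (ModuleCat.of R (R ⧸ J ^ n)) (ModuleCat.of R M) 0)
    (fun _ _ h => extPull (Ideal.pow_le_pow_right h) _ 0)
    (fun n =>
      { toFun e := (Abelian.Ext.linearEquiv₀ (R := R) e).hom (Submodule.Quotient.mk (1 : R))
        map_add' a b := by rw [map_add]; rfl
        map_smul' r a := by rw [map_smul]; rfl })
    (fun n n' h e => by
      obtain ⟨f, rfl⟩ := (Abelian.Ext.linearEquiv₀ (R := R)).symm.surjective e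
      have h1 : extPull (Ideal.pow_le_pow_right h) (ModuleCat.of R M) 0
          ((Abelian.Ext.linearEquiv₀ (R := R)).symm f) = (Abelian.Ext.linearEquiv₀ (R := R)).symm
            (quotFac (Ideal.pow_le_pow_right h) ≫ f) :=
        Abelian.Ext.mk₀_comp_mk₀ _ _
      rw [h1]
      refine (congrArg (fun t : ModuleCat.of R (R ⧸ J ^ n') ⟶ ModuleCat.of R M =>
        t.hom (Submodule.Quotient.mk (1 : R)))
        ((Abelian.Ext.linearEquiv₀ (R := R)).apply_symm_apply _)).trans ?_
      exact (congrArg (fun t : ModuleCat.of R (R ⧸ J ^ n) ⟶ ModuleCat.of R M =>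
        t.hom (Submodule.Quotient.mk (1 : R)))
        ((Abelian.Ext.linearEquiv₀ (R := R)).apply_symm_apply f)).symm)

theorem LCH.eval_cls_mk₀ (n : ℕ) (f : ModuleCat.of R (R ⧸ J ^ n) ⟶ ModuleCat.of R M) :
    LCH.eval M (LC.cls J _ 0 n (Abelian.Ext.mk₀ f)) = f.hom (Submodule.Quotient.mk (1 : R)) := by
  refine (Module.DirectLimit.lift_of _ _ _).trans ?_
  exact congrArg (fun t : ModuleCat.of R (R ⧸ J ^ n) ⟶ ModuleCat.of R M => t.hom (Submodule.Quotient.mk (1 : R)))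
    ((Abelian.Ext.linearEquiv₀ (R := R)).apply_symm_apply f)

theorem LCH.exists_cls_mk₀ (x : LCH J M 0) :
    ∃ n, ∃ f : ModuleCat.of R (R ⧸ J ^ n) ⟶ ModuleCat.of R M,
      LC.cls J _ 0 n (Abelian.Ext.mk₀ f) = x := by
  obtain ⟨n, e, rfl⟩ := LC.exists_cls x
  exact ⟨n, Abelian.Ext.linearEquiv₀ (R := R) e, by rw [Abelian.Ext.mk₀_linearEquiv₀_apply]⟩

theorem LCH.eval_map (f : M →ₗ[R] N) (x : LCH J M 0) :
    LCH.eval N (LCH.map J f 0 x) = f (LCH.eval M x) := by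
  obtain ⟨n, k, rfl⟩ := LCH.exists_cls_mk₀ x
  rw [LCH.map_cls, Abelian.Ext.mk₀_comp_mk₀, LCH.eval_cls_mk₀, LCH.eval_cls_mk₀]
  rfl

theorem LCH.eval_injective : Function.Injective (LCH.eval (J := J) M) := by
  rw [← LinearMap.ker_eq_bot, LinearMap.ker_eq_bot']
  intro x hx
  obtain ⟨n, k, rfl⟩ := LCH.exists_cls_mk₀ x
  rw [LCH.eval_cls_mk₀] at hx
  have : k = 0 := by
    ext
    exact hx
  rw [this, Abelian.Ext.mk₀_zero, map_zero]

theorem LCH.eval_range {m : M} {n : ℕ} (h : ∀ r ∈ J ^ n, r • m = 0) :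
    ∃ x, LCH.eval (J := J) M x = m :=
  ⟨LC.cls J _ 0 n (Abelian.Ext.mk₀ (ModuleCat.ofHom
    ((J ^ n).liftQ (LinearMap.toSpanSingleton R M m) h))), by
      rw [LCH.eval_cls_mk₀]
      exact (Submodule.liftQ_apply _ _ _).trans (one_smul R m)⟩

end LCBasic

section Vanishing

variable {R : Type u} [CommRing R]

/-- The submodule of elements killed by a power of `J`. -/
def gammaSub (J : Ideal R) (M : Type u) [AddCommGroup M] [Module R M] : Submodule R M where
  carrier := {x | ∃ n, ∀ r ∈ J ^ n, r • x = 0}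
  zero_mem' := ⟨0, fun _ _ => smul_zero _⟩
  add_mem' := by
    rintro a b ⟨n, hn⟩ ⟨k, hk⟩
    refine ⟨n + k, fun r hr => ?_⟩
    rw [smul_add, hn r (Ideal.pow_le_pow_right (Nat.le_add_right _ _) hr),
      hk r (Ideal.pow_le_pow_right (Nat.le_add_left _ _) hr), add_zero]
  smul_mem' := by
    rintro c a ⟨n, hn⟩
    exact ⟨n, fun r hr => by rw [smul_comm, hn r hr, smul_zero]⟩

theorem mem_gammaSub_of_gens {J : Ideal R} {M : Type u} [AddCommGroup M] [Module R M]
    {s : ℕ} {x : Fin s → R} {N : ℕ} (hN : J ^ N ≤ Ideal.span (Set.range x)) {m : M}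
    (hm : ∀ l, ∃ n, x l ^ n • m = 0) : m ∈ gammaSub J M := by
  have h1 : Ideal.span (Set.range x) ≤ Ideal.radical
      (LinearMap.ker (LinearMap.toSpanSingleton R M m)) := by
    rw [Ideal.span_le]
    rintro _ ⟨l, rfl⟩
    obtain ⟨n, hn⟩ := hm l
    exact ⟨n, hn⟩
  obtain ⟨k, hk⟩ := Ideal.exists_pow_le_of_le_radical_of_fg h1
    (Submodule.fg_span (Set.finite_range x))
  refine ⟨N * k, fun r hr => ?_⟩
  rw [pow_mul] at hr
  exact hk (Ideal.pow_right_mono hN k hr)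

variable (J : Ideal R)

theorem exists_pow_smul_of_fg {M : Type u} [AddCommGroup M] [Module R M] (S : Submodule R M)
    (hS : S.FG) (h : S ≤ gammaSub J M) : ∃ n, ∀ r ∈ J ^ n, ∀ x ∈ S, r • x = 0 := by
  induction S, hS using Submodule.fg_induction with
  | singleton x =>
    obtain ⟨n, hn⟩ := h (Submodule.mem_span_singleton_self x)
    refine ⟨n, fun r hr y hy => ?_⟩
    obtain ⟨c, rfl⟩ := Submodule.mem_span_singleton.mp hy
    rw [smul_comm, hn r hr, smul_zero]
  | sup S T hS hT h1 h2 =>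
    obtain ⟨n, hn⟩ := h1 (le_sup_left.trans h)
    obtain ⟨k, hk⟩ := h2 (le_sup_right.trans h)
    refine ⟨n + k, fun r hr x hx => ?_⟩
    obtain ⟨y, hy, z, hz, rfl⟩ := Submodule.mem_sup.mp hx
    rw [smul_add, hn r (Ideal.pow_le_pow_right (Nat.le_add_right _ _) hr) y hy,
      hk r (Ideal.pow_le_pow_right (Nat.le_add_left _ _) hr) z hz, add_zero]

theorem gammaSub_injective [IsNoetherianRing R] (E : Type u) [AddCommGroup E] [Module R E] (hE : Module.Injective R E) :
    Module.Injective R (gammaSub J E) := by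
  apply Module.Baer.injective
  intro I g
  obtain ⟨k, hk⟩ := exists_pow_smul_of_fg J (LinearMap.range ((gammaSub J E).subtype ∘ₗ g))
    (by
      rw [← Submodule.map_top]
      exact (IsNoetherian.noetherian (⊤ : Submodule R I)).map _) (by
      rintro _ ⟨y, rfl⟩
      exact (g y).2)
  obtain ⟨c, hc⟩ := Ideal.exists_pow_inf_eq_pow_smul J (M := R) I
  have hAR : ∀ y (hy : y ∈ I), y ∈ J ^ (c + k) → g ⟨y, hy⟩ = 0 := by
    intro y hy hyJ
    have h1 : y ∈ J ^ (c + k) • (⊤ : Submodule R R) ⊓ I := ⟨by simpa using hyJ, hy⟩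
    rw [hc _ (Nat.le_add_right _ _), Nat.add_sub_cancel_left] at h1
    have h2 : y ∈ J ^ k • (I : Submodule R R) := Submodule.smul_mono le_rfl inf_le_right h1
    have h3 : ∀ z ∈ J ^ k • (I : Submodule R R), ∃ hz : z ∈ I, g ⟨z, hz⟩ = 0 := by
      intro z hz
      induction hz using Submodule.smul_induction_on' with
      | smul r hr w hw =>
        refine ⟨I.mul_mem_left r hw, ?_⟩
        have h4 := hk r hr _ ⟨⟨w, hw⟩, rfl⟩
        have h5 : g ⟨r • w, I.mul_mem_left r hw⟩ = r • g ⟨w, hw⟩ := by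
          rw [← map_smul]
          rfl
        exact h5.trans (Subtype.ext h4)
      | add a _ b _ ha hb =>
        obtain ⟨ha, ha'⟩ := ha
        obtain ⟨hb, hb'⟩ := hb
        refine ⟨I.add_mem ha hb, ?_⟩
        have h5 : g ⟨a + b, I.add_mem ha hb⟩ = g ⟨a, ha⟩ + g ⟨b, hb⟩ := by
          rw [← map_add]
          rfl
        rw [h5, ha', hb', add_zero]
    exact (h3 y h2).2
  let S := J ^ (c + k)
  let e : (I × S) →ₗ[R] R := I.subtype.coprod S.subtype
  let f : (I × S) →ₗ[R] E := ((gammaSub J E).subtype ∘ₗ g) ∘ₗ LinearMap.fst R I S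
  have hker : LinearMap.ker e ≤ LinearMap.ker f := by
    rintro ⟨⟨a, ha⟩, ⟨b, hb⟩⟩ hab
    have hab' : a + b = 0 := hab
    have : g ⟨a, ha⟩ = 0 := hAR a ha (by
      rw [eq_neg_of_add_eq_zero_left hab']
      exact S.neg_mem hb)
    change ((g ⟨a, ha⟩ : gammaSub J E) : E) = 0
    rw [this]
    rfl
  obtain ⟨h, hh⟩ := (Module.Baer.of_injective hE) (LinearMap.range e)
    ((LinearMap.ker e).liftQ f hker ∘ₗ e.quotKerEquivRange.symm.toLinearMap)
  have hh' : ∀ p, h (e p) = f p := by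
    intro p
    rw [hh (e p) ⟨p, rfl⟩]
    have : e.quotKerEquivRange.symm ⟨e p, ⟨p, rfl⟩⟩ = Submodule.Quotient.mk p := by
      rw [LinearEquiv.symm_apply_eq]
      rfl
    change (LinearMap.ker e).liftQ f hker (e.quotKerEquivRange.symm ⟨e p, _⟩) = _
    rw [this]
    rfl
  have h1 : h 1 ∈ gammaSub J E := by
    refine ⟨c + k, fun r hr => ?_⟩
    rw [← map_smul, smul_eq_mul, mul_one]
    have := hh' (0, ⟨r, hr⟩)
    simpa [e, f] using this
  refine ⟨LinearMap.toSpanSingleton R _ ⟨h 1, h1⟩, fun x hx => ?_⟩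
  have := hh' (⟨x, hx⟩, 0)
  apply Subtype.ext
  change x • h 1 = _
  rw [← map_smul, smul_eq_mul, mul_one]
  simpa [e, f] using this

variable {J}

theorem gammaSub_quotient {M : Type u} [AddCommGroup M] [Module R M] (h : gammaSub J M = ⊤)
    (S : Submodule R M) : gammaSub J (M ⧸ S) = ⊤ := by
  rw [eq_top_iff]
  rintro x -
  obtain ⟨x, rfl⟩ := S.mkQ_surjective x
  obtain ⟨n, hn⟩ : x ∈ gammaSub J M := h ▸ Submodule.mem_top
  exact ⟨n, fun r hr => by rw [← map_smul, hn r hr, map_zero]⟩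

/-- Local cohomology of torsion modules vanishes in positive degrees. -/
theorem LCH.subsingleton_of_torsion [IsNoetherianRing R] (i : ℕ) : ∀ {M : Type u} [AddCommGroup M] [Module R M],
    gammaSub J M = ⊤ → Subsingleton (LCH J M (i + 1)) := by
  have key : ∀ (i : ℕ) {M : Type u} [AddCommGroup M] [Module R M], gammaSub J M = ⊤ →
      (∀ {G : Type u} [AddCommGroup G] [Module R G] (f : M →ₗ[R] G) (S : Submodule R G)
        (δ : LCH J (G ⧸ S) i →ₗ[R] LCH J M (i + 1)), gammaSub J G = ⊤ →
        Function.Exact (LCH.map J S.mkQ i) δ → ∀ x, δ x = 0) →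
      Subsingleton (LCH J M (i + 1)) := by
    intro i M _ _ h hδ
    let E := Injective.under (ModuleCat.of R M)
    let f : M →ₗ[R] E := (Injective.ι (ModuleCat.of R M)).hom
    have hf : Function.Injective f := (ModuleCat.mono_iff_injective _).mp inferInstance
    have hE' : Injective (ModuleCat.of R E) :=
      inferInstanceAs (Injective (Injective.under (ModuleCat.of R M)))
    have hE : Module.Injective R E := Module.injective_module_of_injective_object R E
    have hG := gammaSub_injective J E hE
    let f' : M →ₗ[R] gammaSub J E := f.codRestrict _ (fun x => by
      obtain ⟨n, hn⟩ : x ∈ gammaSub J M := h ▸ Submodule.mem_top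
      exact ⟨n, fun r hr => by rw [← map_smul, hn r hr, map_zero]⟩)
    have hf' : Function.Injective f' := fun a b hab => hf (congrArg Subtype.val hab)
    have hGI : Injective (ModuleCat.of R (gammaSub J E)) :=
      Module.injective_object_of_injective_module R _
    obtain ⟨-, δ, h1, h2⟩ := LCH.les (J := J) hf' (LinearMap.exact_map_mkQ_range f')
      (Submodule.mkQ_surjective _) i
    have hG0 : Subsingleton (LCH J (gammaSub J E) (i + 1)) := LCH.subsingleton_of_injective i
    have hT : gammaSub J (gammaSub J E) = ⊤ := by
      rw [eq_top_iff]
      rintro ⟨x, n, hn⟩ -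
      exact ⟨n, fun r hr => Subtype.ext (hn r hr)⟩
    refine subsingleton_of_forall_eq 0 fun x => ?_
    obtain ⟨y, rfl⟩ := (h2 x).mp (Subsingleton.elim _ _)
    exact hδ f' _ δ hT h1 y
  induction i with
  | zero =>
    intro M _ _ h
    refine key 0 h fun {G} _ _ f S δ hT hex x => (hex x).mpr ?_
    obtain ⟨g, hg⟩ := S.mkQ_surjective (LCH.eval _ x)
    obtain ⟨n, hn⟩ : g ∈ gammaSub J G := hT ▸ Submodule.mem_top
    obtain ⟨y, rfl⟩ := LCH.eval_range hn
    exact ⟨y, LCH.eval_injective (by rw [LCH.eval_map, hg])⟩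
  | succ i ih =>
    intro M _ _ h
    refine key (i + 1) h fun {G} _ _ f S δ hT hex x => ?_
    have := ih (gammaSub_quotient hT S)
    rw [Subsingleton.elim x 0, map_zero]

end Vanishing

section CechSteps

variable {R : Type u} [CommRing R]

/-- Localization of a module at the powers of an element. -/
abbrev AwayMod (x : R) (M : Type u) [AddCommGroup M] [Module R M] : Type u :=
  LocalizedModule (Submonoid.powers x) M

/-- The canonical map to the localization at the powers of an element. -/
abbrev awayMap (x : R) (M : Type u) [AddCommGroup M] [Module R M] : M →ₗ[R] AwayMod x M :=
  LocalizedModule.mkLinearMap (Submonoid.powers x) M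

/-- The cokernel of the canonical map to the localization at the powers of an element. -/
abbrev AwayCoker (x : R) (M : Type u) [AddCommGroup M] [Module R M] : Type u :=
  AwayMod x M ⧸ LinearMap.range (awayMap x M)

variable {M : Type u} [AddCommGroup M] [Module R M] {x : R}

theorem awayMap_eq_zero_iff {m : M} : awayMap x M m = 0 ↔ ∃ n, x ^ n • m = 0 := by
  rw [IsLocalizedModule.eq_zero_iff (Submonoid.powers x)]
  constructor
  · rintro ⟨⟨_, n, rfl⟩, h⟩
    exact ⟨n, h⟩
  · rintro ⟨n, h⟩
    exact ⟨⟨_, n, rfl⟩, h⟩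

theorem exists_awayMap (y : AwayMod x M) : ∃ n m, x ^ n • y = awayMap x M m := by
  obtain ⟨⟨m, ⟨_, n, rfl⟩⟩, h⟩ := IsLocalizedModule.surj (Submonoid.powers x) (awayMap x M) y
  exact ⟨n, m, h⟩

theorem away_bijective :
    Function.Bijective (x • (LinearMap.id : AwayMod x M →ₗ[R] AwayMod x M)) :=
  (Module.End.isUnit_iff _).mp (IsLocalizedModule.map_units (awayMap x M)
    (⟨x, Submonoid.mem_powers x⟩ : Submonoid.powers x))

theorem awayCoker_torsion (y : AwayCoker x M) : ∃ n, x ^ n • y = 0 := by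
  obtain ⟨y, rfl⟩ := Submodule.mkQ_surjective _ y
  obtain ⟨n, m, h⟩ := exists_awayMap y
  refine ⟨n, ?_⟩
  rw [← map_smul, h]
  exact (Submodule.Quotient.mk_eq_zero _).mpr ⟨m, rfl⟩

theorem awayCoker_torsion_of {y : R} (h : ∀ m : M, ∃ n, y ^ n • m = 0) (z : AwayCoker x M) :
    ∃ n, y ^ n • z = 0 := by
  obtain ⟨z, rfl⟩ := Submodule.mkQ_surjective _ z
  obtain ⟨n, m, hm⟩ := exists_awayMap z
  obtain ⟨k, hk⟩ := h m
  refine ⟨k, ?_⟩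
  rw [← map_smul]
  have h1 : x ^ n • (y ^ k • z) = 0 := by
    rw [smul_comm, hm, ← map_smul, hk, map_zero]
  have h2 : y ^ k • z = 0 := by
    clear hm
    induction n with
    | zero => simpa using h1
    | succ n ih =>
      refine ih (away_bijective.1 ?_)
      rw [map_zero]
      change x • x ^ n • y ^ k • z = 0
      rw [smul_smul x, ← pow_succ', h1]
  rw [h2, map_zero]

variable [IsNoetherianRing R] {J : Ideal R}

theorem LCH.subsingleton_of_partial_torsion {d : ℕ} {x : Fin d → R} (hx : ∀ l, x l ∈ J) {N : ℕ}
    (hN : J ^ N ≤ Ideal.span (Set.range x)) (k : ℕ) : ∀ (i : ℕ), i + k = d →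
    ∀ {M : Type u} [AddCommGroup M] [Module R M],
    (∀ l : Fin d, l.val < i → ∀ m : M, ∃ n, x l ^ n • m = 0) →
    ∀ j, k < j → Subsingleton (LCH J M j) := by
  induction k with
  | zero =>
    intro i hi M _ _ h j hj
    obtain ⟨j, rfl⟩ := Nat.exists_eq_succ_of_ne_zero hj.ne'
    apply LCH.subsingleton_of_torsion
    rw [eq_top_iff]
    rintro m -
    exact mem_gammaSub_of_gens hN fun l => h l (by omega) m
  | succ k ih =>
    intro i hi M _ _ h j hj
    obtain ⟨j, rfl⟩ := Nat.exists_eq_succ_of_ne_zero (by omega : j ≠ 0)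
    let a : Fin d := ⟨i, by omega⟩
    have hstep : ∀ l : Fin d, l.val < i + 1 → l.val < i ∨ l = a := by
      intro l hl
      rcases Nat.lt_succ_iff_lt_or_eq.mp hl with h | h
      · exact Or.inl h
      · exact Or.inr (Fin.ext h)
    have h1 : Subsingleton (LCH J (AwayCoker (x a) M) j) := by
      refine ih (i + 1) (by omega) (fun l hl => ?_) j (by omega)
      rcases hstep l hl with h' | rfl
      · exact awayCoker_torsion_of (h l h')
      · exact awayCoker_torsion
    have h2 : Subsingleton (LCH J (LinearMap.ker (awayMap (x a) M)) (j + 1)) := by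
      refine ih (i + 1) (by omega) (fun l hl => ?_) _ (by omega)
      rcases hstep l hl with h' | rfl
      · rintro ⟨m, hm⟩
        obtain ⟨n, hn⟩ := h l h' m
        exact ⟨n, Subtype.ext hn⟩
      · rintro ⟨m, hm⟩
        obtain ⟨n, hn⟩ := awayMap_eq_zero_iff.mp hm
        exact ⟨n, Subtype.ext hn⟩
    have h3 : Subsingleton (LCH J (AwayMod (x a) M) (j + 1)) :=
      LCH.subsingleton_of_bijective_smul (hx a) away_bijective _
    have h4 : Subsingleton (LCH J (LinearMap.range (awayMap (x a) M)) (j + 1)) := by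
      obtain ⟨-, δ, e1, e2⟩ := LCH.les (J := J)
        (Submodule.subtype_injective (LinearMap.range (awayMap (x a) M)))
        (LinearMap.exact_subtype_mkQ _) (Submodule.mkQ_surjective _) j
      refine subsingleton_of_forall_eq 0 fun y => ?_
      obtain ⟨z, rfl⟩ := (e2 y).mp (Subsingleton.elim _ _)
      rw [Subsingleton.elim z 0, map_zero]
    obtain ⟨e, -⟩ := LCH.les (J := J)
      (Submodule.subtype_injective (LinearMap.ker (awayMap (x a) M)))
      (g := (awayMap (x a) M).rangeRestrict) (by
        intro y
        rw [← LinearMap.mem_ker, LinearMap.ker_rangeRestrict]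
        simp) (LinearMap.surjective_rangeRestrict _) (j + 1)
    refine subsingleton_of_forall_eq 0 fun y => ?_
    obtain ⟨z, rfl⟩ := (e y).mp (Subsingleton.elim _ _)
    rw [Subsingleton.elim z 0, map_zero]

end CechSteps

section Artinian

variable {R : Type u} [CommRing R]

/-- Melkersson's criterion: a module in which every element is killed by a power of `x` and
whose `x`-torsion is Artinian is Artinian. -/
theorem isArtinian_of_torsion {X : Type u} [AddCommGroup X] [Module R X] (x : R)
    (ht : ∀ m : X, ∃ n, x ^ n • m = 0) [IsArtinian R (Submodule.torsionBy R X x)] :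
    IsArtinian R X := by
  rw [← monotone_stabilizes_iff_artinian]
  intro f
  let A : ℕ → ℕ → Submodule R (Submodule.torsionBy R X x) := fun n k =>
    ((OrderDual.ofDual (f k)).map (x ^ n • (LinearMap.id : X →ₗ[R] X))).comap
      (Submodule.torsionBy R X x).subtype
  have memA : ∀ n k y, y ∈ A n k ↔ ∃ z ∈ OrderDual.ofDual (f k), x ^ n • z = (y : X) := by
    intro n k y
    simp [A, Submodule.mem_comap, Submodule.mem_map]
  have hk : ∀ n k k', k ≤ k' → A n k' ≤ A n k := by
    intro n k k' h y hy
    rw [memA] at hy ⊢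
    obtain ⟨z, hz, h1⟩ := hy
    exact ⟨z, f.monotone h hz, h1⟩
  have hn : ∀ n n' k, n ≤ n' → A n' k ≤ A n k := by
    intro n n' k h y hy
    rw [memA] at hy ⊢
    obtain ⟨z, hz, h1⟩ := hy
    refine ⟨x ^ (n' - n) • z, Submodule.smul_mem _ _ hz, ?_⟩
    rw [smul_smul, ← pow_add, Nat.add_sub_cancel' h, h1]
  obtain ⟨K, hK⟩ := IsArtinian.monotone_stabilizes (R := R)
    (⟨fun k => OrderDual.toDual (A k k), fun k k' h =>
      (hk k' k k' h).trans (hn k k' k h)⟩ : ℕ →o (Submodule R (Submodule.torsionBy R X x))ᵒᵈ)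
  have hK' : ∀ m, K ≤ m → A K K = A m m := hK
  have hst : ∀ n, ∃ K', ∀ k, K' ≤ k → A n K' = A n k := by
    intro n
    exact IsArtinian.monotone_stabilizes (R := R)
      (⟨fun k => OrderDual.toDual (A n k), fun k k' h => hk n k k' h⟩ :
        ℕ →o (Submodule R (Submodule.torsionBy R X x))ᵒᵈ)
  choose K' hK'' using hst
  let L := K + ∑ n ∈ Finset.range K, K' n
  have hL : ∀ n k, L ≤ k → A n L = A n k := by
    intro n k hk1
    rcases lt_or_ge n K with h | h
    · have : K' n ≤ L := (Finset.single_le_sum (f := K') (fun _ _ => Nat.zero_le _)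
        (Finset.mem_range.mpr h)).trans (Nat.le_add_left _ _)
      rw [← hK'' n L this, ← hK'' n k (this.trans hk1)]
    · refine le_antisymm ?_ (hk n L k hk1)
      have hKL : K ≤ L := Nat.le_add_right _ _
      have h1 : A n L ≤ A K K := (hn K n L h).trans (hk K K L hKL)
      have h2 : A K K ≤ A n k := by
        rw [hK' (max n k) (h.trans (le_max_left _ _))]
        exact (hk _ _ _ (le_max_right n k)).trans (hn _ _ _ (le_max_left n k))
      exact h1.trans h2
  refine ⟨L, fun k hk1 => ?_⟩
  apply le_antisymm (f.monotone hk1)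
  change OrderDual.ofDual (f L) ≤ OrderDual.ofDual (f k)
  have main : ∀ n, ∀ z ∈ OrderDual.ofDual (f L), x ^ n • z = 0 → z ∈ OrderDual.ofDual (f k) := by
    intro n
    induction n with
    | zero =>
      intro z _ h0
      rw [pow_zero, one_smul] at h0
      rw [h0]
      exact Submodule.zero_mem _
    | succ n ih =>
      intro z hz h0
      have h1 : (⟨x ^ n • z, by
          rw [Submodule.mem_torsionBy_iff, smul_smul, ← pow_succ', h0]⟩ :
          Submodule.torsionBy R X x) ∈ A n L := (memA _ _ _).mpr ⟨z, hz, rfl⟩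
      rw [hL n k hk1, memA] at h1
      obtain ⟨z', hz', h2⟩ := h1
      have h3 := ih (z - z') (Submodule.sub_mem _ hz (f.monotone hk1 hz'))
        (by rw [smul_sub, h2, sub_self])
      have := Submodule.add_mem _ h3 hz'
      rwa [sub_add_cancel] at this
  intro z hz
  obtain ⟨n, h⟩ := ht z
  exact main n z hz h

end Artinian

section LocalNoetherian

variable {R : Type u} [CommRing R]

theorem gammaSub_gammaSub {M : Type u} [AddCommGroup M] [Module R M] (J : Ideal R) :
    gammaSub J (gammaSub J M) = ⊤ := by
  rw [eq_top_iff]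
  rintro ⟨x, n, hn⟩ -
  exact ⟨n, fun r hr => Subtype.ext (hn r hr)⟩

theorem LCH.torsionBy_eq_range {J : Ideal R} {N : Type u} [AddCommGroup N] [Module R N] {x : R}
    (hx : ∀ v : N, x • v = 0 → v = 0) (p : ℕ) :
    ∃ δ : LCH J (N ⧸ LinearMap.range (x • (LinearMap.id : N →ₗ[R] N))) p →ₗ[R] LCH J N (p + 1),
      LinearMap.range δ = Submodule.torsionBy R (LCH J N (p + 1)) x ∧
      LinearMap.ker δ = LinearMap.range
        (LCH.map J (LinearMap.range (x • (LinearMap.id : N →ₗ[R] N))).mkQ p) := by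
  have hinj : Function.Injective (x • (LinearMap.id : N →ₗ[R] N)) := by
    rw [← LinearMap.ker_eq_bot, LinearMap.ker_eq_bot']
    exact hx
  obtain ⟨-, δ, e1, e2⟩ := LCH.les (J := J) hinj (LinearMap.exact_map_mkQ_range _)
    (Submodule.mkQ_surjective _) p
  refine ⟨δ, ?_, ?_⟩
  · ext y
    rw [Submodule.mem_torsionBy_iff, LinearMap.mem_range, ← LCH.map_smul_id]
    exact (e2 y).symm
  · ext y
    exact e1 y

variable [IsLocalRing R] [IsNoetherianRing R]

theorem isArtinian_of_pow_smul {M : Type u} [AddCommGroup M] [Module R M] [Module.Finite R M]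
    {n : ℕ} (h : ∀ r ∈ maximalIdeal R ^ n, ∀ x : M, r • x = 0) : IsArtinian R M := by
  rcases subsingleton_or_nontrivial M with hM | hM
  · infer_instance
  have ht : Module.IsTorsionBySet R M ↑(maximalIdeal R ^ n) := fun x r => h r r.2 x
  let := ht.module
  have : IsScalarTower R (R ⧸ maximalIdeal R ^ n) M := ht.isScalarTower
  have : Nontrivial (R ⧸ maximalIdeal R ^ n) := by
    rw [Ideal.Quotient.nontrivial_iff]
    intro h1
    obtain ⟨x, hx⟩ := exists_ne (0 : M)
    exact hx (by simpa using h 1 (h1 ▸ Submodule.mem_top) x)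
  have := IsLocalRing.of_surjective' (Ideal.Quotient.mk (maximalIdeal R ^ n))
    Ideal.Quotient.mk_surjective
  have : IsArtinianRing (R ⧸ maximalIdeal R ^ n) := by
    rw [isArtinianRing_iff_isNilpotent_maximalIdeal]
    refine ⟨n, ?_⟩
    have : maximalIdeal (R ⧸ maximalIdeal R ^ n) ≤
        (maximalIdeal R).map (Ideal.Quotient.mk (maximalIdeal R ^ n)) := by
      intro x hx
      obtain ⟨x, rfl⟩ := Ideal.Quotient.mk_surjective x
      refine Ideal.mem_map_of_mem _ ?_
      intro hu
      exact hx (hu.map _)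
    rw [Ideal.zero_eq_bot, eq_bot_iff]
    refine (Ideal.pow_right_mono this n).trans ?_
    rw [← Ideal.map_pow, Ideal.map_quotient_self]
  have : Module.Finite (R ⧸ maximalIdeal R ^ n) M := Module.Finite.of_restrictScalars_finite R _ _
  exact isArtinian_of_surjective_algebraMap (R := R ⧸ maximalIdeal R ^ n)
    Ideal.Quotient.mk_surjective

theorem isFiniteLength_of_pow_smul {M : Type u} [AddCommGroup M] [Module R M] [Module.Finite R M]
    {n : ℕ} (h : ∀ r ∈ maximalIdeal R ^ n, ∀ x : M, r • x = 0) : IsFiniteLength R M :=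
  isFiniteLength_iff_isNoetherian_isArtinian.mpr ⟨inferInstance, isArtinian_of_pow_smul h⟩

theorem exists_regular_of_socle {M : Type u} [AddCommGroup M] [Module R M] [Module.Finite R M]
    (h : ∀ x : M, (∀ r ∈ maximalIdeal R, r • x = 0) → x = 0) :
    ∃ r ∈ maximalIdeal R, ∀ x : M, r • x = 0 → x = 0 := by
  by_contra! hc
  have h1 : (maximalIdeal R : Set R) ⊆ ⋃ p ∈ associatedPrimes R M, (p : Set R) := by
    rw [biUnion_associatedPrimes_eq_zero_divisors]
    intro r hr
    obtain ⟨x, hx, h0⟩ := hc r hr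
    exact ⟨x, h0, hx⟩
  obtain ⟨p, hp, hle⟩ := (Ideal.subset_union_prime_finite (associatedPrimes.finite R M)
    (f := id) 0 0 (fun _ h _ _ => h.1)).mp h1
  rw [AssociatedPrimes.mem_iff, isAssociatedPrime_iff] at hp
  obtain ⟨hp, x, rfl⟩ := hp
  have hx : x = 0 := h x fun r hr => by simpa [Submodule.mem_colon_singleton] using hle hr
  exact hp.ne_top (by simp [hx])

theorem gammaSub_isArtinian {M : Type u} [AddCommGroup M] [Module R M] [Module.Finite R M] :
    IsArtinian R (gammaSub (maximalIdeal R) M) := by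
  obtain ⟨n, hn⟩ := exists_pow_smul_of_fg (maximalIdeal R) (gammaSub (maximalIdeal R) M)
    (IsNoetherian.noetherian _) le_rfl
  exact isArtinian_of_pow_smul (n := n) fun r hr x => Subtype.ext (hn r hr x x.2)

theorem gammaSub_quotient_socle {M : Type u} [AddCommGroup M] [Module R M]
    [Module.Finite R M] (y : M ⧸ gammaSub (maximalIdeal R) M)
    (hy : ∀ r ∈ maximalIdeal R, r • y = 0) : y = 0 := by
  obtain ⟨v, rfl⟩ := Submodule.mkQ_surjective _ y
  obtain ⟨n, hn⟩ := exists_pow_smul_of_fg (maximalIdeal R) (gammaSub (maximalIdeal R) M)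
    (IsNoetherian.noetherian _) le_rfl
  refine (Submodule.Quotient.mk_eq_zero _).mpr ⟨n + 1, fun r hr => ?_⟩
  rw [pow_succ] at hr
  induction hr using Submodule.mul_induction_on' with
  | mem_mul_mem a ha b hb =>
    rw [mul_smul]
    refine hn a ha _ ?_
    rw [← Submodule.Quotient.mk_eq_zero]
    exact hy b hb
  | add a _ b _ h1 h2 => rw [add_smul, h1, h2, add_zero]

theorem LCH.isArtinian (p : ℕ) : ∀ {M : Type u} [AddCommGroup M] [Module R M] [Module.Finite R M],
    IsArtinian R (LCH (maximalIdeal R) M p) := by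
  induction p with
  | zero =>
    intro M _ _ _
    have := gammaSub_isArtinian (R := R) (M := M)
    refine isArtinian_of_injective ((LCH.eval (J := maximalIdeal R) M).codRestrict
      (gammaSub (maximalIdeal R) M) fun y => ?_) fun a b h => LCH.eval_injective ?_
    · obtain ⟨n, hn⟩ := LC.torsion y
      exact ⟨n, fun r hr => by rw [← map_smul, hn r hr, map_zero]⟩
    · exact congrArg Subtype.val h
  | succ p ih =>
    intro M _ _ _
    obtain ⟨x, hx, hreg⟩ := exists_regular_of_socle
      (M := M ⧸ gammaSub (maximalIdeal R) M) gammaSub_quotient_socle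
    have hN : IsArtinian R (LCH (maximalIdeal R) (M ⧸ gammaSub (maximalIdeal R) M) (p + 1)) := by
      obtain ⟨δ, h1, -⟩ := LCH.torsionBy_eq_range (J := maximalIdeal R) hreg p
      have := ih (M := (M ⧸ gammaSub (maximalIdeal R) M) ⧸ LinearMap.range (x •
        (LinearMap.id : (M ⧸ gammaSub (maximalIdeal R) M) →ₗ[R] _)))
      have : IsArtinian R (LinearMap.range δ) :=
        isArtinian_of_surjective _ δ.rangeRestrict δ.surjective_rangeRestrict
      rw [h1] at this
      refine isArtinian_of_torsion x fun y => ?_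
      obtain ⟨n, hn⟩ := LC.torsion y
      exact ⟨n, hn _ (Ideal.pow_mem_pow hx n)⟩
    refine isArtinian_of_injective (LCH.map _ (gammaSub (maximalIdeal R) M).mkQ (p + 1)) ?_
    rw [← LinearMap.ker_eq_bot, LinearMap.ker_eq_bot']
    intro y hy
    obtain ⟨e, -⟩ := LCH.les (J := maximalIdeal R)
      (Submodule.subtype_injective (gammaSub (maximalIdeal R) M))
      (LinearMap.exact_subtype_mkQ _) (Submodule.mkQ_surjective _) (p + 1)
    have := LCH.subsingleton_of_torsion (J := maximalIdeal R) p
      (gammaSub_gammaSub (M := M) (maximalIdeal R))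
    obtain ⟨z, rfl⟩ := (e y).mp hy
    rw [Subsingleton.elim z 0, map_zero]

end LocalNoetherian

section GNonempty

variable {R : Type u} [CommRing R] [IsLocalRing R]

theorem socle_fg_of_isArtinian {X : Type u} [AddCommGroup X] [Module R X] [IsArtinian R X] :
    (Submodule.torsionBySet R X (maximalIdeal R : Set R)).FG := by
  have ht : Module.IsTorsionBySet R (Submodule.torsionBySet R X (maximalIdeal R : Set R))
      (maximalIdeal R : Set R) := Submodule.torsionBySet_isTorsionBySet _
  let := ht.module
  let : Field (R ⧸ maximalIdeal R) := Ideal.Quotient.field _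
  have : IsSemisimpleModule R (Submodule.torsionBySet R X (maximalIdeal R : Set R)) := by
    have h : IsSemisimpleModule (R ⧸ maximalIdeal R)
      (Submodule.torsionBySet R X (maximalIdeal R : Set R)) := inferInstance
    exact ht.isSemisimpleModule_iff.mp h
  rw [← Module.Finite.iff_fg]
  have h : IsArtinian R (Submodule.torsionBySet R X (maximalIdeal R : Set R)) := inferInstance
  exact ((IsSemisimpleModule.finite_tfae (R := R)
    (M := Submodule.torsionBySet R X (maximalIdeal R : Set R))).out 2 0).mp h

variable [IsNoetherianRing R]

theorem LC.exists_socle_cls {X : ModuleCat.{u} R} {p : ℕ} {y : LC (maximalIdeal R) X p}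
    (hy : ∀ r ∈ maximalIdeal R, r • y = 0) :
    ∃ n e, LC.cls (maximalIdeal R) X p n e = y ∧ ∀ r ∈ maximalIdeal R, r • e = 0 := by
  obtain ⟨n, e, rfl⟩ := LC.exists_cls y
  have key : ∀ I : Ideal R, I.FG → I ≤ maximalIdeal R → ∃ n', ∃ h : n ≤ n', ∀ r ∈ I,
      r • extPull (Ideal.pow_le_pow_right (I := maximalIdeal R) h) X p e = 0 := by
    intro I hI
    induction I, hI using Submodule.fg_induction with
    | singleton r =>
      intro hr
      have h1 := hy r (hr (Submodule.mem_span_singleton_self r))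
      rw [← map_smul, LC.cls_eq_zero_iff] at h1
      obtain ⟨n', h, h0⟩ := h1
      refine ⟨n', h, fun s hs => ?_⟩
      obtain ⟨t, rfl⟩ := Submodule.mem_span_singleton.mp hs
      rw [smul_eq_mul, mul_smul, ← map_smul, h0, smul_zero]
    | sup I₁ I₂ _ _ h1 h2 =>
      intro hle
      obtain ⟨n₁, g₁, e₁⟩ := h1 (le_sup_left.trans hle)
      obtain ⟨n₂, g₂, e₂⟩ := h2 (le_sup_right.trans hle)
      refine ⟨max n₁ n₂, g₁.trans (le_max_left _ _), fun r hr => ?_⟩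
      obtain ⟨a, ha, b, hb, rfl⟩ := Submodule.mem_sup.mp hr
      have h3 : a • extPull (Ideal.pow_le_pow_right (I := maximalIdeal R)
          (g₁.trans (le_max_left n₁ n₂))) X p e = 0 := by
        rw [← extPull_extPull (Ideal.pow_le_pow_right (le_max_left n₁ n₂))
          (Ideal.pow_le_pow_right g₁), ← map_smul, e₁ a ha, map_zero]
      have h4 : b • extPull (Ideal.pow_le_pow_right (I := maximalIdeal R)
          (g₁.trans (le_max_left n₁ n₂))) X p e = 0 := by
        rw [← extPull_extPull (Ideal.pow_le_pow_right (le_max_right n₁ n₂))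
          (Ideal.pow_le_pow_right g₂), ← map_smul, e₂ b hb, map_zero]
      rw [add_smul, h3, h4, add_zero]
  obtain ⟨n', h, h0⟩ := key _ (IsNoetherian.noetherian (maximalIdeal R)) le_rfl
  exact ⟨n', _, LC.cls_extPull h e, h0⟩

/-- The classes in local cohomology of socle elements at a given level. -/
def socleLevel (X : ModuleCat.{u} R) (p : ℕ) : ℕ →o Submodule R (LC (maximalIdeal R) X p) where
  toFun n := (Submodule.torsionBySet R
    (Abelian.Ext (ModuleCat.of R (R ⧸ maximalIdeal R ^ n)) X p) (maximalIdeal R : Set R)).map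
      (LC.cls (maximalIdeal R) X p n)
  monotone' := by
    rintro n n' h _ ⟨e, he, rfl⟩
    refine ⟨extPull (Ideal.pow_le_pow_right h) X p e, ?_, LC.cls_extPull h e⟩
    rw [SetLike.mem_coe, Submodule.mem_torsionBySet_iff] at he ⊢
    intro r
    rw [← map_smul, he r, map_zero]

theorem exists_socleLevel (X : ModuleCat.{u} R) (p : ℕ) [IsArtinian R (LC (maximalIdeal R) X p)] :
    ∃ n, Submodule.torsionBySet R (LC (maximalIdeal R) X p) (maximalIdeal R : Set R) =
      socleLevel X p n := by
  apply socle_fg_of_isArtinian.stabilizes_of_iSup_eq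
  apply le_antisymm
  · apply iSup_le
    rintro n _ ⟨e, he, rfl⟩
    rw [SetLike.mem_coe, Submodule.mem_torsionBySet_iff] at he
    rw [Submodule.mem_torsionBySet_iff]
    intro r
    rw [← map_smul, he r, map_zero]
  · intro y hy
    rw [Submodule.mem_torsionBySet_iff] at hy
    obtain ⟨n, e, rfl, he⟩ := LC.exists_socle_cls fun r hr => hy ⟨r, hr⟩
    refine Submodule.mem_iSup_of_mem n ⟨e, ?_, rfl⟩
    rw [SetLike.mem_coe, Submodule.mem_torsionBySet_iff]
    exact fun r => he r r.2

variable (R)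

theorem exists_gProperty : ∃ n₀, GProperty R n₀ := by
  obtain ⟨k, x, hx⟩ := Submodule.fg_iff_exists_fin_generating_family.mp
    (IsNoetherian.noetherian (maximalIdeal R))
  have hvan : ∀ p, k < p → Subsingleton (LCH (maximalIdeal R) R p) :=
    LCH.subsingleton_of_partial_torsion (J := maximalIdeal R) (x := x) (N := 1)
      (fun l => hx ▸ Submodule.subset_span ⟨l, rfl⟩) (by rw [pow_one]; exact hx.ge) k 0
      (by omega) (fun l hl => absurd hl (by omega))
  have hlev : ∀ p, ∃ n, Submodule.torsionBySet R (LC (maximalIdeal R) (ModuleCat.of R R) p)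
      (maximalIdeal R : Set R) = socleLevel (ModuleCat.of R R) p n := fun p =>
    have := LCH.isArtinian (R := R) p (M := R)
    exists_socleLevel _ p
  choose n hn using hlev
  refine ⟨(Finset.range (k + 1)).sup n, ?_⟩
  intro s y _ hy h p z hz
  obtain ⟨z', rfl⟩ := (lcEquiv (maximalIdeal R) p).surjective z
  have hz' : z' ∈ Submodule.torsionBySet R (LC (maximalIdeal R) (ModuleCat.of R R) p)
      (maximalIdeal R : Set R) := by
    rw [Submodule.mem_torsionBySet_iff] at hz ⊢
    intro r
    apply (lcEquiv (maximalIdeal R) p).injective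
    rw [map_smul, map_zero]
    exact hz r
  rcases lt_or_ge k p with hp | hp
  · have := hvan p hp
    refine ⟨0, Submodule.zero_mem _, ?_⟩
    rw [Subsingleton.elim z' 0, map_zero, map_zero]
  · have hle : n p ≤ (Finset.range (k + 1)).sup n :=
      Finset.le_sup (Finset.mem_range.mpr (by omega))
    have hq : Ideal.span (Set.range y) ≤ maximalIdeal R ^ (Finset.range (k + 1)).sup n := by
      rw [Ideal.span_le]
      rintro _ ⟨i, rfl⟩
      exact hy i
    rw [hn] at hz'
    obtain ⟨e, he, rfl⟩ := (socleLevel (ModuleCat.of R R) p).monotone hle hz'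
    rw [SetLike.mem_coe, Submodule.mem_torsionBySet_iff] at he
    refine ⟨extComparison (ModuleCat.of R (R ⧸ Ideal.span (Set.range y))) (ModuleCat.of R R) p
      (extPull hq _ p e), ?_, ?_⟩
    · refine (Submodule.mem_torsionBySet_iff _ _).mpr fun r => ?_
      have : extComparison (ModuleCat.of R (R ⧸ Ideal.span (Set.range y))) (ModuleCat.of R R) p
        (extPull hq _ p ((r : R) • e)) = 0 := by rw [he r, map_zero, map_zero]
      rw [map_smul, map_smul] at this
      exact this
    · rw [canonical_extPull (maximalIdeal R) h (le_radical_pow _ _) hq]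
      exact (lcToHmod_cls _ _ _ _).symm

theorem gProperty_gInvariant : GProperty R (gInvariant R) :=
  Nat.sInf_mem (exists_gProperty R)

end GNonempty

section QuotientCohomology

variable {R : Type u} [CommRing R] {J c : Ideal R} {x : R}

theorem mem_sup_span_singleton {a : R} : a ∈ c ⊔ Ideal.span {x} ↔ ∃ t, a - x * t ∈ c := by
  rw [Submodule.mem_sup]
  constructor
  · rintro ⟨y, hy, z, hz, rfl⟩
    obtain ⟨t, rfl⟩ := Ideal.mem_span_singleton.mp hz
    exact ⟨t, by simpa using hy⟩
  · rintro ⟨t, ht⟩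
    exact ⟨_, ht, x * t, Ideal.mul_mem_right _ _ (Ideal.mem_span_singleton_self x), by ring⟩

theorem LCH.quotient_les (hx : ∀ a, x * a ∈ c → a ∈ c) (p : ℕ) :
    ∃ δ : LCH J (R ⧸ (c ⊔ Ideal.span {x})) p →ₗ[R] LCH J (R ⧸ c) (p + 1),
      LinearMap.range δ = Submodule.torsionBy R (LCH J (R ⧸ c) (p + 1)) x ∧
      LinearMap.ker δ = LinearMap.range (LCH.map J
        (Submodule.factor (le_sup_left : c ≤ c ⊔ Ideal.span {x})) p) := by
  have hinj : Function.Injective (x • (LinearMap.id : (R ⧸ c) →ₗ[R] (R ⧸ c))) := by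
    rw [← LinearMap.ker_eq_bot, LinearMap.ker_eq_bot']
    intro a ha
    obtain ⟨a, rfl⟩ := Submodule.mkQ_surjective _ a
    exact (Submodule.Quotient.mk_eq_zero _).mpr
      (hx a ((Submodule.Quotient.mk_eq_zero _).mp ha))
  have hex : Function.Exact (x • (LinearMap.id : (R ⧸ c) →ₗ[R] (R ⧸ c)))
      (Submodule.factor (le_sup_left : c ≤ c ⊔ Ideal.span {x})) := by
    intro a
    obtain ⟨a, rfl⟩ := Submodule.mkQ_surjective _ a
    have h1 : Submodule.factor (le_sup_left : c ≤ c ⊔ Ideal.span {x}) (c.mkQ a) = 0 ↔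
      a ∈ c ⊔ Ideal.span {x} := Submodule.Quotient.mk_eq_zero _
    rw [h1, mem_sup_span_singleton]
    constructor
    · rintro ⟨t, ht⟩
      refine ⟨c.mkQ t, ?_⟩
      have := (Submodule.Quotient.mk_eq_zero c).mpr ht
      rw [Submodule.Quotient.mk_sub, sub_eq_zero] at this
      exact this.symm
    · rintro ⟨t, ht⟩
      obtain ⟨t, rfl⟩ := Submodule.mkQ_surjective _ t
      refine ⟨t, ?_⟩
      rw [← Submodule.Quotient.mk_eq_zero, Submodule.Quotient.mk_sub, sub_eq_zero]
      exact ht.symm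
  obtain ⟨-, δ, e1, e2⟩ := LCH.les (J := J) hinj hex (Submodule.factor_surjective _) p
  refine ⟨δ, ?_, ?_⟩
  · ext y
    rw [Submodule.mem_torsionBy_iff, LinearMap.mem_range, ← LCH.map_smul_id]
    exact (e2 y).symm
  · ext y
    exact e1 y

theorem LCH.subsingleton_quotient (hx : ∀ a, x * a ∈ c → a ∈ c) {p : ℕ}
    (h0 : Subsingleton (LCH J (R ⧸ c) p)) (h1 : Subsingleton (LCH J (R ⧸ c) (p + 1))) :
    Subsingleton (LCH J (R ⧸ (c ⊔ Ideal.span {x})) p) := by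
  obtain ⟨δ, -, hk⟩ := LCH.quotient_les (J := J) hx p
  refine subsingleton_of_forall_eq 0 fun y => ?_
  have : y ∈ LinearMap.ker δ := Subsingleton.elim _ _
  rw [hk] at this
  obtain ⟨z, rfl⟩ := this
  rw [Subsingleton.elim z 0, map_zero]

theorem eq_zero_of_smul_eq_zero {X : Type*} [AddCommGroup X] [Module R X]
    (h : ∀ y : X, x • y = 0 → y = 0) (ht : ∀ y : X, ∃ n, x ^ n • y = 0) (y : X) : y = 0 := by
  obtain ⟨n, hn⟩ := ht y
  induction n generalizing y with
  | zero => simpa using hn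
  | succ n ih => exact h y (ih (x • y) (by rw [smul_smul, ← pow_succ, hn]))

theorem LCH.subsingleton_of_quotient (hxJ : x ∈ J) (hx : ∀ a, x * a ∈ c → a ∈ c) {s : ℕ}
    (h : ∀ i < s, Subsingleton (LCH J (R ⧸ (c ⊔ Ideal.span {x})) i)) :
    ∀ i < s + 1, Subsingleton (LCH J (R ⧸ c) i) := by
  intro i hi
  refine subsingleton_of_forall_eq 0 (eq_zero_of_smul_eq_zero (x := x) ?_ ?_)
  · rcases i with _ | i
    · intro y hy
      apply LCH.eval_injective
      rw [map_zero]
      have := congrArg (LCH.eval (J := J) (R ⧸ c)) hy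
      rw [map_smul, map_zero] at this
      obtain ⟨a, ha⟩ := Submodule.mkQ_surjective _ (LCH.eval (J := J) (R ⧸ c) y)
      rw [← ha] at this ⊢
      exact (Submodule.Quotient.mk_eq_zero _).mpr
        (hx a ((Submodule.Quotient.mk_eq_zero _).mp this))
    · intro y hy
      obtain ⟨δ, hr, -⟩ := LCH.quotient_les (J := J) hx i
      have := h i (by omega)
      have hy' : y ∈ LinearMap.range δ := by
        rw [hr]
        exact hy
      obtain ⟨z, rfl⟩ := hy'
      rw [Subsingleton.elim z 0, map_zero]
  · intro y
    obtain ⟨n, hn⟩ := LC.torsion y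
    exact ⟨n, hn _ (Ideal.pow_mem_pow hxJ n)⟩

/-- The connecting map identifies socles when the preceding local cohomology vanishes. -/
theorem LCH.socle_equiv (hxJ : x ∈ J) (hx : ∀ a, x * a ∈ c → a ∈ c) {p : ℕ}
    (h0 : Subsingleton (LCH J (R ⧸ c) p)) :
    Nonempty (Submodule.torsionBySet R (LCH J (R ⧸ (c ⊔ Ideal.span {x})) p) (J : Set R) ≃ₗ[R]
      Submodule.torsionBySet R (LCH J (R ⧸ c) (p + 1)) (J : Set R)) := by
  obtain ⟨δ, hr, hk⟩ := LCH.quotient_les (J := J) hx p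
  have hinj : ∀ y, δ y = 0 → y = 0 := by
    intro y hy
    have : y ∈ LinearMap.ker δ := hy
    rw [hk] at this
    obtain ⟨z, rfl⟩ := this
    rw [Subsingleton.elim z 0, map_zero]
  refine ⟨LinearEquiv.ofBijective (δ.restrict fun y hy => ?_) ⟨?_, ?_⟩⟩
  · rw [Submodule.mem_torsionBySet_iff] at hy ⊢
    intro r
    rw [← map_smul, hy r, map_zero]
  · rw [← LinearMap.ker_eq_bot, LinearMap.ker_eq_bot']
    rintro ⟨y, hy⟩ h
    exact Subtype.ext (hinj y (congrArg Subtype.val h))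
  · rintro ⟨z, hz⟩
    rw [Submodule.mem_torsionBySet_iff] at hz
    have hz' : z ∈ LinearMap.range δ := by
      rw [hr]
      exact hz ⟨x, hxJ⟩
    obtain ⟨y, rfl⟩ := hz'
    refine ⟨⟨y, ?_⟩, rfl⟩
    rw [Submodule.mem_torsionBySet_iff]
    intro r
    apply hinj
    rw [map_smul]
    exact hz r

end QuotientCohomology

section Dimension

variable {R : Type u} [CommRing R] [IsLocalRing R] [IsNoetherianRing R]

theorem ringKrullDim_le_zero_of_pow_le {P : Ideal R} {n : ℕ} (h : maximalIdeal R ^ n ≤ P) :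
    ringKrullDim (R ⧸ P) ≤ 0 := by
  have : IsArtinian R (R ⧸ P) := isArtinian_of_pow_smul (n := n) (by
    intro r hr y
    obtain ⟨y, rfl⟩ := Submodule.mkQ_surjective _ y
    exact (Submodule.Quotient.mk_eq_zero _).mpr (Ideal.mul_mem_right _ _ (h hr)))
  have : IsArtinianRing (R ⧸ P) := isArtinian_of_tower R this
  rw [isArtinianRing_iff_krullDimLE_zero] at this
  exact Order.krullDimLE_iff _ _ |>.mp this

theorem ringKrullDim_quotient_le_card {P : Ideal R} {n : ℕ} {s : Finset R}
    (hs : ∀ y ∈ s, y ∈ maximalIdeal R) (h : maximalIdeal R ^ n ≤ P ⊔ Ideal.span (s : Set R)) :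
    ringKrullDim (R ⧸ P) ≤ s.card := by
  classical
  rcases eq_or_ne P ⊤ with rfl | hP
  · have : Subsingleton (R ⧸ (⊤ : Ideal R)) := Ideal.Quotient.subsingleton_iff.mpr rfl
    rw [ringKrullDim_eq_bot_of_subsingleton]
    exact bot_le
  have : Nontrivial (R ⧸ P) := Ideal.Quotient.nontrivial_iff.mpr hP
  have := IsLocalRing.of_surjective' (Ideal.Quotient.mk P) Ideal.Quotient.mk_surjective
  have hs' : ((s.image (Ideal.Quotient.mk P) : Finset (R ⧸ P)) : Set (R ⧸ P)) ⊆
      Ring.jacobson (R ⧸ P) := by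
    rw [IsLocalRing.ringJacobson_eq_maximalIdeal]
    intro y hy
    obtain ⟨z, hz, rfl⟩ := Finset.mem_image.mp (Finset.mem_coe.mp hy)
    rw [SetLike.mem_coe, mem_maximalIdeal]
    intro hu
    have := IsLocalHom.of_surjective (Ideal.Quotient.mk P) Ideal.Quotient.mk_surjective
    have := (isUnit_map_iff (Ideal.Quotient.mk P) z).mp hu
    exact hs z hz this
  have h1 := ringKrullDim_le_ringKrullDim_quotient_add_card _ hs'
  refine h1.trans ?_
  have h2 : ringKrullDim ((R ⧸ P) ⧸ Ideal.span
      ((s.image (Ideal.Quotient.mk P) : Finset (R ⧸ P)) : Set (R ⧸ P))) ≤ 0 := by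
    refine (ringKrullDim_le_of_surjective (Ideal.Quotient.lift (P ⊔ Ideal.span (s : Set R))
      ((Ideal.Quotient.mk _).comp (Ideal.Quotient.mk P)) ?_) ?_).trans
      (ringKrullDim_le_zero_of_pow_le h)
    · intro a ha
      obtain ⟨b, hb, e, he, rfl⟩ := Submodule.mem_sup.mp ha
      rw [RingHom.comp_apply, map_add, Ideal.Quotient.eq_zero_iff_mem.mpr hb, zero_add,
        Ideal.Quotient.eq_zero_iff_mem, Finset.coe_image, ← Ideal.map_span]
      exact Ideal.mem_map_of_mem _ he
    · exact Ideal.Quotient.lift_surjective_of_surjective _ _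
        (Ideal.Quotient.mk_surjective.comp Ideal.Quotient.mk_surjective)
  calc _ ≤ (0 : WithBot ℕ∞) + ((s.image (Ideal.Quotient.mk P)).card : WithBot ℕ∞) := by gcongr
    _ ≤ _ := by
      rw [zero_add]
      exact_mod_cast Finset.card_image_le

end Dimension

section AssociatedPrimes

variable {R : Type u} [CommRing R] [IsLocalRing R] [IsNoetherianRing R]

omit [IsLocalRing R] in
theorem exists_prime_of_not_mem {c P : Ideal R} {z : R} (hz : z ∉ c) (h : ∀ a ∈ P, a * z ∈ c) :
    ∃ Q : Ideal R, Q.IsPrime ∧ P ≤ Q ∧ ∃ w, ∀ a, a ∈ Q ↔ a * w ∈ c := by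
  obtain ⟨Q, hQ, hle⟩ := exists_le_isAssociatedPrime_of_isNoetherianRing R
    (Submodule.Quotient.mk z : R ⧸ c) (fun h0 => hz ((Submodule.Quotient.mk_eq_zero _).mp h0))
  obtain ⟨hp, w, hw⟩ := isAssociatedPrime_iff.mp hQ
  obtain ⟨w, rfl⟩ := Submodule.mkQ_surjective _ w
  have key : ∀ (a w : R), a ∈ (⊥ : Submodule R (R ⧸ c)).colon {c.mkQ w} ↔ a * w ∈ c := by
    intro a w
    rw [Submodule.mem_colon_singleton, Submodule.mem_bot, ← map_smul]
    exact Submodule.Quotient.mk_eq_zero _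
  exact ⟨Q, hp, fun a ha => hle ((key a z).mpr (h a ha)), w, fun a => by rw [hw]; exact key a w⟩

theorem regular_of_subsingleton {c : Ideal R}
    (h0 : Subsingleton (LCH (maximalIdeal R) (R ⧸ c) 0)) :
    ∃ x ∈ maximalIdeal R, ∀ a, x * a ∈ c → a ∈ c := by
  obtain ⟨x, hx, hreg⟩ := exists_regular_of_socle (M := R ⧸ c) (by
    intro y hy
    obtain ⟨z, rfl⟩ := LCH.eval_range (J := maximalIdeal R) (n := 1) (m := y)
      (by rw [pow_one]; exact hy)
    rw [Subsingleton.elim z 0, map_zero])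
  exact ⟨x, hx, fun a ha => (Submodule.Quotient.mk_eq_zero _).mp
    (hreg (Submodule.Quotient.mk a) ((Submodule.Quotient.mk_eq_zero _).mpr ha))⟩

/-- An ideal annihilating a nonzero element of a module whose first `s` local cohomology
modules vanish has dimension at least `s`. -/
theorem le_ringKrullDim_of_annihilates (s : ℕ) : ∀ (c P : Ideal R) (z : R),
    (∀ i < s, Subsingleton (LCH (maximalIdeal R) (R ⧸ c) i)) → z ∉ c →
    (∀ a ∈ P, a * z ∈ c) → (s : WithBot ℕ∞) ≤ ringKrullDim (R ⧸ P) := by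
  induction s with
  | zero =>
    intro c P z _ hz h
    have : Nontrivial (R ⧸ P) := Ideal.Quotient.nontrivial_iff.mpr (by
      rintro rfl
      exact hz (by simpa using h 1 trivial))
    simpa using ringKrullDim_nonneg_of_nontrivial
  | succ s ih =>
    intro c P z hv hz h
    obtain ⟨x, hxm, hx⟩ := regular_of_subsingleton (hv 0 (by omega))
    obtain ⟨Q, hQ, hPQ, w, hw⟩ := exists_prime_of_not_mem hz h
    have hwc : w ∉ c := fun h0 => hQ.ne_top ((Ideal.eq_top_iff_one _).mpr
      ((hw 1).mpr (by simpa using h0)))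
    have hxQ : x ∉ Q := fun h0 => hwc (hx w ((hw x).mp h0))
    let N : Ideal R := modColon R c Q
    have hN : ¬ N ≤ c ⊔ Ideal.span {x} := by
      intro hle
      have : N ≤ c := by
        refine Submodule.le_of_le_smul_of_le_jacobson_bot (I := maximalIdeal R)
          (IsNoetherian.noetherian N) (IsLocalRing.maximalIdeal_le_jacobson _) ?_
        intro y hy
        obtain ⟨t, ht⟩ := mem_sup_span_singleton.mp (hle hy)
        have htN : t ∈ N := by
          intro a ha
          apply hx
          have h1 : a * (y - x * t) ∈ c := Ideal.mul_mem_left _ _ ht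
          have h2 : a * y ∈ c := hy a ha
          have := c.sub_mem h2 h1
          rw [smul_eq_mul]
          convert this using 1
          ring
        have : y = (y - x * t) + x • t := by rw [smul_eq_mul]; ring
        rw [this]
        exact Submodule.add_mem_sup ht (Submodule.smul_mem_smul hxm htN)
      exact hwc (this fun a ha => (hw a).mp ha)
    obtain ⟨y, hyN, hy⟩ := Set.not_subset.mp hN
    have h1 := ih (c ⊔ Ideal.span {x}) (Q ⊔ Ideal.span {x}) y
      (fun i hi => LCH.subsingleton_quotient hx (hv i (by omega)) (hv (i + 1) (by omega))) hy (by
        intro a ha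
        obtain ⟨t, ht⟩ := mem_sup_span_singleton.mp ha
        refine mem_sup_span_singleton.mpr ⟨t * y, ?_⟩
        have := hyN _ ht
        rw [smul_eq_mul] at this
        convert this using 1
        ring)
    have h2 : ringKrullDim (R ⧸ (Q ⊔ Ideal.span {x})) + 1 ≤ ringKrullDim (R ⧸ Q) := by
      refine ringKrullDim_succ_le_of_surjective
        (Ideal.Quotient.factor (le_sup_left : Q ≤ Q ⊔ Ideal.span {x}))
        (Ideal.Quotient.factor_surjective _) (r := Ideal.Quotient.mk Q x) ?_ ?_
      · refine mem_nonZeroDivisors_of_ne_zero ?_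
        rwa [Ne, Ideal.Quotient.eq_zero_iff_mem]
      · rw [Ideal.Quotient.factor_mk, Ideal.Quotient.eq_zero_iff_mem]
        exact Ideal.mem_sup_right (Ideal.mem_span_singleton_self x)
    have h3 : ringKrullDim (R ⧸ Q) ≤ ringKrullDim (R ⧸ P) :=
      ringKrullDim_le_of_surjective (Ideal.Quotient.factor hPQ) (Ideal.Quotient.factor_surjective _)
    refine le_trans ?_ (h2.trans h3)
    rw [Nat.cast_succ]
    gcongr

end AssociatedPrimes

section Parameters

variable {R : Type u} [CommRing R] [IsLocalRing R] [IsNoetherianRing R]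

theorem isFiniteLength_quotient_iff {c q : Ideal R} :
    IsFiniteLength R ((R ⧸ c) ⧸ (q • (⊤ : Submodule R (R ⧸ c)))) ↔
      ∃ n, maximalIdeal R ^ n ≤ c ⊔ q := by
  have hmap : q • (⊤ : Submodule R (R ⧸ c)) = Submodule.map c.mkQ q := by
    rw [← Submodule.range_mkQ c, LinearMap.range_eq_map, ← Submodule.map_smul'', smul_eq_mul,
      Ideal.mul_top]
  constructor
  · intro h
    have h1 := (isFiniteLength_iff_isNoetherian_isArtinian.mp h).2
    let f : ((R ⧸ c) ⧸ (q • (⊤ : Submodule R (R ⧸ c)))) →ₗ[R] R ⧸ (c ⊔ q) :=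
      Submodule.liftQ _ (Submodule.factor le_sup_left) (by
        rw [hmap, Submodule.map_le_iff_le_comap]
        intro a ha
        exact (Submodule.Quotient.mk_eq_zero _).mpr (Ideal.mem_sup_right ha))
    have hf : Function.Surjective f := by
      intro y
      obtain ⟨a, rfl⟩ := Submodule.mkQ_surjective _ y
      exact ⟨Submodule.Quotient.mk (Submodule.Quotient.mk a), rfl⟩
    have : IsArtinian R (R ⧸ (c ⊔ q)) := isArtinian_of_surjective _ f hf
    have : IsArtinianRing (R ⧸ (c ⊔ q)) := isArtinian_of_tower R this
    exact IsLocalRing.exists_maximalIdeal_pow_le_of_isArtinianRing_quotient _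
  · rintro ⟨n, hn⟩
    refine isFiniteLength_of_pow_smul (n := n) ?_
    intro r hr y
    obtain ⟨y, rfl⟩ := Submodule.mkQ_surjective _ y
    obtain ⟨y, rfl⟩ := Submodule.mkQ_surjective _ y
    rw [← map_smul, ← map_smul]
    refine (Submodule.Quotient.mk_eq_zero _).mpr ?_
    obtain ⟨a, ha, b, hb, hab⟩ := Submodule.mem_sup.mp (hn (Ideal.mul_mem_right y _ hr))
    rw [smul_eq_mul, ← hab, map_add, Submodule.mkQ_apply, (Submodule.Quotient.mk_eq_zero c).mpr ha,
      zero_add, hmap]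
    exact Submodule.mem_map_of_mem hb

theorem isSOP_quotient_iff {c : Ideal R} {t : ℕ} {y : Fin t → R} :
    IsSOP R (R ⧸ c) y ↔ ringKrullDim (R ⧸ c) = t ∧ (∀ i, y i ∈ maximalIdeal R) ∧
      ∃ n, maximalIdeal R ^ n ≤ c ⊔ Ideal.span (Set.range y) := by
  rw [IsSOP, moduleDim, Ideal.annihilator_quotient, isFiniteLength_quotient_iff]
  rfl

theorem isSOP_iff {t : ℕ} {y : Fin t → R} :
    IsSOP R R y ↔ ringKrullDim R = t ∧ (∀ i, y i ∈ maximalIdeal R) ∧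
      ∃ n, maximalIdeal R ^ n ≤ Ideal.span (Set.range y) := by
  have h1 : moduleDim R R = ringKrullDim R := by
    have : Module.annihilator R R = ⊥ := Module.annihilator_eq_bot.mpr inferInstance
    rw [moduleDim, this]
    exact ringKrullDim_eq_of_ringEquiv (RingEquiv.quotientBot R)
  have h2 : IsFiniteLength R (R ⧸ (Ideal.span (Set.range y) • (⊤ : Submodule R R))) ↔
      ∃ n, maximalIdeal R ^ n ≤ Ideal.span (Set.range y) := by
    rw [smul_eq_mul, Ideal.mul_top]
    constructor
    · intro h
      have := (isFiniteLength_iff_isNoetherian_isArtinian.mp h).2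
      have : IsArtinianRing (R ⧸ Ideal.span (Set.range y)) := isArtinian_of_tower R this
      exact IsLocalRing.exists_maximalIdeal_pow_le_of_isArtinianRing_quotient _
    · rintro ⟨n, hn⟩
      refine isFiniteLength_of_pow_smul (n := n) ?_
      intro r hr z
      obtain ⟨z, rfl⟩ := Submodule.mkQ_surjective _ z
      exact (Submodule.Quotient.mk_eq_zero _).mpr (hn (Ideal.mul_mem_right z _ hr))
  rw [IsSOP, h1, h2]
  rfl

omit [IsLocalRing R] [IsNoetherianRing R] in
theorem mem_bIdeal_quotient_iff {c : Ideal R} {z : R} :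
    z ∈ bIdeal R (R ⧸ c) ↔ ∀ (t : ℕ) (y : Fin t → R), IsSOP R (R ⧸ c) y → ∀ (i : Fin t) (a : R),
      y i * a ∈ c ⊔ Ideal.span (y '' {j | j < i}) →
        z * a ∈ c ⊔ Ideal.span (y '' {j | j < i}) := by
  have key : ∀ (q : Ideal R) (a : R), (q • (⊤ : Submodule R (R ⧸ c))).mkQ (c.mkQ a) = 0 ↔
      a ∈ c ⊔ q := by
    intro q a
    have hmap : q • (⊤ : Submodule R (R ⧸ c)) = Submodule.map c.mkQ q := by
      rw [← Submodule.range_mkQ c, LinearMap.range_eq_map, ← Submodule.map_smul'', smul_eq_mul,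
        Ideal.mul_top]
    rw [Submodule.mkQ_apply, Submodule.Quotient.mk_eq_zero, hmap, ← Submodule.mem_comap,
      Submodule.comap_map_eq, Submodule.ker_mkQ, sup_comm]
  simp only [bIdeal, Submodule.mem_iInf]
  refine forall_congr' fun t => forall_congr' fun y => forall_congr' fun hy =>
    forall_congr' fun i => ?_
  rw [Submodule.mem_annihilator]
  constructor
  · intro h a ha
    have := h ((Ideal.span (y '' {j | j < i}) • (⊤ : Submodule R (R ⧸ c))).mkQ (c.mkQ a)) (by
      rw [Submodule.mem_torsionBy_iff, ← map_smul, ← map_smul, key]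
      exact ha)
    rwa [← map_smul, ← map_smul, key] at this
  · intro h e he
    obtain ⟨e, rfl⟩ := Submodule.mkQ_surjective _ e
    obtain ⟨a, rfl⟩ := Submodule.mkQ_surjective _ e
    rw [Submodule.mem_torsionBy_iff, ← map_smul, ← map_smul, key] at he
    rw [← map_smul, ← map_smul, key]
    exact h a he

theorem isCSOP_iff {d : ℕ} (hdim : ringKrullDim R = d) {x : Fin d → R} :
    IsCSOP R R x ↔ (∀ i, x i ∈ maximalIdeal R) ∧
      (∃ n, maximalIdeal R ^ n ≤ Ideal.span (Set.range x)) ∧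
      ∀ i, x i ∈ bIdeal R (R ⧸ Ideal.span (x '' {j | i < j})) ^ 3 := by
  rw [IsCSOP, isSOP_iff, hdim, and_iff_right rfl, and_assoc]
  refine and_congr_right fun _ => and_congr_right fun _ => forall_congr' fun i => ?_
  rw [smul_eq_mul, Ideal.mul_top]

end Parameters

section ParameterLists

variable {R : Type u} [CommRing R] [IsLocalRing R]

/-- A list of elements of the maximal ideal generating an ideal primary to it. -/
structure IsParamList (c : Ideal R) (L : List R) : Prop where
  mem : ∀ a ∈ L, a ∈ maximalIdeal R
  le_radical : maximalIdeal R ≤ (c ⊔ Ideal.ofList L).radical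

variable [IsNoetherianRing R] {c : Ideal R} {d : ℕ}

theorem IsParamList.exists_pow_le {L : List R} (h : IsParamList c L) :
    ∃ n, maximalIdeal R ^ n ≤ c ⊔ Ideal.ofList L :=
  Ideal.exists_pow_le_of_le_radical_of_fg h.le_radical (IsNoetherian.noetherian _)

theorem IsParamList.ringKrullDim_le {L : List R} (h : IsParamList c L) :
    ringKrullDim (R ⧸ c) ≤ L.length := by
  classical
  obtain ⟨n, hn⟩ := h.exists_pow_le
  have h1 : ((L.toFinset : Finset R) : Set R) = {a | a ∈ L} := by
    ext a
    simp
  refine (ringKrullDim_quotient_le_card (s := L.toFinset) (n := n) ?_ ?_).trans ?_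
  · intro y hy
    exact h.mem y (List.mem_toFinset.mp hy)
  · rw [h1]
    exact hn
  · exact_mod_cast List.toFinset_card_le L

omit [IsNoetherianRing R] in
theorem IsParamList.of_append {L L' : List R} (h : IsParamList c (L ++ L')) :
    IsParamList (c ⊔ Ideal.ofList L) L' :=
  ⟨fun a ha => h.mem a (List.mem_append_right _ ha), by
    rw [sup_assoc, ← Ideal.ofList_append]
    exact h.le_radical⟩

theorem IsParamList.ringKrullDim_eq {L L' : List R} (h : IsParamList c (L ++ L'))
    (hdim : ringKrullDim (R ⧸ c) = (L.length + L'.length : ℕ)) :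
    ringKrullDim (R ⧸ (c ⊔ Ideal.ofList L)) = L'.length := by
  classical
  refine le_antisymm h.of_append.ringKrullDim_le ?_
  have hc : c ≠ ⊤ := by
    rintro rfl
    have : Subsingleton (R ⧸ (⊤ : Ideal R)) := Ideal.Quotient.subsingleton_iff.mpr rfl
    rw [ringKrullDim_eq_bot_of_subsingleton] at hdim
    exact absurd hdim.symm (WithBot.coe_ne_bot (a := ((L.length + L'.length : ℕ) : ℕ∞)))
  have : Nontrivial (R ⧸ c) := Ideal.Quotient.nontrivial_iff.mpr hc
  have := IsLocalRing.of_surjective' (Ideal.Quotient.mk c) Ideal.Quotient.mk_surjective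
  have := IsLocalHom.of_surjective (Ideal.Quotient.mk c) Ideal.Quotient.mk_surjective
  have hs' : ((L.toFinset.image (Ideal.Quotient.mk c) : Finset (R ⧸ c)) : Set (R ⧸ c)) ⊆
      Ring.jacobson (R ⧸ c) := by
    rw [IsLocalRing.ringJacobson_eq_maximalIdeal]
    intro y hy
    obtain ⟨z, hz, rfl⟩ := Finset.mem_image.mp (Finset.mem_coe.mp hy)
    rw [SetLike.mem_coe, mem_maximalIdeal]
    intro hu
    exact h.mem z (List.mem_append_left _ (List.mem_toFinset.mp hz))
      ((isUnit_map_iff (Ideal.Quotient.mk c) z).mp hu)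
  have h1 := ringKrullDim_le_ringKrullDim_quotient_add_card _ hs'
  have h2 : ringKrullDim ((R ⧸ c) ⧸ Ideal.span
      ((L.toFinset.image (Ideal.Quotient.mk c) : Finset (R ⧸ c)) : Set (R ⧸ c))) ≤
      ringKrullDim (R ⧸ (c ⊔ Ideal.ofList L)) := by
    refine ringKrullDim_le_of_surjective (Ideal.Quotient.lift (c ⊔ Ideal.ofList L)
      ((Ideal.Quotient.mk _).comp (Ideal.Quotient.mk c)) ?_) ?_
    · intro a ha
      obtain ⟨b, hb, e, he, rfl⟩ := Submodule.mem_sup.mp ha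
      rw [RingHom.comp_apply, map_add, Ideal.Quotient.eq_zero_iff_mem.mpr hb, zero_add,
        Ideal.Quotient.eq_zero_iff_mem, Finset.coe_image, ← Ideal.map_span]
      refine Ideal.mem_map_of_mem _ ?_
      have hset : ((L.toFinset : Finset R) : Set R) = {a | a ∈ L} := by
        ext a
        simp
      rw [hset]
      exact he
    · exact Ideal.Quotient.lift_surjective_of_surjective _ _
        (Ideal.Quotient.mk_surjective.comp Ideal.Quotient.mk_surjective)
  have h3 : ((L.toFinset.image (Ideal.Quotient.mk c)).card : WithBot ℕ∞) ≤ (L.length : ℕ) := by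
    exact_mod_cast Finset.card_image_le.trans (List.toFinset_card_le L)
  have h4 : ((L.length + L'.length : ℕ) : WithBot ℕ∞) ≤
      ringKrullDim (R ⧸ (c ⊔ Ideal.ofList L)) + (L.length : ℕ) := by
    rw [← hdim]
    exact h1.trans (add_le_add h2 h3)
  generalize ringKrullDim (R ⧸ (c ⊔ Ideal.ofList L)) = D at h4
  cases D with
  | bot =>
    rw [WithBot.bot_add] at h4
    exact absurd (le_bot_iff.mp h4) (WithBot.coe_ne_bot (a := ((L.length + L'.length : ℕ) : ℕ∞)))
  | coe D =>
    cases D with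
    | top => exact le_top
    | coe D =>
      norm_cast at h4 ⊢
      omega

theorem isSOP_get_iff {L : List R} :
    IsSOP R (R ⧸ c) L.get ↔ ringKrullDim (R ⧸ c) = L.length ∧ IsParamList c L := by
  have hr : Set.range L.get = {a | a ∈ L} := by
    ext a
    simp [List.mem_iff_get]
  rw [isSOP_quotient_iff, hr]
  refine and_congr_right fun _ => ⟨?_, ?_⟩
  · rintro ⟨h1, n, hn⟩
    refine ⟨fun a ha => ?_, ?_⟩
    · obtain ⟨i, rfl⟩ := List.mem_iff_get.mp ha
      exact h1 i
    · exact fun a ha => ⟨n, hn (Ideal.pow_mem_pow ha n)⟩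
  · intro h
    exact ⟨fun i => h.mem _ (List.get_mem _ _), h.exists_pow_le⟩

theorem mul_mem_of_mem_bIdeal {z : R} (hz : z ∈ bIdeal R (R ⧸ c)) {L L' : List R} {y : R}
    (hdim : ringKrullDim (R ⧸ c) = (L.length + (L'.length + 1) : ℕ))
    (h : IsParamList c (L ++ y :: L')) {a : R} (ha : y * a ∈ c ⊔ Ideal.ofList L) :
    z * a ∈ c ⊔ Ideal.ofList L := by
  have hlt : L.length < (L ++ y :: L').length := by simp
  have hset : (L ++ y :: L').get '' {j | j < ⟨L.length, hlt⟩} = {a | a ∈ L} := by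
    ext a
    rw [Set.mem_ofPred_eq, List.mem_iff_getElem]
    constructor
    · rintro ⟨⟨j, hj⟩, hjl, rfl⟩
      have : j < L.length := hjl
      exact ⟨j, this, by simp [List.getElem_append_left, this]⟩
    · rintro ⟨j, hj, rfl⟩
      exact ⟨⟨j, by simp; omega⟩, hj, by simp [List.getElem_append_left, hj]⟩
  have := mem_bIdeal_quotient_iff.mp hz _ (L ++ y :: L').get
    (isSOP_get_iff.mpr ⟨by rw [hdim]; simp, h⟩) ⟨L.length, hlt⟩ a
  rw [hset] at this
  exact this (by simpa using ha)

end ParameterLists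

section CohenMacaulay

variable {R : Type u} [CommRing R] [IsLocalRing R] [IsNoetherianRing R] {d : ℕ}

theorem isCMLocal_iff (hdim : ringKrullDim R = d) :
    IsCMLocal R ↔ ∀ i < d, Subsingleton (LCH (maximalIdeal R) (R ⧸ (⊥ : Ideal R)) i) := by
  have e : (R ⧸ (⊥ : Ideal R)) ≃ₗ[R] R := Submodule.quotEquivOfEqBot _ rfl
  rw [IsCMLocal, hdim]
  refine forall_congr' fun i => imp_congr (by norm_cast) ⟨fun h => ?_, fun h => ?_⟩
  · have h' : Subsingleton ↥((localCohomology (maximalIdeal R) i).obj (ModuleCat.of R R)) := h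
    have : Subsingleton (LCH (maximalIdeal R) R i) := (lcEquiv (maximalIdeal R) i).subsingleton
    exact LCH.subsingleton_congr e i this
  · have := LCH.subsingleton_congr e.symm i h
    exact (lcEquiv (maximalIdeal R) i).symm.subsingleton

theorem IsCMLocal.vanishing (hdim : ringKrullDim R = d) (hCM : IsCMLocal R) (L : List R) :
    ∀ L' : List R, L.length + L'.length = d → IsParamList ⊥ (L ++ L') →
      (∀ i < L'.length, Subsingleton (LCH (maximalIdeal R) (R ⧸ Ideal.ofList L) i)) ∧
      ∀ y T, L' = y :: T → ∀ a, y * a ∈ Ideal.ofList L → a ∈ Ideal.ofList L := by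
  have key : ∀ L L' : List R, L.length + L'.length = d → IsParamList ⊥ (L ++ L') →
      (∀ i < L'.length, Subsingleton (LCH (maximalIdeal R) (R ⧸ Ideal.ofList L) i)) →
      ∀ y T, L' = y :: T → ∀ a, y * a ∈ Ideal.ofList L → a ∈ Ideal.ofList L := by
    rintro L L' hd hL hv y T rfl a ha
    by_contra hna
    have h1 := le_ringKrullDim_of_annihilates (T.length + 1) (Ideal.ofList L)
      (Ideal.ofList L ⊔ Ideal.ofList [y]) a hv hna (by
        intro b hb
        rw [Ideal.ofList_singleton] at hb
        obtain ⟨t, ht⟩ := mem_sup_span_singleton.mp hb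
        have : b * a = a * (b - y * t) + t * (y * a) := by ring
        rw [this]
        exact Ideal.add_mem _ (Ideal.mul_mem_left _ _ ht) (Ideal.mul_mem_left _ _ ha))
    have h2 : IsParamList (⊥ ⊔ Ideal.ofList (L ++ [y])) T :=
      IsParamList.of_append (by rwa [List.append_assoc, List.singleton_append])
    rw [bot_sup_eq, Ideal.ofList_append] at h2
    have := h1.trans h2.ringKrullDim_le
    norm_cast at this
    omega
  induction L using List.reverseRecOn with
  | nil =>
    intro L' hd hL
    have : ∀ i < L'.length,
        Subsingleton (LCH (maximalIdeal R) (R ⧸ Ideal.ofList ([] : List R)) i) := by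
      rw [Ideal.ofList_nil]
      intro i hi
      exact (isCMLocal_iff hdim).mp hCM i (by simp at hd; omega)
    exact ⟨this, key [] L' hd hL this⟩
  | append_singleton L y ih =>
    intro L' hd hL
    rw [List.append_assoc, List.singleton_append] at hL
    obtain ⟨hv, hr⟩ := ih (y :: L') (by simp at hd ⊢; omega) hL
    have : ∀ i < L'.length,
        Subsingleton (LCH (maximalIdeal R) (R ⧸ Ideal.ofList (L ++ [y])) i) := by
      intro i hi
      rw [Ideal.ofList_append, Ideal.ofList_singleton]
      exact LCH.subsingleton_quotient (hr y L' rfl) (hv i (by simp; omega))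
        (hv (i + 1) (by simp; omega))
    exact ⟨this, key _ L' hd (by rwa [List.append_assoc, List.singleton_append]) this⟩

theorem IsCMLocal.regular (hdim : ringKrullDim R = d) (hCM : IsCMLocal R) {L L' : List R} {y : R}
    (hd : L.length + (L'.length + 1) = d) (h : IsParamList ⊥ (L ++ y :: L')) {a : R}
    (ha : y * a ∈ Ideal.ofList L) : a ∈ Ideal.ofList L :=
  (hCM.vanishing hdim L (y :: L') hd h).2 y L' rfl a ha

omit [IsNoetherianRing R] in
/-- A regular sequence of length `d` forces the Cohen-Macaulay property. -/
theorem subsingleton_of_regular_list (L' : List R) : ∀ L : List R,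
    (∀ y ∈ L', y ∈ maximalIdeal R) →
    (∀ T y T', L' = T ++ y :: T' → ∀ a, y * a ∈ Ideal.ofList (L ++ T) → a ∈ Ideal.ofList (L ++ T)) →
    ∀ i < L'.length, Subsingleton (LCH (maximalIdeal R) (R ⧸ Ideal.ofList L) i) := by
  induction L' with
  | nil => intro L _ _ i hi; simp at hi
  | cons y L' ih =>
    intro L hm hr
    refine LCH.subsingleton_of_quotient (x := y) (hm y (by simp)) ?_ ?_
    · simpa using hr [] y L' rfl
    · have := ih (L ++ [y]) (fun z hz => hm z (by simp [hz])) (by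
        intro T z T' hT a
        rw [List.append_assoc, List.singleton_append]
        exact hr (y :: T) z T' (by rw [hT]; rfl) a)
      rwa [Ideal.ofList_append, Ideal.ofList_singleton] at this

end CohenMacaulay

section SequenceIdeals

variable {R : Type u} [CommRing R]

/-- The ideal generated by `c` and the first `i` members of a sequence. -/
def seqIdeal (c : Ideal R) (x : ℕ → R) : ℕ → Ideal R
  | 0 => c
  | i + 1 => seqIdeal c x i ⊔ Ideal.span {x i}

variable {c : Ideal R} {x : ℕ → R}

theorem seqIdeal_succ (i : ℕ) : seqIdeal c x (i + 1) = seqIdeal c x i ⊔ Ideal.span {x i} := rfl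

theorem seqIdeal_mono : Monotone (seqIdeal c x) :=
  monotone_nat_of_le_succ fun _ => le_sup_left

theorem mem_seqIdeal {l i : ℕ} (h : l < i) : x l ∈ seqIdeal c x i :=
  seqIdeal_mono (Nat.succ_le_of_lt h) (Ideal.mem_sup_right (Ideal.mem_span_singleton_self (x l)))

theorem mem_seqIdeal_succ {i : ℕ} {a : R} :
    a ∈ seqIdeal c x (i + 1) ↔ ∃ t, a - x i * t ∈ seqIdeal c x i :=
  mem_sup_span_singleton

theorem seqIdeal_eq (i : ℕ) :
    seqIdeal c x i = c ⊔ Ideal.ofList ((List.range i).map x) := by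
  induction i with
  | zero => simp [seqIdeal]
  | succ i ih =>
    rw [seqIdeal_succ, ih, List.range_succ, List.map_append, Ideal.ofList_append, sup_assoc]
    simp

theorem seqIdeal_sup (b : Ideal R) (i : ℕ) : seqIdeal (c ⊔ b) x i = seqIdeal c x i ⊔ b := by
  induction i with
  | zero => rfl
  | succ i ih => rw [seqIdeal_succ, seqIdeal_succ, ih, sup_right_comm]

/-- `x 0, …, x (d - 1)` is a d-sequence modulo `c`. -/
def IsDSeq (c : Ideal R) (x : ℕ → R) (d : ℕ) : Prop :=
  ∀ i j a, i ≤ j → j < d → x i * (x j * a) ∈ seqIdeal c x i → x j * a ∈ seqIdeal c x i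

variable {d : ℕ} (h : IsDSeq c x d)
include h

theorem IsDSeq.mul_mem {i j : ℕ} {a : R} (hij : i ≤ j) (hj : j < d)
    (ha : x i * a ∈ seqIdeal c x i) : x j * a ∈ seqIdeal c x i := by
  refine h i j a hij hj ?_
  rw [mul_left_comm]
  exact Ideal.mul_mem_left _ _ ha

theorem IsDSeq.mem_of_mul_mem {i : ℕ} {a : R} (hi : i < d) (ha : x i * a ∈ seqIdeal c x i) (k : ℕ)
    (hk : i + k ≤ d) (hak : a ∈ seqIdeal c x (i + k)) : a ∈ seqIdeal c x i := by
  induction k with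
  | zero => exact hak
  | succ k ih =>
    refine ih (by omega) ?_
    obtain ⟨t, ht⟩ := (mem_seqIdeal_succ (i := i + k)).mp hak
    have h1 : x (i + k) * a ∈ seqIdeal c x (i + k) :=
      seqIdeal_mono (Nat.le_add_right i k) (h.mul_mem (Nat.le_add_right i k) (by omega) ha)
    have h2 : x (i + k) * (x (i + k) * t) ∈ seqIdeal c x (i + k) := by
      have := Ideal.sub_mem _ h1 (Ideal.mul_mem_left _ (x (i + k)) ht)
      convert this using 1
      ring
    have h3 := h (i + k) (i + k) t le_rfl (by omega) h2
    have := Ideal.add_mem _ ht h3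
    simpa using this

theorem IsDSeq.inf_pow {h0 : c = ⊥} (k : ℕ) : ∀ i, i + k = d → ∀ n,
    seqIdeal c x i ⊓ seqIdeal c x d ^ (n + 1) ≤ seqIdeal c x i * seqIdeal c x d ^ n := by
  induction k with
  | zero =>
    rintro i rfl n
    rw [add_zero, ← pow_succ']
    exact inf_le_right
  | succ k ih =>
    intro i hi n
    induction n with
    | zero =>
      rw [pow_zero, Ideal.one_eq_top, Ideal.mul_top]
      exact inf_le_left
    | succ n ihn =>
      rintro a ⟨ha1, ha2⟩
      have h1 := ih (i + 1) (by omega) (n + 1) ⟨seqIdeal_mono (Nat.le_succ i) ha1, ha2⟩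
      rw [seqIdeal_succ, Ideal.sup_mul] at h1
      obtain ⟨a', ha', y, hy, rfl⟩ := Submodule.mem_sup.mp h1
      obtain ⟨t, ht, rfl⟩ := Ideal.mem_span_singleton_mul.mp hy
      refine Ideal.add_mem _ ha' ?_
      have h2 : x i * t ∈ seqIdeal c x i := by
        have := Ideal.sub_mem _ ha1 (Ideal.mul_le_inf ha').1
        simpa using this
      have h3 : t ∈ seqIdeal c x i := by
        refine h.mem_of_mul_mem (by omega) h2 (k + 1) (by omega) ?_
        rw [hi]
        exact Ideal.pow_le_self (Nat.succ_ne_zero n) ht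
      have h4 := ihn ⟨h3, ht⟩
      have := Ideal.mul_mem_mul h4 (mem_seqIdeal (c := c) (x := x) (show i < d by omega))
      rwa [mul_assoc, ← pow_succ, mul_comm t] at this

end SequenceIdeals

section Colon

variable {R : Type u} [CommRing R] {x : ℕ → R} {d : ℕ}

/-- The colon ideal of the first `i` members of a sequence by the next one. -/
def seqColon (x : ℕ → R) (i : ℕ) : Ideal R := modColon R (seqIdeal ⊥ x i) (Ideal.span {x i})

theorem mem_seqColon {i : ℕ} {a : R} : a ∈ seqColon x i ↔ x i * a ∈ seqIdeal ⊥ x i := by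
  constructor
  · intro h
    exact h _ (Ideal.mem_span_singleton_self _)
  · intro h r hr
    obtain ⟨t, rfl⟩ := Ideal.mem_span_singleton.mp hr
    have := Ideal.mul_mem_left _ t h
    rw [smul_eq_mul]
    convert this using 1
    ring

variable (h : IsDSeq ⊥ x d)
include h

theorem IsDSeq.seqColon_inf {i : ℕ} (hi : i < d) :
    seqColon x i ⊓ seqIdeal ⊥ x d ≤ seqIdeal ⊥ x i := by
  rintro a ⟨h1, h2⟩
  refine h.mem_of_mul_mem hi (mem_seqColon.mp h1) (d - i) (by omega) ?_
  rwa [Nat.add_sub_cancel' hi.le]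

theorem IsDSeq.seqColon_le {i : ℕ} (hi : i + 1 < d) : seqColon x i ≤ seqColon x (i + 1) := by
  intro a ha
  exact mem_seqColon.mpr (seqIdeal_mono (Nat.le_succ i)
    (h.mul_mem (Nat.le_succ i) hi (mem_seqColon.mp ha)))

theorem IsDSeq.mem_of_mul_mem_pow {i : ℕ} (hi : i < d) {n : ℕ} {a : R}
    (ha : x i * a ∈ seqIdeal ⊥ x d ^ (n + 1) ⊔ seqColon x i) :
    a ∈ seqIdeal ⊥ x d ^ n ⊔ seqColon x i := by
  obtain ⟨b, hb, e, he, hbe⟩ := Submodule.mem_sup.mp ha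
  have h1 : e ∈ seqIdeal ⊥ x i := by
    refine h.seqColon_inf hi ⟨he, ?_⟩
    have : e = x i * a - b := by rw [← hbe]; ring
    rw [this]
    exact Ideal.sub_mem _ (Ideal.mul_mem_right _ _ (mem_seqIdeal hi))
      (Ideal.pow_le_self (Nat.succ_ne_zero n) hb)
  have h2 : b ∈ seqIdeal ⊥ x (i + 1) := by
    refine mem_seqIdeal_succ.mpr ⟨a, ?_⟩
    rw [← hbe]
    simpa using h1
  have h3 := h.inf_pow (h0 := rfl) (d - (i + 1)) (i + 1) (by omega) n ⟨h2, hb⟩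
  rw [seqIdeal_succ, Ideal.sup_mul] at h3
  obtain ⟨b', hb', y, hy, rfl⟩ := Submodule.mem_sup.mp h3
  obtain ⟨t, ht, rfl⟩ := Ideal.mem_span_singleton_mul.mp hy
  have h4 : x i * (a - t) ∈ seqIdeal ⊥ x i := by
    have : x i * (a - t) = b' + e := by linear_combination -hbe
    rw [this]
    exact Ideal.add_mem _ (Ideal.mul_le_inf hb').1 h1
  have := Ideal.add_mem _ (Ideal.mem_sup_left (T := seqColon x i) ht)
    (Ideal.mem_sup_right (S := seqIdeal ⊥ x d ^ n) (mem_seqColon.mpr h4))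
  simpa using this

end Colon

section CSystems

variable {R : Type u} [CommRing R] [IsLocalRing R]

/-- The ideal generated by the members of a sequence with index in `[k, d)`. -/
def tailIdeal (x : ℕ → R) (d k : ℕ) : Ideal R := Ideal.ofList ((List.range' k (d - k)).map x)

omit [IsLocalRing R] in
theorem tailIdeal_eq_sup {x : ℕ → R} {d k : ℕ} (hk : k < d) :
    tailIdeal x d k = tailIdeal x d (k + 1) ⊔ Ideal.span {x k} := by
  obtain ⟨n, hn⟩ : ∃ n, d - k = n + 1 := ⟨d - k - 1, by omega⟩
  rw [tailIdeal, tailIdeal, hn, show d - (k + 1) = n by omega, List.range'_succ, List.map_cons,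
    Ideal.ofList_cons, sup_comm]

omit [IsLocalRing R] in
theorem tailIdeal_self {x : ℕ → R} {d : ℕ} : tailIdeal x d d = ⊥ := by
  simp [tailIdeal]

/-- A C-system of parameters, indexed by natural numbers. -/
structure IsCSeq (x : ℕ → R) (d : ℕ) : Prop where
  param : IsParamList ⊥ ((List.range d).map x)
  mem_b : ∀ l < d, x l ∈ bIdeal R (R ⧸ tailIdeal x d (l + 1)) ^ 3

variable [IsNoetherianRing R]

omit [IsNoetherianRing R] in
theorem IsParamList.of_radical {c c' : Ideal R} {L L' : List R} (h : IsParamList c L)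
    (hm : ∀ a ∈ L', a ∈ maximalIdeal R) (hc : c ≤ (c' ⊔ Ideal.ofList L').radical)
    (hL : ∀ a ∈ L, a ∈ (c' ⊔ Ideal.ofList L').radical) : IsParamList c' L' :=
  ⟨hm, h.le_radical.trans (Ideal.radical_le_radical_iff.mpr
    (sup_le hc (Ideal.span_le.mpr fun a ha => hL a ha)))⟩

omit [IsLocalRing R] [IsNoetherianRing R] in
theorem mem_sup_ofList {c : Ideal R} {L : List R} {a : R} (h : a ∈ L) : a ∈ c ⊔ Ideal.ofList L :=
  Ideal.mem_sup_right (Ideal.subset_span h)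

theorem IsParamList.of_mem_iff {c : Ideal R} {L L' : List R} (h : IsParamList c L)
    (hm : ∀ a, a ∈ L' ↔ a ∈ L) : IsParamList c L' :=
  h.of_radical (fun a ha => h.mem a ((hm a).mp ha)) (le_sup_left.trans Ideal.le_radical)
    (fun a ha => Ideal.le_radical (mem_sup_ofList ((hm a).mpr ha)))

variable {x : ℕ → R} {d : ℕ} (hdim : ringKrullDim R = d) (h : IsCSeq x d)

include h in
theorem IsCSeq.param_tail {k : ℕ} (hk : k ≤ d) :
    IsParamList ⊥ ((List.range' k (d - k)).map x ++ (List.range k).map x) := by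
  refine h.param.of_mem_iff fun a => ?_
  simp only [List.mem_append, List.mem_map, List.mem_range, List.mem_range'_1]
  constructor
  · rintro (⟨l, hl, rfl⟩ | ⟨l, hl, rfl⟩)
    · exact ⟨l, by omega, rfl⟩
    · exact ⟨l, by omega, rfl⟩
  · rintro ⟨l, hl, rfl⟩
    rcases lt_or_ge l k with h1 | h1
    · exact Or.inr ⟨l, h1, rfl⟩
    · exact Or.inl ⟨l, by omega, rfl⟩

include h in
theorem IsCSeq.param_mod_tail {k : ℕ} (hk : k ≤ d) :
    IsParamList (tailIdeal x d k) ((List.range k).map x) := by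
  have := (h.param_tail hk).of_append
  rwa [bot_sup_eq] at this

omit [IsLocalRing R] [IsNoetherianRing R] in
include hdim in
theorem ringKrullDim_quotient_bot : ringKrullDim (R ⧸ (⊥ : Ideal R)) = d := by
  rw [← hdim]
  exact ringKrullDim_eq_of_ringEquiv (RingEquiv.quotientBot R)

include hdim h in
theorem IsCSeq.ringKrullDim_tail {k : ℕ} (hk : k ≤ d) :
    ringKrullDim (R ⧸ tailIdeal x d k) = k := by
  have := (h.param_tail hk).ringKrullDim_eq (by
    rw [ringKrullDim_quotient_bot hdim]
    simp [Nat.sub_add_cancel hk])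
  rw [bot_sup_eq, List.length_map, List.length_range] at this
  exact this

omit [IsNoetherianRing R] in
include h in
theorem IsCSeq.mem_bIdeal {l : ℕ} (hl : l < d) :
    x l ∈ bIdeal R (R ⧸ tailIdeal x d (l + 1)) :=
  Ideal.pow_le_self three_ne_zero (h.mem_b l hl)

include hdim h in
theorem IsCSeq.mul_mem_of_bIdeal {k i : ℕ} (hik : i < k) (hk : k ≤ d) {z a : R}
    (hz : z ∈ bIdeal R (R ⧸ tailIdeal x d k))
    (ha : x i * a ∈ seqIdeal (tailIdeal x d k) x i) :
    z * a ∈ seqIdeal (tailIdeal x d k) x i := by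
  rw [seqIdeal_eq] at ha ⊢
  refine mul_mem_of_mem_bIdeal hz (y := x i) (L' := (List.range' (i + 1) (k - i - 1)).map x) ?_ ?_ ha
  · rw [h.ringKrullDim_tail hdim hk, List.length_map, List.length_map, List.length_range,
      List.length_range']
    congr 1
    omega
  · refine (h.param_mod_tail hk).of_mem_iff fun a => ?_
    rw [← List.map_cons, ← List.map_append]
    simp only [List.mem_append, List.mem_map, List.mem_range, List.mem_cons, List.mem_range'_1]
    refine exists_congr fun l => and_congr_left fun _ => ?_
    omega

include hdim h in
theorem IsCSeq.mul_mem_of_bIdeal_sq {k i : ℕ} (hik : i ≤ k) (hk : k < d) {z a : R}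
    (hz : z ∈ bIdeal R (R ⧸ tailIdeal x d (k + 1)))
    (ha : x k * (x k * a) ∈ seqIdeal (tailIdeal x d (k + 1)) x i) :
    z * a ∈ seqIdeal (tailIdeal x d (k + 1)) x i := by
  have hm : ∀ l < d, x l ∈ maximalIdeal R := fun l hl =>
    h.param.mem _ (List.mem_map_of_mem (List.mem_range.mpr hl))
  rw [seqIdeal_eq] at ha ⊢
  refine mul_mem_of_mem_bIdeal hz (y := x k ^ 2) (L' := (List.range' i (k - i)).map x) ?_ ?_ ?_
  · rw [h.ringKrullDim_tail hdim hk, List.length_map, List.length_map, List.length_range,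
      List.length_range']
    congr 1
    omega
  · refine (h.param_mod_tail hk).of_radical ?_ (le_sup_left.trans Ideal.le_radical) ?_
    · intro a ha
      simp only [List.mem_append, List.mem_map, List.mem_range, List.mem_cons,
        List.mem_range'_1] at ha
      rcases ha with ⟨l, hl, rfl⟩ | rfl | ⟨l, hl, rfl⟩
      · exact hm l (by omega)
      · exact Ideal.pow_le_self two_ne_zero (Ideal.pow_mem_pow (hm k hk) 2)
      · exact hm l (by omega)
    · intro a ha
      obtain ⟨l, hl, rfl⟩ := List.mem_map.mp ha
      rw [List.mem_range] at hl
      rcases Nat.lt_or_ge l i with h1 | h1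
      · exact Ideal.le_radical (mem_sup_ofList (List.mem_append_left _
          (List.mem_map_of_mem (List.mem_range.mpr h1))))
      · rcases Nat.lt_or_ge l k with h2 | h2
        · refine Ideal.le_radical (mem_sup_ofList (List.mem_append_right _
            (List.mem_cons_of_mem _ (List.mem_map_of_mem ?_))))
          rw [List.mem_range'_1]
          omega
        · obtain rfl : l = k := by omega
          exact ⟨2, mem_sup_ofList (List.mem_append_right _ List.mem_cons_self)⟩
  · rwa [sq, mul_assoc]

include hdim h in
theorem IsCSeq.isDSeq_tail (k : ℕ) (hk : k ≤ d) : IsDSeq (tailIdeal x d k) x k := by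
  induction k with
  | zero => intro i j a _ hj; omega
  | succ k ih =>
    have hz := h.mem_bIdeal (l := k) (by omega)
    have hlast : ∀ i a, i ≤ k → x i * (x k * a) ∈ seqIdeal (tailIdeal x d (k + 1)) x i →
        x k * a ∈ seqIdeal (tailIdeal x d (k + 1)) x i := by
      intro i a hi ha
      rcases Nat.lt_or_eq_of_le hi with h1 | rfl
      · exact h.mul_mem_of_bIdeal_sq hdim hi hk hz
          (h.mul_mem_of_bIdeal hdim (Nat.lt_succ_of_le hi) hk hz ha)
      · exact h.mul_mem_of_bIdeal_sq hdim hi hk hz ha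
    intro i j a hij hj ha
    rcases Nat.lt_or_eq_of_le (Nat.le_of_lt_succ hj) with h1 | rfl
    · have h2 := ih (by omega) i j a hij h1
      rw [tailIdeal_eq_sup hk, seqIdeal_sup] at h2
      obtain ⟨w, hw⟩ := mem_sup_span_singleton.mp (h2 (Ideal.mem_sup_left ha))
      have h3 := hlast i w (by omega) (by
        have := Ideal.sub_mem _ ha (Ideal.mul_mem_left _ (x i) hw)
        convert this using 1
        ring)
      have := Ideal.add_mem _ hw h3
      simpa using this
    · exact hlast i a hij ha

include hdim h in
theorem IsCSeq.isDSeq : IsDSeq ⊥ x d := by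
  have := h.isDSeq_tail hdim d le_rfl
  rwa [tailIdeal_self] at this

end CSystems

section RelativeLength

variable {R : Type u} [CommRing R]

theorem length_range_le {M N X : Type*} [AddCommGroup M] [Module R M] [AddCommGroup N] [Module R N]
    [AddCommGroup X] [Module R X] (f : X →ₗ[R] M) (g : X →ₗ[R] N)
    (h : ∀ a, g a = 0 → f a = 0) :
    Module.length R (LinearMap.range f) ≤ Module.length R (LinearMap.range g) := by
  have hle : LinearMap.ker g ≤ LinearMap.ker f := h
  rw [← f.quotKerEquivRange.length_eq, ← g.quotKerEquivRange.length_eq]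
  exact Module.length_le_of_surjective (Submodule.factor hle) (Submodule.factor_surjective hle)

theorem length_mono {M : Type*} [AddCommGroup M] [Module R M] {N P : Submodule R M} (h : N ≤ P) :
    Module.length R N ≤ Module.length R P :=
  Module.length_le_of_injective (Submodule.inclusion h) (Submodule.inclusion_injective h)

/-- The length of `(A + B) / B`. -/
def relLength (A B : Ideal R) : ℕ∞ := Module.length R (Submodule.map B.mkQ A)

variable {A A' B B' : Ideal R}

theorem relLength_eq_range : relLength A B =
    Module.length R (LinearMap.range (B.mkQ ∘ₗ A.subtype)) := by
  rw [LinearMap.range_comp, Submodule.range_subtype, relLength]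

theorem relLength_le_length {M : Type*} [AddCommGroup M] [Module R M] (f : R →ₗ[R] M)
    (h : ∀ a ∈ A, f a = 0 → a ∈ B) : relLength A B ≤ Module.length R (Submodule.map f A) := by
  have : Submodule.map f A = LinearMap.range (f ∘ₗ A.subtype) := by
    rw [LinearMap.range_comp, Submodule.range_subtype]
  rw [relLength_eq_range, this]
  exact length_range_le _ _ fun a ha => (Submodule.Quotient.mk_eq_zero _).mpr (h a a.2 ha)

theorem length_le_relLength {M : Type*} [AddCommGroup M] [Module R M] (f : R →ₗ[R] M)
    (h : ∀ a ∈ A, a ∈ B → f a = 0) : Module.length R (Submodule.map f A) ≤ relLength A B := by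
  have : Submodule.map f A = LinearMap.range (f ∘ₗ A.subtype) := by
    rw [LinearMap.range_comp, Submodule.range_subtype]
  rw [relLength_eq_range, this]
  exact length_range_le _ _ fun a ha => h a a.2 ((Submodule.Quotient.mk_eq_zero _).mp ha)

theorem relLength_mono (h : A ≤ A') : relLength A B ≤ relLength A' B :=
  length_mono (Submodule.map_mono h)

theorem relLength_anti (h : B ≤ B') : relLength A B' ≤ relLength A B :=
  length_le_relLength B'.mkQ fun _ _ ha => (Submodule.Quotient.mk_eq_zero _).mpr (h ha)

theorem relLength_le_mul {x : R} (h : ∀ a ∈ A, x * a ∈ B' → a ∈ B) (hA : ∀ a ∈ A, x * a ∈ A') :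
    relLength A B ≤ relLength A' B' := by
  refine (relLength_le_length (B'.mkQ ∘ₗ LinearMap.mulLeft R x) fun a ha h0 =>
    h a ha ((Submodule.Quotient.mk_eq_zero _).mp h0)).trans ?_
  refine length_mono ?_
  rw [Submodule.map_comp]
  refine Submodule.map_mono ?_
  rintro _ ⟨a, ha, rfl⟩
  exact hA a ha

theorem mul_relLength_le {x : R} (h : ∀ a ∈ A, a ∈ B → x * a ∈ B')
    (hA : ∀ b ∈ A', ∃ a ∈ A, b - x * a ∈ B') :
    relLength A' B' ≤ relLength A B := by
  refine le_trans (length_mono ?_) (length_le_relLength (B'.mkQ ∘ₗ LinearMap.mulLeft R x)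
    fun a ha h0 => (Submodule.Quotient.mk_eq_zero _).mpr (h a ha h0))
  rintro _ ⟨b, hb, rfl⟩
  obtain ⟨a, ha, hab⟩ := hA b hb
  exact ⟨a, ha, ((Submodule.Quotient.eq _).mpr hab).symm⟩

theorem relLength_eq_add (h : B ≤ B') :
    relLength A B = relLength (A ⊓ B') B + relLength A B' := by
  let g : Submodule.map B.mkQ A →ₗ[R] Submodule.map B'.mkQ A :=
    (Submodule.factor h).restrict (by
      rintro _ ⟨a, ha, rfl⟩
      exact ⟨a, ha, rfl⟩)
  have hle : Submodule.map B.mkQ (A ⊓ B') ≤ Submodule.map B.mkQ A := Submodule.map_mono inf_le_left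
  refine Module.length_eq_add_of_exact (Submodule.inclusion hle) g
    (Submodule.inclusion_injective hle) ?_ ?_
  · rintro ⟨_, a, ha, rfl⟩
    exact ⟨⟨Submodule.Quotient.mk a, a, ha, rfl⟩, rfl⟩
  · rintro ⟨_, a, ha, rfl⟩
    constructor
    · intro h0
      have : a ∈ B' := (Submodule.Quotient.mk_eq_zero _).mp (congrArg Subtype.val h0)
      exact ⟨⟨B.mkQ a, a, ⟨ha, this⟩, rfl⟩, rfl⟩
    · rintro ⟨⟨_, b, hb, rfl⟩, hab⟩
      have h1 : B.mkQ b = B.mkQ a := congrArg Subtype.val hab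
      have h2 : b - a ∈ B := (Submodule.Quotient.eq _).mp h1
      refine Subtype.ext ((Submodule.Quotient.mk_eq_zero _).mpr ?_)
      have := B'.sub_mem hb.2 (h h2)
      simpa using this

theorem relLength_add_le (h : B ≤ B') (h1 : A' ≤ A) (h2 : A' ≤ B') :
    relLength A' B + relLength A B' ≤ relLength A B := by
  rw [relLength_eq_add (A := A) h]
  exact add_le_add (relLength_mono (le_inf h1 h2)) le_rfl

theorem relLength_eq_zero (h : A ≤ B) : relLength A B = 0 := by
  have := relLength_le_mul (A := A) (B := B) (A' := ⊥) (B' := ⊥) (x := 0) (fun a ha _ => h ha)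
    (fun a _ => by simp)
  refine le_antisymm (this.trans ?_) zero_le
  rw [relLength, Submodule.map_bot]
  simp

theorem relLength_top : relLength ⊤ B = Module.length R (R ⧸ B) := by
  rw [relLength, Submodule.map_top, Submodule.range_mkQ, Module.length_top]

end RelativeLength

section LowerBound

variable {R : Type u} [CommRing R] {x : ℕ → R} {d : ℕ} (h : IsDSeq ⊥ x d)
include h

theorem IsDSeq.relLength_step (J : Ideal R) {i : ℕ} (hi : i < d) (n : ℕ) :
    relLength (seqIdeal ⊥ x d ^ n * J) (seqIdeal ⊥ x d ^ (n + 1) ⊔ seqColon x i) ≤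
      relLength (Ideal.span {x i} * (seqIdeal ⊥ x d ^ n * J))
        (seqIdeal ⊥ x d ^ (n + 2) ⊔ seqColon x i) :=
  relLength_le_mul (x := x i) (fun _ _ ha => h.mem_of_mul_mem_pow hi ha)
    fun _ ha => Ideal.mul_mem_mul (Ideal.mem_span_singleton_self _) ha

theorem IsDSeq.choose_mul_relLength_le_aux (J : Ideal R) (k : ℕ) : ∀ i, i + k + 1 = d → ∀ n,
    ((n + k).choose k : ℕ∞) * relLength J (seqIdeal ⊥ x d ⊔ seqColon x (d - 1)) ≤
      relLength (seqIdeal ⊥ x d ^ n * J) (seqIdeal ⊥ x d ^ (n + 1) ⊔ seqColon x i) := by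
  have hle : ∀ i n, i < d → Ideal.span {x i} * (seqIdeal ⊥ x d ^ n * J) ≤
      seqIdeal ⊥ x d ^ (n + 1) * J := by
    intro i n hi
    rw [pow_succ', mul_assoc]
    exact Ideal.mul_mono_left ((Ideal.span_singleton_le_iff_mem _).mpr (mem_seqIdeal hi))
  induction k with
  | zero =>
    intro i hi n
    obtain rfl : i = d - 1 := by omega
    induction n with
    | zero => simp
    | succ n ihn =>
      simp only [add_zero, Nat.choose_zero_right] at ihn ⊢
      exact ihn.trans ((h.relLength_step J (by omega) n).trans
        (relLength_mono (hle _ n (by omega))))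
  | succ k ih =>
    intro i hi n
    have hc := h.seqColon_le (i := i) (by omega)
    induction n with
    | zero =>
      have := ih (i + 1) (by omega) 0
      simp only [zero_add, Nat.choose_self] at this ⊢
      exact this.trans (relLength_anti (sup_le_sup_left hc _))
    | succ n ihn =>
      have h1 := ih (i + 1) (by omega) (n + 1)
      have h2 := relLength_add_le (A := seqIdeal ⊥ x d ^ (n + 1) * J)
        (B := seqIdeal ⊥ x d ^ (n + 2) ⊔ seqColon x i)
        (B' := seqIdeal ⊥ x d ^ (n + 2) ⊔ seqColon x (i + 1))
        (sup_le_sup_left hc _) (hle i n (by omega)) (by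
          refine Ideal.mul_le_left.trans ?_ |>.trans le_sup_right
          rw [Ideal.span_singleton_le_iff_mem, mem_seqColon]
          exact Ideal.mul_mem_left _ _ (mem_seqIdeal (Nat.lt_succ_self i)))
      refine le_trans ?_ h2
      rw [show n + 1 + (k + 1) = (n + 1 + k) + 1 by ring, Nat.choose_succ_succ, add_comm,
        Nat.cast_add, add_mul]
      refine add_le_add ?_ h1
      refine le_trans ?_ (h.relLength_step J (by omega) n)
      rw [show n + 1 + k = n + (k + 1) by ring]
      exact ihn

theorem IsDSeq.choose_mul_relLength_le (J : Ideal R) (hd : 0 < d) (n : ℕ) :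
    ((n + (d - 1)).choose (d - 1) : ℕ∞) *
        relLength J (seqIdeal ⊥ x d ⊔ seqColon x (d - 1)) ≤
      relLength (seqIdeal ⊥ x d ^ n * J) (seqIdeal ⊥ x d ^ (n + 1)) :=
  (h.choose_mul_relLength_le_aux J (d - 1) 0 (by omega) n).trans (relLength_anti le_sup_left)

end LowerBound

section Witness

variable {R : Type u} [CommRing R] [IsLocalRing R]

theorem exists_socle_of_pow {c : Ideal R} {n : ℕ} : ∀ {z : R}, z ∉ c →
    (∀ r ∈ maximalIdeal R ^ n, r * z ∈ c) →
    ∃ t, t * z ∉ c ∧ ∀ r ∈ maximalIdeal R, r * (t * z) ∈ c := by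
  induction n with
  | zero =>
    intro z hz h
    exact absurd (by simpa using h 1 (by simp)) hz
  | succ n ih =>
    intro z hz h
    by_cases h1 : ∀ r ∈ maximalIdeal R, r * z ∈ c
    · exact ⟨1, by simpa using hz, by simpa using h1⟩
    · push Not at h1
      obtain ⟨r, hr, hrz⟩ := h1
      obtain ⟨t, ht, ht'⟩ := ih hrz (by
        intro r' hr'
        rw [← mul_assoc]
        exact h _ (by rw [pow_succ]; exact Ideal.mul_mem_mul hr' hr))
      exact ⟨t * r, by rwa [mul_assoc], by simpa only [mul_assoc] using ht'⟩

variable [IsNoetherianRing R] {x : ℕ → R} {d : ℕ}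

omit [IsNoetherianRing R] in
theorem seqIdeal_bot_eq_tail (hd : 0 < d) :
    seqIdeal (tailIdeal x d (d - 1)) x (d - 1) = seqIdeal ⊥ x d := by
  obtain ⟨k, rfl⟩ : ∃ k, d = k + 1 := ⟨d - 1, by omega⟩
  rw [Nat.add_sub_cancel, tailIdeal_eq_sup (Nat.lt_succ_self k), tailIdeal_self, seqIdeal_sup]
  rfl

omit [IsNoetherianRing R] in
theorem tailIdeal_last (hd : 0 < d) : tailIdeal x d (d - 1) = ⊥ ⊔ Ideal.span {x (d - 1)} := by
  rw [tailIdeal_eq_sup (by omega), Nat.sub_add_cancel hd, tailIdeal_self]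

theorem mem_seqIdeal_tail (hd : 0 < d) {i : ℕ} {a : R} :
    a ∈ seqIdeal (tailIdeal x d (d - 1)) x i ↔ ∃ t, a - x (d - 1) * t ∈ seqIdeal ⊥ x i := by
  rw [tailIdeal_last hd, seqIdeal_sup, mem_sup_span_singleton]

variable (hdim : ringKrullDim R = d) (h : IsCSeq x d)

include hdim h in
theorem IsCSeq.exists_colon_ne (hd : 0 < d) (hreg : ∀ a, x (d - 1) * a = 0 → a = 0)
    (hCM : ¬ IsCMLocal R) :
    ∃ s < d - 1, ∃ a, x s * a ∈ seqIdeal (tailIdeal x d (d - 1)) x s ∧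
      a ∉ seqIdeal (tailIdeal x d (d - 1)) x s := by
  by_contra hcon
  push Not at hcon
  apply hCM
  rw [isCMLocal_iff hdim]
  have := subsingleton_of_regular_list (x (d - 1) :: (List.range (d - 1)).map x) [] (by
    intro y hy
    refine h.param.mem y ?_
    rcases List.mem_cons.mp hy with rfl | hy
    · exact List.mem_map_of_mem (List.mem_range.mpr (by omega))
    · obtain ⟨l, hl, rfl⟩ := List.mem_map.mp hy
      exact List.mem_map_of_mem (List.mem_range.mpr (by rw [List.mem_range] at hl; omega))) (by
    intro T y T' hT a
    rw [List.nil_append]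
    rcases T with _ | ⟨z, T⟩
    · obtain ⟨rfl, -⟩ := List.cons.inj hT
      simpa using hreg a
    · obtain ⟨rfl, hT'⟩ := List.cons.inj hT
      obtain ⟨l₁, l₂, hl, hl₁, hl₂⟩ := List.map_eq_append_iff.mp hT'
      obtain ⟨s, l₃, rfl, rfl, -⟩ := List.map_eq_cons_iff.mp hl₂
      have hlen : l₁.length < d - 1 := by
        have := congrArg List.length hl
        simp at this
        omega
      have h1 : l₁ = List.range l₁.length := by
        have := congrArg (List.take l₁.length) hl
        rw [List.take_range, min_eq_left hlen.le] at this
        simpa using this.symm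
      have h2 : s = l₁.length := by
        have := congrArg (fun l : List ℕ => l[l₁.length]?) hl
        simpa [hlen] using this.symm
      have h3 : Ideal.ofList (x (d - 1) :: T) = seqIdeal (tailIdeal x d (d - 1)) x s := by
        rw [seqIdeal_eq, tailIdeal_last hd, bot_sup_eq, Ideal.ofList_cons, ← hl₁, h2, ← h1]
      rw [h3]
      exact hcon s (by omega) a)
  rw [Ideal.ofList_nil, List.length_cons, List.length_map, List.length_range,
    Nat.sub_add_cancel hd] at this
  exact this

include hdim h in
theorem IsCSeq.exists_witness (hd : 0 < d) (hreg : ∀ a, x (d - 1) * a = 0 → a = 0)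
    (hCM : ¬ IsCMLocal R) :
    ∃ s < d - 1, ∃ a, x s * a ∈ seqIdeal (tailIdeal x d (d - 1)) x s ∧
      (∀ r ∈ maximalIdeal R, r * a ∈ seqIdeal ⊥ x d) ∧
      a ∉ seqIdeal ⊥ x d ⊔ seqColon x (d - 1) := by
  classical
  have hex := h.exists_colon_ne hdim hd hreg hCM
  let s := Nat.find hex
  obtain ⟨hsd, z, hz, hz'⟩ : s < d - 1 ∧ ∃ a, x s * a ∈ seqIdeal (tailIdeal x d (d - 1)) x s ∧
      a ∉ seqIdeal (tailIdeal x d (d - 1)) x s := Nat.find_spec hex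
  have hmin : ∀ l < s, ∀ a, x l * a ∈ seqIdeal (tailIdeal x d (d - 1)) x l →
      a ∈ seqIdeal (tailIdeal x d (d - 1)) x l := by
    intro l hl a ha
    by_contra hna
    exact Nat.find_min hex hl ⟨by omega, a, ha, hna⟩
  have hlast : ∀ i ≤ s, ∀ a, x (d - 1) * a ∈ seqIdeal ⊥ x i → a ∈ seqIdeal ⊥ x i := by
    intro i
    induction i with
    | zero => intro _ a ha; exact hreg a ha
    | succ i ih =>
      intro hi a ha
      obtain ⟨t, ht⟩ := mem_seqIdeal_succ.mp ha
      have h1 : t ∈ seqIdeal (tailIdeal x d (d - 1)) x i := by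
        refine hmin i (by omega) t ((mem_seqIdeal_tail hd).mpr ⟨a, ?_⟩)
        have := Ideal.neg_mem_iff _ |>.mpr ht
        convert this using 1
        ring
      obtain ⟨w, hw⟩ := (mem_seqIdeal_tail hd).mp h1
      refine mem_seqIdeal_succ.mpr ⟨w, ih (by omega) _ ?_⟩
      have := Ideal.add_mem _ ht (Ideal.mul_mem_left _ (x i) hw)
      convert this using 1
      ring
  have hE := h.isDSeq_tail hdim (d - 1) (by omega)
  have hann : seqIdeal ⊥ x d ≤ modColon R (seqIdeal (tailIdeal x d (d - 1)) x s) (Ideal.span {z}) := by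
    have key : ∀ b, b ∈ modColon R (seqIdeal (tailIdeal x d (d - 1)) x s) (Ideal.span {z}) ↔
        b * z ∈ seqIdeal (tailIdeal x d (d - 1)) x s := by
      intro b
      constructor
      · intro hb
        have := hb z (Ideal.mem_span_singleton_self z)
        rwa [smul_eq_mul, mul_comm] at this
      · intro hb r hr
        obtain ⟨t, rfl⟩ := Ideal.mem_span_singleton.mp hr
        have := Ideal.mul_mem_left _ t hb
        rw [smul_eq_mul]
        convert this using 1
        ring
    rw [← seqIdeal_bot_eq_tail hd, seqIdeal_eq]
    refine sup_le (fun b hb => (key b).mpr (Ideal.mul_mem_right _ _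
      (seqIdeal_mono (c := tailIdeal x d (d - 1)) (x := x) (Nat.zero_le s) hb))) ?_
    rw [Ideal.span_le]
    rintro _ hb
    obtain ⟨l, hl, rfl⟩ := List.mem_map.mp hb
    rw [List.mem_range] at hl
    refine (key _).mpr ?_
    rcases Nat.lt_or_ge l s with h1 | h1
    · exact Ideal.mul_mem_right _ _ (mem_seqIdeal h1)
    · exact hE.mul_mem h1 hl hz
  obtain ⟨n, hn⟩ := h.param.exists_pow_le
  rw [← seqIdeal_eq] at hn
  obtain ⟨t, ht, ht'⟩ := exists_socle_of_pow (n := n) hz' (by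
    intro r hr
    have := hann (hn hr) z (Ideal.mem_span_singleton_self z)
    rwa [smul_eq_mul, mul_comm] at this)
  have hxa : x s * (t * z) ∈ seqIdeal (tailIdeal x d (d - 1)) x s := by
    have := Ideal.mul_mem_left _ t hz
    convert this using 1
    ring
  have hle : seqIdeal (tailIdeal x d (d - 1)) x s ≤ seqIdeal ⊥ x d := by
    rw [← seqIdeal_bot_eq_tail hd]
    exact seqIdeal_mono (by omega)
  refine ⟨s, hsd, t * z, hxa, fun r hr => hle (ht' r hr), ?_⟩
  generalize t * z = a at ht ht' hxa
  intro ha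
  suffices hq : a ∈ seqIdeal ⊥ x d by
    refine ht (hE.mem_of_mul_mem hsd hxa (d - 1 - s) (by omega) ?_)
    rwa [Nat.add_sub_cancel' hsd.le, seqIdeal_bot_eq_tail hd]
  have hsucc : seqIdeal ⊥ x d = seqIdeal ⊥ x (d - 1 + 1) := by rw [Nat.sub_add_cancel hd]
  obtain ⟨q, hq, u, hu, rfl⟩ := Submodule.mem_sup.mp ha
  rw [hsucc] at hq
  obtain ⟨w, hw⟩ := mem_seqIdeal_succ.mp hq
  rw [hsucc]
  refine mem_seqIdeal_succ.mpr ⟨w, ?_⟩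
  have hU : q + u - x (d - 1) * w ∈ seqColon x (d - 1) := by
    have : q + u - x (d - 1) * w = (q - x (d - 1) * w) + u := by ring
    rw [this]
    exact Ideal.add_mem _ (mem_seqColon.mpr (Ideal.mul_mem_left _ _ hw)) hu
  have hbU : ∀ y ∈ bIdeal R (R ⧸ tailIdeal x d d), ∀ v ∈ seqColon x (d - 1),
      y * v ∈ seqIdeal ⊥ x (d - 1) := by
    intro y hy v hv
    have := h.mul_mem_of_bIdeal hdim (k := d) (i := d - 1) (by omega) le_rfl hy (a := v)
    rw [tailIdeal_self] at this
    exact this (mem_seqColon.mp hv)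
  by_cases hb : bIdeal R (R ⧸ tailIdeal x d d) = ⊤
  · simpa using hbU 1 (by rw [hb]; trivial) _ hU
  have hbm := le_maximalIdeal hb
  have hT : bIdeal R (R ⧸ tailIdeal x d d) ^ 2 ≤
      modColon R (seqIdeal ⊥ x s ⊔ Ideal.span {x (d - 1)} * seqIdeal ⊥ x (d - 1))
        (Ideal.span {q + u - x (d - 1) * w}) := by
    rw [sq, Ideal.mul_le]
    intro y hy z hz r hr
    obtain ⟨e, rfl⟩ := Ideal.mem_span_singleton.mp hr
    have h1 : y * (q + u - x (d - 1) * w) ∈ seqIdeal (tailIdeal x d (d - 1)) x s := by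
      obtain ⟨t, ht⟩ := (mem_seqIdeal_tail hd).mp (ht' y (hbm hy))
      refine (mem_seqIdeal_tail hd).mpr ⟨t - y * w, ?_⟩
      convert ht using 1
      ring
    obtain ⟨v, hv⟩ := (mem_seqIdeal_tail hd).mp h1
    have h2 : v ∈ seqColon x (d - 1) := by
      rw [mem_seqColon]
      have := Ideal.sub_mem _ (hbU y hy _ hU) (seqIdeal_mono (show s ≤ d - 1 by omega) hv)
      convert this using 1
      ring
    have h3 := Ideal.mul_mem_mul (Ideal.mem_span_singleton_self (x (d - 1))) (hbU z hz v h2)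
    have h4 := Ideal.mul_mem_left _ e (Ideal.add_mem _
      (Ideal.mem_sup_left (T := Ideal.span {x (d - 1)} * seqIdeal ⊥ x (d - 1))
        (Ideal.mul_mem_left _ z hv)) (Ideal.mem_sup_right (S := seqIdeal ⊥ x s) h3))
    rw [smul_eq_mul]
    convert h4 using 1
    ring
  have hx : x (d - 1) ∈ bIdeal R (R ⧸ tailIdeal x d d) ^ 2 := by
    have := h.mem_b (d - 1) (by omega)
    rw [Nat.sub_add_cancel hd] at this
    exact Ideal.pow_le_pow_right (by norm_num) this
  have h5 := hT hx _ (Ideal.mem_span_singleton_self _)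
  obtain ⟨f, hf, g, hg, hfg⟩ := Submodule.mem_sup.mp h5
  obtain ⟨v, hv, rfl⟩ := Ideal.mem_span_singleton_mul.mp hg
  have h6 := hlast s le_rfl (q + u - x (d - 1) * w - v) (by
    have : x (d - 1) * (q + u - x (d - 1) * w - v) = f := by
      rw [smul_eq_mul] at hfg
      linear_combination -hfg
    rwa [this])
  have := Ideal.add_mem _ (seqIdeal_mono (show s ≤ d - 1 by omega) h6) hv
  simpa using this

end Witness

section Saturation

variable {R : Type u} [CommRing R] [IsLocalRing R]

/-- The saturation of `c` with respect to the maximal ideal. -/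
def saturation (c : Ideal R) : Ideal R :=
  (gammaSub (maximalIdeal R) (R ⧸ c)).comap c.mkQ

theorem mem_saturation {c : Ideal R} {e : R} :
    e ∈ saturation c ↔ ∃ n, ∀ r ∈ maximalIdeal R ^ n, r * e ∈ c := by
  refine exists_congr fun n => forall₂_congr fun r _ => ?_
  rw [← map_smul, Submodule.mkQ_apply, Submodule.Quotient.mk_eq_zero, smul_eq_mul]

theorem le_saturation (c : Ideal R) : c ≤ saturation c := fun e he =>
  mem_saturation.mpr ⟨0, fun r _ => c.mul_mem_left r he⟩

variable [IsNoetherianRing R]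

theorem exists_pow_mul_saturation (c : Ideal R) :
    ∃ n, ∀ r ∈ maximalIdeal R ^ n, ∀ e ∈ saturation c, r * e ∈ c := by
  obtain ⟨n, hn⟩ := exists_pow_smul_of_fg (maximalIdeal R)
    (gammaSub (maximalIdeal R) (R ⧸ c)) (IsNoetherian.noetherian _) le_rfl
  refine ⟨n, fun r hr e he => ?_⟩
  have := hn r hr _ he
  rwa [← map_smul, Submodule.mkQ_apply, Submodule.Quotient.mk_eq_zero, smul_eq_mul] at this

theorem mem_of_forall_pow {c : Ideal R} {y z : R} (hy : y ∈ maximalIdeal R)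
    (h : ∀ k, ∃ t, z - y ^ k * t ∈ c) : z ∈ c := by
  by_cases hc : c = ⊤
  · simp [hc]
  have h1 : (c.mkQ z : R ⧸ c) ∈ (⨅ k : ℕ, maximalIdeal R ^ k • (⊤ : Submodule R (R ⧸ c))) := by
    rw [Submodule.mem_iInf]
    intro k
    obtain ⟨t, ht⟩ := h k
    have : c.mkQ z = y ^ k • c.mkQ t := by
      rw [← map_smul, ← sub_eq_zero, ← map_sub, Submodule.mkQ_apply,
        Submodule.Quotient.mk_eq_zero, smul_eq_mul]
      exact ht
    rw [this]
    exact Submodule.smul_mem_smul (Ideal.pow_mem_pow hy k) trivial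
  rw [Ideal.iInf_pow_smul_eq_bot_of_isLocalRing _ (Ideal.IsPrime.ne_top inferInstance),
    Submodule.mem_bot, Submodule.mkQ_apply, Submodule.Quotient.mk_eq_zero] at h1
  exact h1

variable {c : Ideal R} {y : R}

omit [IsNoetherianRing R] in
theorem exists_sub_pow_mem {U : Ideal R} (h : ∀ r ∈ maximalIdeal R, ∃ t, r - y * t ∈ U) :
    ∀ k, ∀ r ∈ maximalIdeal R ^ k, ∃ t, r - y ^ k * t ∈ U := by
  intro k
  induction k with
  | zero => intro r _; exact ⟨r, by simp⟩
  | succ k ih =>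
    intro r hr
    rw [pow_succ] at hr
    induction hr using Submodule.mul_induction_on' with
    | mem_mul_mem a ha b hb =>
      obtain ⟨s, hs⟩ := ih a ha
      obtain ⟨t, ht⟩ := h b hb
      refine ⟨s * t, ?_⟩
      have : a * b - y ^ (k + 1) * (s * t) = (a - y ^ k * s) * b + y ^ k * s * (b - y * t) := by
        ring
      rw [this]
      exact add_mem (U.mul_mem_right _ hs) (U.mul_mem_left _ ht)
    | add a _ b _ iha ihb =>
      obtain ⟨s, hs⟩ := iha
      obtain ⟨t, ht⟩ := ihb
      refine ⟨s + t, ?_⟩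
      have : a + b - y ^ (k + 1) * (s + t) =
        (a - y ^ (k + 1) * s) + (b - y ^ (k + 1) * t) := by ring
      rw [this]
      exact add_mem hs ht

theorem mul_mem_saturation (hc : ∀ r ∈ maximalIdeal R, ∃ t, r - y * t ∈ saturation c) {e : R}
    (he : y * e ∈ saturation c) : e ∈ saturation c := by
  obtain ⟨n, hn⟩ := exists_pow_mul_saturation c
  obtain ⟨k, hk⟩ := mem_saturation.mp he
  refine mem_saturation.mpr ⟨(k + 1) + n, fun r hr => ?_⟩
  rw [pow_add] at hr
  induction hr using Submodule.mul_induction_on' with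
  | mem_mul_mem a ha b hb =>
    rw [pow_succ] at ha
    induction ha using Submodule.mul_induction_on' with
    | mem_mul_mem p hp q hq =>
      obtain ⟨t, ht⟩ := hc q hq
      have : p * q * b * e = (b * (q - y * t)) * (p * e) + (b * t) * (p * (y * e)) := by ring
      rw [this]
      refine add_mem (c.mul_mem_right _ (hn b hb _ ht)) (c.mul_mem_left _ (hk p hp))
    | add p _ q _ hp hq =>
      rw [add_mul, add_mul]
      exact add_mem hp hq
  | add a _ b _ ha hb =>
    rw [add_mul]
    exact add_mem ha hb

theorem pow_mul_mem_saturation (hc : ∀ r ∈ maximalIdeal R, ∃ t, r - y * t ∈ saturation c) {e : R}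
    (k : ℕ) (he : y ^ k * e ∈ saturation c) : e ∈ saturation c := by
  induction k with
  | zero => simpa using he
  | succ k ih =>
    refine ih (mul_mem_saturation hc ?_)
    rwa [← mul_assoc, ← pow_succ']

/-- If the quotient by the saturation of `c` is a discrete valuation ring with parameter `y`, an
element outside the saturation generates an `m`-primary ideal together with `c`. -/
theorem exists_pow_le_of_not_mem_saturation (hy : y ∈ maximalIdeal R)
    (hc : ∀ r ∈ maximalIdeal R, ∃ t, r - y * t ∈ saturation c) {e : R}
    (he : e ∉ saturation c) : ∃ n, maximalIdeal R ^ n ≤ c ⊔ Ideal.span {e} := by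
  classical
  obtain ⟨n, hn⟩ := exists_pow_mul_saturation c
  have hex : ∃ k, ¬ ∃ t, e - y ^ k * t ∈ saturation c := by
    by_contra hcon
    push Not at hcon
    exact he (mem_of_forall_pow hy hcon)
  obtain ⟨k, hk⟩ : ∃ k, Nat.find hex = k + 1 := by
    refine Nat.exists_eq_succ_of_ne_zero fun h0 => ?_
    have := Nat.find_spec hex
    rw [h0] at this
    exact this ⟨e, by simp⟩
  have h1 := Nat.find_spec hex
  rw [hk] at h1
  have h2 := Nat.find_min hex (m := k) (by omega)
  rw [not_not] at h2
  obtain ⟨t, ht⟩ := h2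
  have htu : IsUnit t := by
    by_contra htn
    obtain ⟨s, hs⟩ := hc t ((mem_maximalIdeal t).mpr htn)
    refine h1 ⟨s, ?_⟩
    have : e - y ^ (k + 1) * s = (e - y ^ k * t) + y ^ k * (t - y * s) := by ring
    rw [this]
    exact add_mem ht (Ideal.mul_mem_left _ _ hs)
  obtain ⟨v, hv⟩ := htu.exists_right_inv
  refine ⟨n + k, fun r hr => ?_⟩
  rw [pow_add] at hr
  induction hr using Submodule.mul_induction_on' with
  | mem_mul_mem a ha b hb =>
    obtain ⟨w, hw⟩ := exists_sub_pow_mem hc k b hb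
    have : a * b = a * ((b - y ^ k * w) - w * v * (e - y ^ k * t)) + a * w * v * e +
      a * w * y ^ k * (1 - t * v) := by ring
    rw [this, hv, sub_self, mul_zero, add_zero]
    refine add_mem (Ideal.mem_sup_left (hn a ha _ (sub_mem hw (Ideal.mul_mem_left _ _ ht)))) ?_
    exact Ideal.mem_sup_right (Ideal.mul_mem_left _ _ (Ideal.mem_span_singleton_self e))
  | add a _ b _ ha hb => exact add_mem ha hb

end Saturation

section Cyclic

variable {R : Type u} [CommRing R] [IsLocalRing R] [IsNoetherianRing R] {L : List R} {x t : R}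

theorem mem_of_pow_mul_mem (hdim : ringKrullDim R = (L.length + 2 : ℕ))
    (h : IsParamList ⊥ (L ++ [x, t])) {y : R} (hy : y ∈ maximalIdeal R)
    (hc : ∀ r ∈ maximalIdeal R, ∃ t, r - y * t ∈ saturation (Ideal.ofList L ⊔ Ideal.span {x}))
    {k : ℕ} {s : R} (hs : x ^ k * s ∈ Ideal.ofList L) :
    s ∈ saturation (Ideal.ofList L ⊔ Ideal.span {x}) := by
  by_contra hns
  have hns' : y * s ∉ saturation (Ideal.ofList L ⊔ Ideal.span {x}) :=
    fun hcon => hns (mul_mem_saturation hc hcon)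
  obtain ⟨n, hn⟩ := exists_pow_le_of_not_mem_saturation hy hc hns'
  have hx : x ∈ maximalIdeal R := h.mem x (by simp)
  have hLm : ∀ a ∈ L, a ∈ maximalIdeal R := fun a ha => h.mem a (by simp [ha])
  have h1 : Ideal.ofList (L ++ [x + y * s]) ≤ (⊥ ⊔ Ideal.ofList (L ++ [x + y * s])).radical :=
    le_sup_right.trans Ideal.le_radical
  have hxs : x + y * s ∈ (⊥ ⊔ Ideal.ofList (L ++ [x + y * s])).radical :=
    h1 (Ideal.subset_span (by simp))
  have hL : Ideal.ofList L ≤ (⊥ ⊔ Ideal.ofList (L ++ [x + y * s])).radical :=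
    le_trans (Ideal.span_mono fun a ha => by
      rw [Set.mem_ofPred_eq] at ha ⊢
      exact List.mem_append_left _ ha) h1
  have hxr : x ∈ (⊥ ⊔ Ideal.ofList (L ++ [x + y * s])).radical := by
    rw [← Ideal.radical_idem]
    refine ⟨k + 1, ?_⟩
    have : x ^ (k + 1) = x ^ k * (x + y * s) - y * (x ^ k * s) := by ring
    rw [this]
    exact sub_mem (Ideal.mul_mem_left _ _ hxs) (Ideal.mul_mem_left _ _ (hL hs))
  have hP : IsParamList ⊥ (L ++ [x + y * s]) := by
    refine ⟨?_, ?_⟩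
    · intro a ha
      rcases List.mem_append.mp ha with ha | ha
      · exact hLm a ha
      · rw [List.mem_singleton.mp ha]
        exact add_mem hx (Ideal.mul_mem_right _ _ hy)
    · intro a ha
      rw [← Ideal.radical_idem]
      refine ⟨n, (hn.trans (sup_le (sup_le hL ?_) ?_)) (Ideal.pow_mem_pow ha n)⟩
      · rw [Ideal.span_singleton_le_iff_mem]
        exact hxr
      · rw [Ideal.span_singleton_le_iff_mem]
        simpa using sub_mem hxs hxr
  have := hP.ringKrullDim_le
  rw [ringKrullDim_quotient_bot hdim, List.length_append, List.length_singleton] at this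
  have := WithBot.coe_le_coe.mp this
  norm_cast at this
  omega

theorem false_of_cyclic (hdim : ringKrullDim R = (L.length + 2 : ℕ))
    (h : IsParamList ⊥ (L ++ [x, t])) (hx2 : x ∈ maximalIdeal R ^ 2) {a y : R}
    (hy : y ∈ maximalIdeal R)
    (ha : ∀ r ∈ maximalIdeal R, r * a ∈ Ideal.ofList (L ++ [x, t]))
    (ht : ∃ u, t - u * (y * a) ∈ Ideal.ofList L ⊔ Ideal.span {x})
    (hb : t ∈ bIdeal R (R ⧸ (⊥ : Ideal R)) ∨ x ∈ bIdeal R (R ⧸ (⊥ : Ideal R)) ^ 2) : False := by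
  set c := Ideal.ofList L with hcdef
  set U := saturation (c ⊔ Ideal.span {x}) with hU
  have hq : Ideal.ofList (L ++ [x, t]) = c ⊔ Ideal.span {x} ⊔ Ideal.span {t} := by
    rw [Ideal.ofList_append, Ideal.ofList_cons, Ideal.ofList_singleton, sup_assoc]
  rw [hq] at ha
  have htU : t ∉ U := by
    intro hcon
    obtain ⟨n, hn⟩ := mem_saturation.mp hcon
    have hP : IsParamList ⊥ (L ++ [x]) := by
      refine h.of_radical (fun a ha => h.mem a (by
        rw [List.mem_append, List.mem_singleton] at ha; rcases ha with ha | ha <;> simp [ha]))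
        bot_le ?_
      intro b hb
      rw [bot_sup_eq, Ideal.ofList_append, Ideal.ofList_singleton]
      simp only [List.mem_append, List.mem_cons, List.not_mem_nil, or_false] at hb
      rcases hb with hb | rfl | rfl
      · exact Ideal.le_radical (Ideal.mem_sup_left (Ideal.subset_span hb))
      · exact Ideal.le_radical (Ideal.mem_sup_right (Ideal.mem_span_singleton_self b))
      · refine ⟨n + 1, ?_⟩
        rw [pow_succ]
        exact hn _ (Ideal.pow_mem_pow (h.mem b (by simp)) n)
    have := hP.ringKrullDim_le
    rw [ringKrullDim_quotient_bot hdim, List.length_append, List.length_singleton] at this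
    have := WithBot.coe_le_coe.mp this
    norm_cast at this
    omega
  have hleU : c ⊔ Ideal.span {x} ≤ U := le_saturation _
  obtain ⟨M, hM⟩ := h.exists_pow_le
  rw [bot_sup_eq, hq] at hM
  have htcancel : ∀ e, t * e ∈ c ⊔ Ideal.span {x} → e ∈ U := by
    intro e he
    refine mem_saturation.mpr ⟨M, fun r hr => ?_⟩
    obtain ⟨p, hp, s, hs, rfl⟩ := Submodule.mem_sup.mp (hM hr)
    obtain ⟨w, rfl⟩ := Ideal.mem_span_singleton'.mp hs
    have : (p + w * t) * e = p * e + w * (t * e) := by ring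
    rw [this]
    exact add_mem (Ideal.mul_mem_right _ _ hp) (Ideal.mul_mem_left _ _ he)
  have hxU : x ∈ U := hleU (Ideal.mem_sup_right (Ideal.mem_span_singleton_self x))
  obtain ⟨u, hu⟩ := ht
  have hc : ∀ r ∈ maximalIdeal R, ∃ t, r - y * t ∈ U := by
    intro r hr
    obtain ⟨p, hp, s, hs, hps⟩ := Submodule.mem_sup.mp (ha r hr)
    obtain ⟨w, rfl⟩ := Ideal.mem_span_singleton'.mp hs
    refine ⟨w * u, htcancel _ ?_⟩
    have : t * (r - y * (w * u)) = (t - u * (y * a)) * (r - y * (w * u)) +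
        u * y * (p + w * (t - u * (y * a))) + u * y * (r * a - (p + w * t)) := by ring
    rw [this, hps, sub_self, mul_zero, add_zero]
    exact add_mem (Ideal.mul_mem_right _ _ hu) (Ideal.mul_mem_left _ _
      (add_mem hp (Ideal.mul_mem_left _ _ hu)))
  have key : ∀ k s, x ^ k * s ∈ c → s ∈ U := fun k s hs => mem_of_pow_mul_mem hdim h hy hc hs
  have cancel : ∀ k e, y ^ k * e ∈ U → e ∈ U := fun k e he => pow_mul_mem_saturation hc k he
  obtain ⟨N', hN'⟩ := exists_pow_mul_saturation (c ⊔ Ideal.span {x})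
  obtain ⟨N, hN1, hN⟩ : ∃ N, 1 ≤ N ∧ ∀ e ∈ U, ∀ r ∈ maximalIdeal R ^ N,
      r * e ∈ c ⊔ Ideal.span {x} :=
    ⟨N' + 1, by omega, fun e he r hr => hN' r (Ideal.pow_le_pow_right (by omega) hr) e he⟩
  have hyN : y ^ N ∈ maximalIdeal R ^ N := Ideal.pow_mem_pow hy N
  have h1U : ∀ k, y ^ k ∉ U := by
    intro k hk
    have : (1 : R) ∈ U := cancel k 1 (by simpa using hk)
    exact htU (by simpa using U.mul_mem_left t this)
  have hdivx : ∀ e ∈ U, ∃ r, y ^ N * e - x * r ∈ c := fun e he =>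
    mem_sup_span_singleton.mp (hN e he _ hyN)
  have hUsq : ∀ e ∈ U ^ 2, ∃ r, y ^ (2 * N) * e - x * (x * r) ∈ c := by
    intro e he
    rw [sq] at he
    induction he using Submodule.mul_induction_on' with
    | mem_mul_mem p hp q hq =>
      obtain ⟨r, hr⟩ := hdivx p hp
      obtain ⟨s, hs⟩ := hdivx q hq
      refine ⟨r * s, ?_⟩
      have : y ^ (2 * N) * (p * q) - x * (x * (r * s)) =
        (y ^ N * p - x * r) * (y ^ N * q) + x * r * (y ^ N * q - x * s) := by ring
      rw [this]
      exact add_mem (Ideal.mul_mem_right _ _ hr) (Ideal.mul_mem_left _ _ hs)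
    | add p _ q _ hp hq =>
      obtain ⟨r, hr⟩ := hp
      obtain ⟨s, hs⟩ := hq
      refine ⟨r + s, ?_⟩
      have : y ^ (2 * N) * (p + q) - x * (x * (r + s)) =
        (y ^ (2 * N) * p - x * (x * r)) + (y ^ (2 * N) * q - x * (x * s)) := by ring
      rw [this]
      exact add_mem hr hs
  obtain ⟨z, hzb, hzU⟩ : ∃ z ∈ bIdeal R (R ⧸ (⊥ : Ideal R)), z ∉ U := by
    rcases hb with hb | hb
    · exact ⟨t, hb, htU⟩
    · by_contra hcon
      push Not at hcon
      obtain ⟨r, hr⟩ := hUsq x (Ideal.pow_right_mono hcon 2 hb)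
      have := key 1 (y ^ (2 * N) - x * r) (by
        have e : x ^ 1 * (y ^ (2 * N) - x * r) = y ^ (2 * N) * x - x * (x * r) := by ring
        rwa [e])
      have := add_mem this (U.mul_mem_right r hxU)
      rw [sub_add_cancel] at this
      exact h1U _ this
  obtain ⟨w, hw, u', hu', hwu⟩ : ∃ w ∈ U, ∃ u' ∈ U, y ^ N * w - x * (y ^ (N - 1) + u') ∈ c := by
    have h2 : x ∈ Ideal.span {y ^ 2} ⊔ Ideal.span {y} * U ⊔ U ^ 2 := by
      have : maximalIdeal R ≤ Ideal.span {y} ⊔ U := by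
        intro r hr
        obtain ⟨s, hs⟩ := hc r hr
        have := add_mem (Ideal.mem_sup_left (S := Ideal.span {y}) (T := U)
          (Ideal.mul_mem_right s _ (Ideal.mem_span_singleton_self y))) (Ideal.mem_sup_right hs)
        rwa [add_sub_cancel] at this
      have := Ideal.pow_right_mono this 2 hx2
      rw [sq, Ideal.sup_mul, Ideal.mul_sup, Ideal.mul_sup, Ideal.span_singleton_mul_span_singleton,
        ← sq, ← sq, mul_comm U (Ideal.span {y})] at this
      refine SetLike.le_def.mp (sup_le (sup_le ?_ ?_) (sup_le ?_ ?_)) this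
      · exact le_sup_left.trans le_sup_left
      · exact le_sup_right.trans le_sup_left
      · exact le_sup_right.trans le_sup_left
      · exact le_sup_right
    obtain ⟨p, hp, v, hv, hpv⟩ := Submodule.mem_sup.mp h2
    obtain ⟨p₁, hp₁, p₂, hp₂, rfl⟩ := Submodule.mem_sup.mp hp
    obtain ⟨α, rfl⟩ := Ideal.mem_span_singleton'.mp hp₁
    obtain ⟨β, hβ, rfl⟩ := Ideal.mem_span_singleton_mul.mp hp₂
    have hα : α ∈ U := by
      refine cancel 2 α ?_
      have : y ^ 2 * α = x - y * β - v := by rw [← hpv]; ring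
      rw [this]
      exact sub_mem (sub_mem hxU (U.mul_mem_left _ hβ))
        (Ideal.pow_le_self two_ne_zero hv)
    have hw : y * α + β ∈ U := add_mem (U.mul_mem_left _ hα) hβ
    obtain ⟨r, hr⟩ := hdivx _ hw
    obtain ⟨r', hr'⟩ := hUsq v hv
    have h3 : y ^ (2 * N) - y ^ (N + 1) * r - x * r' ∈ U := by
      refine key 1 _ ?_
      have : x ^ 1 * (y ^ (2 * N) - y ^ (N + 1) * r - x * r') =
          y ^ (N + 1) * (y ^ N * (y * α + β) - x * r) + (y ^ (2 * N) * v - x * (x * r')) +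
          y ^ (2 * N) * (x - (α * y ^ 2 + y * β + v)) := by ring
      rw [this, hpv, sub_self, mul_zero, add_zero]
      exact add_mem (Ideal.mul_mem_left _ _ hr) hr'
    have h4 : y ^ (N - 1) - r ∈ U := by
      refine cancel (N + 1) _ ?_
      have : y ^ (N + 1) * (y ^ (N - 1) - r) =
          (y ^ (2 * N) - y ^ (N + 1) * r - x * r') + x * r' := by
        obtain ⟨k, rfl⟩ : ∃ k, N = k + 1 := ⟨N - 1, by omega⟩
        rw [Nat.add_sub_cancel]
        ring
      rw [this]
      exact add_mem h3 (U.mul_mem_right _ hxU)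
    refine ⟨_, hw, r - y ^ (N - 1), by simpa using neg_mem h4, ?_⟩
    rwa [add_sub_cancel]
  refine hzU (mem_of_forall_pow hy fun k => ?_)
  rcases Nat.eq_zero_or_pos k with rfl | hk
  · exact ⟨z, by simp⟩
  obtain ⟨r, hr⟩ : ∃ r, z * w ^ k - x ^ k * r ∈ c := by
    rw [← mem_sup_span_singleton]
    have h5 : t ^ (N * k) * w ^ k ∈ c ⊔ Ideal.span {x ^ k} := by
      obtain ⟨r, hr⟩ := mem_sup_span_singleton.mp (hN w hw _ (Ideal.pow_mem_pow
        (h.mem t (by simp)) N))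
      rw [mem_sup_span_singleton]
      refine ⟨r ^ k, ?_⟩
      rw [pow_mul, ← mul_pow, ← mul_pow]
      exact Ideal.mem_of_dvd _ (sub_dvd_pow_sub_pow _ _ k) hr
    have h6 : Ideal.ofList (L ++ [x ^ k]) = c ⊔ Ideal.span {x ^ k} := by
      rw [Ideal.ofList_append, Ideal.ofList_singleton]
    have := mul_mem_of_mem_bIdeal hzb (L := L ++ [x ^ k]) (L' := []) (y := t ^ (N * k))
      (by
        rw [ringKrullDim_quotient_bot hdim, List.length_append, List.length_singleton,
          List.length_nil, add_assoc]) ?_ (a := w ^ k)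
      (by rwa [bot_sup_eq, h6])
    · rwa [bot_sup_eq, h6] at this
    · refine h.of_radical ?_ bot_le ?_
      · intro b hb
        simp only [List.mem_append, List.mem_cons, List.not_mem_nil, or_false] at hb
        rcases hb with (hb | rfl) | rfl
        · exact h.mem b (by simp [hb])
        · exact Ideal.pow_mem_of_mem _ (h.mem x (by simp)) k hk
        · exact Ideal.pow_mem_of_mem _ (h.mem t (by simp)) _ (by positivity)
      · intro b hb
        simp only [List.mem_append, List.mem_cons, List.not_mem_nil, or_false] at hb
        rcases hb with hb | rfl | rfl
        · exact Ideal.le_radical (mem_sup_ofList (by simp [hb]))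
        · exact ⟨k, mem_sup_ofList (by simp)⟩
        · exact ⟨N * k, mem_sup_ofList (by simp)⟩
  have h7 : z * (y ^ (N - 1) + u') ^ k - y ^ (N * k) * r ∈ U := by
    refine key k _ ?_
    have h8 : (y ^ N * w) ^ k - (x * (y ^ (N - 1) + u')) ^ k ∈ c :=
      Ideal.mem_of_dvd _ (sub_dvd_pow_sub_pow _ _ k) hwu
    have : x ^ k * (z * (y ^ (N - 1) + u') ^ k - y ^ (N * k) * r) =
        -(z * ((y ^ N * w) ^ k - (x * (y ^ (N - 1) + u')) ^ k)) +
          y ^ (N * k) * (z * w ^ k - x ^ k * r) := by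
      rw [mul_pow, mul_pow, ← pow_mul]
      ring
    rw [this]
    exact add_mem (neg_mem (Ideal.mul_mem_left _ _ h8)) (Ideal.mul_mem_left _ _ hr)
  refine ⟨r, cancel ((N - 1) * k) _ ?_⟩
  have h9 : (y ^ (N - 1) + u') ^ k - (y ^ (N - 1)) ^ k ∈ U := by
    refine Ideal.mem_of_dvd _ (sub_dvd_pow_sub_pow _ _ k) ?_
    simpa using hu'
  have : y ^ ((N - 1) * k) * (z - y ^ k * r) = (z * (y ^ (N - 1) + u') ^ k - y ^ (N * k) * r) -
      z * ((y ^ (N - 1) + u') ^ k - (y ^ (N - 1)) ^ k) := by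
    obtain ⟨j, rfl⟩ : ∃ j, N = j + 1 := ⟨N - 1, by omega⟩
    rw [Nat.add_sub_cancel, ← pow_mul, add_mul, one_mul, pow_add]
    ring
  rw [this]
  exact sub_mem h7 (Ideal.mul_mem_left _ _ h9)

end Cyclic

section Reduction

variable {R : Type u} [CommRing R]

theorem mem_seqIdeal_iff_sum {x : ℕ → R} {d : ℕ} {a : R} :
    a ∈ seqIdeal ⊥ x d ↔ ∃ c : ℕ → R, a = ∑ l ∈ Finset.range d, c l * x l := by
  classical
  constructor
  · induction d generalizing a with
    | zero =>
      intro ha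
      exact ⟨0, by simpa [seqIdeal] using ha⟩
    | succ d ih =>
      intro ha
      obtain ⟨t, ht⟩ := mem_seqIdeal_succ.mp ha
      obtain ⟨c, hc⟩ := ih ht
      refine ⟨fun l => if l < d then c l else t, ?_⟩
      have h1 : ∑ l ∈ Finset.range d, (if l < d then c l else t) * x l =
          ∑ l ∈ Finset.range d, c l * x l :=
        Finset.sum_congr rfl fun l hl => by rw [if_pos (Finset.mem_range.mp hl)]
      rw [Finset.sum_range_succ, h1, ← hc]
      simp only [lt_self_iff_false, if_false]
      ring
  · rintro ⟨c, rfl⟩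
    refine Ideal.sum_mem _ fun l hl => Ideal.mul_mem_left _ _ ?_
    rw [seqIdeal_eq]
    exact Ideal.mem_sup_right (Ideal.subset_span
      (List.mem_map_of_mem (List.mem_range.mpr (Finset.mem_range.mp hl))))

variable [IsLocalRing R] [IsNoetherianRing R] {x : ℕ → R} {d : ℕ} (hdim : ringKrullDim R = d)
  (h : IsCSeq x d)

include hdim h in
theorem IsCSeq.bIdeal_le (hd : 2 ≤ d) (hreg : ∀ a, x (d - 1) * a = 0 → a = 0)
    (hCM : ¬ IsCMLocal R) :
    bIdeal R (R ⧸ (⊥ : Ideal R)) ≤ maximalIdeal R ∧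
      bIdeal R (R ⧸ tailIdeal x d (d - 1)) ≤ maximalIdeal R := by
  obtain ⟨s, hs, a, ha, hna⟩ := h.exists_colon_ne hdim (by omega) hreg hCM
  constructor
  · refine le_maximalIdeal fun htop => hna ?_
    rw [seqIdeal_eq, tailIdeal_last (by omega), sup_assoc, ← Ideal.ofList_cons] at ha ⊢
    have := mul_mem_of_mem_bIdeal (z := 1) (by rw [htop]; trivial)
      (L := x (d - 1) :: (List.range s).map x) (y := x s)
      (L' := (List.range' (s + 1) (d - 2 - s)).map x) (by
        rw [ringKrullDim_quotient_bot hdim]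
        simp only [List.length_cons, List.length_map, List.length_range, List.length_range']
        congr 2
        omega) (by
        refine h.param.of_mem_iff fun b => ?_
        rw [← List.map_cons, ← List.map_cons, ← List.map_append]
        simp only [List.mem_append, List.mem_map, List.mem_range, List.mem_cons, List.mem_range'_1]
        refine exists_congr fun l => and_congr_left fun _ => ?_
        omega) ha
    rwa [one_mul] at this
  · refine le_maximalIdeal fun htop => hna ?_
    have := h.mul_mem_of_bIdeal hdim (k := d - 1) (i := s) hs (by omega) (z := 1)
      (by rw [htop]; trivial) ha
    rwa [one_mul] at this

include hdim h in
theorem IsCSeq.mul_mem_of_socle (hd : 2 ≤ d) (hreg : ∀ a, x (d - 1) * a = 0 → a = 0)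
    (hCM : ¬ IsCMLocal R) {a y : R} (ha : ∀ r ∈ maximalIdeal R, r * a ∈ seqIdeal ⊥ x d)
    (hy : y ∈ maximalIdeal R) : y * a ∈ maximalIdeal R * seqIdeal ⊥ x d := by
  classical
  obtain ⟨c, hc⟩ := mem_seqIdeal_iff_sum.mp (ha y hy)
  by_contra hcon
  obtain ⟨j, hj, hcj⟩ : ∃ j < d, c j ∉ maximalIdeal R := by
    by_contra hall
    push Not at hall
    refine hcon ?_
    rw [hc]
    refine Ideal.sum_mem _ fun l hl => Ideal.mul_mem_mul (hall l (Finset.mem_range.mp hl)) ?_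
    exact mem_seqIdeal_iff_sum.mpr ⟨Pi.single l 1, by simp [Pi.single_apply, Finset.mem_range.mp hl]⟩
  obtain ⟨hb, hb'⟩ := h.bIdeal_le hdim hd hreg hCM
  have hlast : x (d - 1) ∈ bIdeal R (R ⧸ (⊥ : Ideal R)) ^ 3 := by
    have := h.mem_b (d - 1) (by omega)
    rwa [Nat.sub_add_cancel (by omega), tailIdeal_self] at this
  obtain ⟨i, hi, hij, hi2, hbi⟩ : ∃ i < d, i ≠ j ∧ x i ∈ maximalIdeal R ^ 2 ∧
      (x j ∈ bIdeal R (R ⧸ (⊥ : Ideal R)) ∨ x i ∈ bIdeal R (R ⧸ (⊥ : Ideal R)) ^ 2) := by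
    by_cases hjd : j = d - 1
    · refine ⟨d - 2, by omega, by omega, ?_, Or.inl (hjd ▸ Ideal.pow_le_self three_ne_zero hlast)⟩
      have := h.mem_b (d - 2) (by omega)
      rw [show d - 2 + 1 = d - 1 by omega] at this
      exact Ideal.pow_le_pow_right (by omega) (Ideal.pow_right_mono hb' 3 this)
    · exact ⟨d - 1, by omega, fun hcon => hjd hcon.symm,
        Ideal.pow_le_pow_right (by omega) (Ideal.pow_right_mono hb 3 hlast),
        Or.inr (Ideal.pow_le_pow_right (by omega) hlast)⟩
  have hnd : (List.range d).Nodup := List.nodup_range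
  set l := ((List.range d).erase i).erase j with hl
  have hmem : ∀ k, k ∈ l ↔ k ≠ j ∧ k ≠ i ∧ k < d := fun k => by
    rw [hl, (hnd.erase i).mem_erase_iff, hnd.mem_erase_iff, List.mem_range]
  have hlen : l.length + 2 = d := by
    rw [hl, List.length_erase_of_mem, List.length_erase_of_mem, List.length_range]
    · omega
    · rwa [List.mem_range]
    · rw [hnd.mem_erase_iff, List.mem_range]
      exact ⟨fun hcon => hij hcon.symm, hj⟩
  have hparam : ∀ b, b ∈ l.map x ++ [x i, x j] ↔ b ∈ (List.range d).map x := by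
    intro b
    have : l.map x ++ [x i, x j] = (l ++ [i, j]).map x := by simp
    rw [this]
    simp only [List.mem_map, List.mem_append, hmem, List.mem_cons, List.mem_range,
      List.not_mem_nil, or_false]
    refine exists_congr fun k => and_congr_left fun _ => ?_
    omega
  have hq : Ideal.ofList (l.map x ++ [x i, x j]) = seqIdeal ⊥ x d := by
    rw [seqIdeal_eq, bot_sup_eq]
    exact congrArg Ideal.span (Set.ext hparam)
  obtain ⟨u, hu⟩ : ∃ u, c j * u = 1 :=
    IsUnit.exists_right_inv (by rwa [mem_maximalIdeal, mem_nonunits_iff, not_not] at hcj)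
  refine false_of_cyclic (L := l.map x) (x := x i) (t := x j) (a := a) (y := y)
    (by rw [hdim, List.length_map, hlen]) (h.param.of_mem_iff hparam) hi2 hy
    (by rwa [hq]) ⟨u, ?_⟩ hbi
  rw [hc, ← Finset.add_sum_erase _ _ (Finset.mem_range.mpr hj)]
  have e : x j - u * (c j * x j + ∑ k ∈ (Finset.range d).erase j, c k * x k) =
      (1 - c j * u) * x j - u * ∑ k ∈ (Finset.range d).erase j, c k * x k := by ring
  rw [e, hu, sub_self, zero_mul, zero_sub]
  refine neg_mem (Ideal.mul_mem_left _ _ (Ideal.sum_mem _ fun k hk =>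
    Ideal.mul_mem_left _ _ ?_))
  rw [Finset.mem_erase, Finset.mem_range] at hk
  by_cases hki : k = i
  · rw [hki]
    exact Ideal.mem_sup_right (Ideal.mem_span_singleton_self _)
  · exact Ideal.mem_sup_left (Ideal.subset_span (List.mem_map_of_mem ((hmem k).mpr ⟨hk.1, hki, hk.2⟩)))

end Reduction

section Binomial

theorem choose_add_le (n s k : ℕ) : (n + s).choose s ≤ (n + (s + k)).choose (s + k) := by
  induction k with
  | zero => exact le_rfl
  | succ k ih =>
    refine ih.trans ?_
    exact (Nat.le_add_right _ _).trans (Nat.choose_succ_succ (n + (s + k)) (s + k)).ge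

theorem exists_abs_sub_le (s : ℕ) (g : ℕ → ℤ) : ∃ G : ℤ, 0 ≤ G ∧ ∀ n : ℕ,
    |∑ i ∈ Finset.range (s + 1 + 1), (-1) ^ i * g i * ((n + (s + 1) - i).choose (s + 1 - i) : ℤ) -
      g 0 * ((n + (s + 1)).choose (s + 1) : ℤ)| ≤ G * ((n + s).choose s : ℤ) := by
  refine ⟨∑ i ∈ Finset.range (s + 1), |g (i + 1)|, Finset.sum_nonneg fun _ _ => abs_nonneg _,
    fun n => ?_⟩
  rw [Finset.sum_range_succ']
  simp only [pow_zero, one_mul, Nat.sub_zero, add_sub_cancel_right]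
  refine (Finset.abs_sum_le_sum_abs _ _).trans ?_
  rw [Finset.sum_mul]
  refine Finset.sum_le_sum fun i hi => ?_
  rw [Finset.mem_range] at hi
  rw [abs_mul, abs_mul, abs_pow, abs_neg, abs_one, one_pow, one_mul, Nat.abs_cast]
  refine mul_le_mul_of_nonneg_left ?_ (abs_nonneg _)
  rw [show n + (s + 1) - (i + 1) = n + (s - i) by omega, show s + 1 - (i + 1) = s - i by omega]
  have := choose_add_le n (s - i) i
  rw [Nat.sub_add_cancel (by omega)] at this
  exact_mod_cast this

theorem nonpos_of_mul_choose_le {s N : ℕ} {K G : ℤ}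
    (h : ∀ n ≥ N, K * ((n + (s + 1)).choose (s + 1) : ℤ) ≤ G * ((n + s).choose s : ℤ)) : K ≤ 0 := by
  by_contra hK
  push Not at hK
  have h1 := h (N + (G.toNat * (s + 1))) (Nat.le_add_right _ _)
  set n := N + (G.toNat * (s + 1)) with hn
  have h2 := Nat.add_one_mul_choose_eq (n + s) s
  have hpos : 0 < (n + s).choose s := Nat.choose_pos (Nat.le_add_left _ _)
  have h3 : ((n + s + 1 : ℕ) : ℤ) * ((n + s).choose s : ℤ) =
      ((n + (s + 1)).choose (s + 1) : ℤ) * ((s + 1 : ℕ) : ℤ) := by exact_mod_cast h2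
  have h4 : ((n + s + 1 : ℕ) : ℤ) * ((n + s).choose s : ℤ) ≤
      (G * ((s + 1 : ℕ) : ℤ)) * ((n + s).choose s : ℤ) := by
    rw [h3]
    have : (0 : ℤ) ≤ ((s + 1 : ℕ) : ℤ) := by positivity
    have h5 : (0 : ℤ) ≤ ((n + (s + 1)).choose (s + 1) : ℤ) := by positivity
    have h6 : ((n + (s + 1)).choose (s + 1) : ℤ) ≤ G * ((n + s).choose s : ℤ) := by nlinarith
    have := mul_le_mul_of_nonneg_right h6 this
    linarith
  have h5 := le_of_mul_le_mul_right h4 (by exact_mod_cast hpos)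
  have h6 : G ≤ G.toNat := Int.self_le_toNat G
  have h7 : G * ((s + 1 : ℕ) : ℤ) ≤ (G.toNat : ℤ) * ((s + 1 : ℕ) : ℤ) :=
    mul_le_mul_of_nonneg_right h6 (by positivity)
  have h8 : ((n + s + 1 : ℕ) : ℤ) ≤ ((G.toNat * (s + 1) : ℕ) : ℤ) := by
    push_cast at h5 h7 ⊢
    linarith
  have := Int.ofNat_le.mp h8
  omega

/-- Comparison of leading coefficients. -/
theorem le_of_mul_choose_le_sum {s N : ℕ} {K : ℤ} {g : ℕ → ℤ}
    (h : ∀ n ≥ N, K * ((n + (s + 1)).choose (s + 1) : ℤ) ≤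
      ∑ i ∈ Finset.range (s + 1 + 1),
        (-1) ^ i * g i * ((n + (s + 1) - i).choose (s + 1 - i) : ℤ)) : K ≤ g 0 := by
  obtain ⟨G, -, hG⟩ := exists_abs_sub_le s g
  have := nonpos_of_mul_choose_le (K := K - g 0) (G := G) (N := N) (s := s) fun n hn => by
    have h1 := h n hn
    have h2 := (abs_le.mp (hG n)).2
    rw [sub_mul]
    linarith
  linarith

theorem choose_succ_le (n s : ℕ) : (n + 1 + s).choose s ≤ (s + 1) * (n + s).choose s := by
  have h := Nat.choose_mul_succ_eq (n + s) s
  rw [show n + s + 1 - s = n + 1 by omega] at h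
  refine Nat.le_of_mul_le_mul_right (c := n + 1) ?_ (Nat.succ_pos n)
  rw [show n + 1 + s = n + s + 1 by omega, ← h]
  have : n + s + 1 ≤ (s + 1) * (n + 1) := by nlinarith
  calc _ ≤ (n + s).choose s * ((s + 1) * (n + 1)) := Nat.mul_le_mul_left _ this
    _ = _ := by ring

theorem leading_le_of_shift {s N : ℕ} {g g' : ℕ → ℤ}
    (h : ∀ n ≥ N, ∑ i ∈ Finset.range (s + 1 + 1),
        (-1) ^ i * g' i * ((n + (s + 1) - i).choose (s + 1 - i) : ℤ) ≤
      ∑ i ∈ Finset.range (s + 1 + 1),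
        (-1) ^ i * g i * ((n + 1 + (s + 1) - i).choose (s + 1 - i) : ℤ)) : g' 0 ≤ g 0 := by
  obtain ⟨G, hG0, hG⟩ := exists_abs_sub_le s g
  obtain ⟨G', -, hG'⟩ := exists_abs_sub_le s g'
  have := nonpos_of_mul_choose_le (K := g' 0 - g 0) (G := G' + (|g 0| + G) * (s + 1 : ℕ))
    (N := N) (s := s) fun n hn => by
    have h1 := h n hn
    have h2 := (abs_le.mp (hG (n + 1))).2
    have h3 := (abs_le.mp (hG' n)).1
    have h4 : ((n + 1 + (s + 1)).choose (s + 1) : ℤ) =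
        ((n + 1 + s).choose s : ℤ) + ((n + (s + 1)).choose (s + 1) : ℤ) := by
      rw [show n + 1 + (s + 1) = (n + 1 + s) + 1 by omega, Nat.choose_succ_succ,
        show n + (s + 1) = n + 1 + s by omega]
      push_cast
      rfl
    rw [h4] at h2
    have h5 : ((n + 1 + s).choose s : ℤ) ≤ (s + 1 : ℕ) * ((n + s).choose s : ℤ) := by
      exact_mod_cast choose_succ_le n s
    have h6 : (|g 0| + G) * ((n + 1 + s).choose s : ℤ) ≤
        (|g 0| + G) * ((s + 1 : ℕ) * ((n + s).choose s : ℤ)) :=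
      mul_le_mul_of_nonneg_left h5 (add_nonneg (abs_nonneg _) hG0)
    have h7 : g 0 * ((n + 1 + s).choose s : ℤ) ≤ |g 0| * ((n + 1 + s).choose s : ℤ) :=
      mul_le_mul_of_nonneg_right (le_abs_self _) (by positivity)
    rw [sub_mul, add_mul, mul_assoc (|g 0| + G)]
    rw [add_mul] at h6
    linarith
  linarith

end Binomial

section Coefficients

variable {R : Type u} [CommRing R]

theorem moduleLength_eq_natCast_iff {M : Type u} [AddCommGroup M] [Module R M] {L : ℕ} :
    moduleLength R M = (L : WithBot ℕ∞) ↔ Module.length R M = L := by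
  rw [moduleLength, ← Module.coe_length]
  exact WithBot.coe_inj

theorem moduleLength_quotient {I : Ideal R} {L : ℕ} :
    moduleLength R (R ⧸ (I • (⊤ : Submodule R R))) = (L : WithBot ℕ∞) ↔ relLength ⊤ I = L := by
  rw [moduleLength_eq_natCast_iff, relLength_top, smul_eq_mul, Ideal.mul_top]

variable [IsLocalRing R]

theorem mem_colonIdeal {q : Ideal R} {a : R} :
    a ∈ colonIdeal R q ↔ ∀ r ∈ maximalIdeal R, r * a ∈ q := Iff.rfl

theorem le_colonIdeal (q : Ideal R) : q ≤ colonIdeal R q := fun _ ha r _ => q.mul_mem_left r ha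

theorem irMod_eq_natCast_iff {I : Ideal R} {L : ℕ} :
    irMod R R I = (L : WithBot ℕ∞) ↔ relLength (colonIdeal R I) I = L := by
  rw [irMod, moduleLength_eq_natCast_iff, smul_eq_mul, Ideal.mul_top]
  rfl

variable {x : ℕ → R} {d : ℕ} (h : IsDSeq ⊥ x d) {K : ℕ}
  (hK : (K : ℕ∞) ≤ relLength (colonIdeal R (seqIdeal ⊥ x d))
    (seqIdeal ⊥ x d ⊔ seqColon x (d - 1)))

include h hK in
theorem IsDSeq.mul_choose_le (hd : 0 < d) (n : ℕ) :
    (((n + (d - 1)).choose (d - 1) * K : ℕ) : ℕ∞) ≤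
      relLength (seqIdeal ⊥ x d ^ n * colonIdeal R (seqIdeal ⊥ x d)) (seqIdeal ⊥ x d ^ (n + 1)) := by
  refine le_trans ?_ (h.choose_mul_relLength_le (colonIdeal R (seqIdeal ⊥ x d)) hd n)
  push_cast
  gcongr

include h hK in
theorem IsDSeq.le_irrCoeff (hd : 2 ≤ d) {f : ℕ → ℤ} (hf : IsIrrCoeff R (seqIdeal ⊥ x d) d f) :
    (K : ℤ) ≤ f 0 := by
  obtain ⟨s, rfl⟩ : ∃ s, d = s + 1 + 1 := ⟨d - 2, by omega⟩
  obtain ⟨N, hN⟩ := hf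
  refine le_of_mul_choose_le_sum (s := s) (N := N) fun n hn => ?_
  obtain ⟨L, hL, hLe⟩ := hN n hn
  rw [irMod_eq_natCast_iff] at hL
  have h1 := (h.mul_choose_le hK (by omega) n).trans (relLength_mono
    (A' := colonIdeal R (seqIdeal ⊥ x (s + 1 + 1) ^ (n + 1))) (Ideal.mul_le.mpr ?_))
  · rw [hL, Nat.add_sub_cancel] at h1
    have h2 : (n + (s + 1)).choose (s + 1) * K ≤ L := by exact_mod_cast h1
    have h3 : ((n + (s + 1)).choose (s + 1) : ℤ) * K ≤ L := by exact_mod_cast h2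
    rw [mul_comm]
    refine h3.trans (hLe.le.trans (le_of_eq (Finset.sum_congr rfl fun i _ => ?_)))
    rfl
  · intro a ha b hb r hr
    rw [smul_eq_mul, mul_left_comm, pow_succ]
    exact Ideal.mul_mem_mul ha (hb r hr)

include h hK in
theorem IsDSeq.le_hilbCoeff_sub (hd : 2 ≤ d)
    (hm : maximalIdeal R * colonIdeal R (seqIdeal ⊥ x d) ≤ maximalIdeal R * seqIdeal ⊥ x d)
    (hI : colonIdeal R (seqIdeal ⊥ x d) ≤ maximalIdeal R) {e e' : ℕ → ℤ}
    (he : IsHilbCoeff R (colonIdeal R (seqIdeal ⊥ x d)) d e)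
    (he' : IsHilbCoeff R (seqIdeal ⊥ x d) d e') : (K : ℤ) ≤ e 1 - e' 1 := by
  obtain ⟨s, rfl⟩ : ∃ s, d = s + 1 + 1 := ⟨d - 2, by omega⟩
  set q := seqIdeal ⊥ x (s + 1 + 1) with hq
  set I := colonIdeal R q with hIdef
  obtain ⟨N, hN⟩ := he
  obtain ⟨N', hN'⟩ := he'
  have hqI : q ≤ I := le_colonIdeal q
  have hmI : ∀ n, maximalIdeal R * I ^ n ≤ q ^ n := by
    have : ∀ n, maximalIdeal R * I ^ n ≤ maximalIdeal R * q ^ n := by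
      intro n
      induction n with
      | zero => simp
      | succ n ih =>
        calc maximalIdeal R * I ^ (n + 1) = (maximalIdeal R * I) * I ^ n := by ring
          _ ≤ (maximalIdeal R * q) * I ^ n := Ideal.mul_mono_left hm
          _ = q * (maximalIdeal R * I ^ n) := by ring
          _ ≤ q * (maximalIdeal R * q ^ n) := Ideal.mul_mono_right ih
          _ = maximalIdeal R * q ^ (n + 1) := by ring
    exact fun n => (this n).trans Ideal.mul_le_right
  have hIq : ∀ n, I ^ (n + 1) ≤ q ^ n := fun n => by
    rw [pow_succ']
    exact (Ideal.mul_mono_left hI).trans (hmI n)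
  have h0 : e' 0 ≤ e 0 := by
    refine leading_le_of_shift (s := s + 1) (N := max N N') fun n hn => ?_
    obtain ⟨L, hL, hLe⟩ := hN (n + 1) (by omega)
    obtain ⟨L', hL', hLe'⟩ := hN' n (by omega)
    rw [moduleLength_quotient] at hL hL'
    have := relLength_anti (A := ⊤) (hIq (n + 1))
    rw [hL, hL'] at this
    have : L' ≤ L := by exact_mod_cast this
    rw [← hLe, ← hLe']
    exact_mod_cast this
  have hlow : ∀ n ≥ max N N', (K : ℤ) * ((n + (s + 1)).choose (s + 1) : ℤ) ≤
      ∑ i ∈ Finset.range (s + 1 + 1 + 1), (-1) ^ i * (e' i - e i) *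
        ((n + (s + 1 + 1) - i).choose (s + 1 + 1 - i) : ℤ) := by
    intro n hn
    obtain ⟨L, hL, hLe⟩ := hN n (by omega)
    obtain ⟨L', hL', hLe'⟩ := hN' n (by omega)
    rw [moduleLength_quotient] at hL hL'
    have h1 := relLength_eq_add (A := ⊤) (Ideal.pow_right_mono hqI (n + 1))
    rw [hL, hL', top_inf_eq] at h1
    have h2 := (h.mul_choose_le hK (by omega) n).trans (relLength_mono (A' := I ^ (n + 1)) (by
      rw [pow_succ]
      exact Ideal.mul_mono_left (Ideal.pow_right_mono hqI n)))
    have h3 := add_le_add_left h2 (L : ℕ∞)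
    rw [← hq, ← h1, Nat.add_sub_cancel] at h3
    have h4 : (n + (s + 1)).choose (s + 1) * K + L ≤ L' := by exact_mod_cast h3
    have h5 : ((n + (s + 1)).choose (s + 1) : ℤ) * K + L ≤ L' := by exact_mod_cast h4
    have h6 : ∑ i ∈ Finset.range (s + 1 + 1 + 1), (-1) ^ i * (e' i - e i) *
        ((n + (s + 1 + 1) - i).choose (s + 1 + 1 - i) : ℤ) = L' - L := by
      rw [hLe, hLe', ← Finset.sum_sub_distrib]
      exact Finset.sum_congr rfl fun i _ => by ring
    rw [h6]
    linarith
  have h0' : e 0 ≤ e' 0 := by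
    have := le_of_mul_choose_le_sum (s := s + 1) (N := max N N') (K := 0)
      (g := fun i => e' i - e i) fun n hn => by
        rw [zero_mul]
        exact le_trans (by positivity) (hlow n hn)
    linarith
  have := le_of_mul_choose_le_sum (s := s) (N := max N N') (K := K)
    (g := fun i => e (i + 1) - e' (i + 1)) fun n hn => by
      refine (hlow n hn).trans (le_of_eq ?_)
      rw [Finset.sum_range_succ']
      rw [show e' 0 - e 0 = 0 by linarith, mul_zero, zero_mul, add_zero]
      refine Finset.sum_congr rfl fun i _ => ?_
      rw [show n + (s + 1 + 1) - (i + 1) = n + (s + 1) - i by omega,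
        show s + 1 + 1 - (i + 1) = s + 1 - i by omega]
      ring
  exact this

end Coefficients

section RegularSequence

variable {R : Type u} [CommRing R] [IsNoetherianRing R] {x : ℕ → R} {d : ℕ}
  (hreg : ∀ i < d, ∀ a, x i * a ∈ seqIdeal ⊥ x i → a ∈ seqIdeal ⊥ x i)

include hreg

omit [IsNoetherianRing R] in
theorem isDSeq_of_regular : IsDSeq ⊥ x d := fun i _ _ hij hj ha => hreg i (by omega) _ ha

omit [IsNoetherianRing R] in
theorem seqColon_of_regular {i : ℕ} (hi : i < d) : seqColon x i = seqIdeal ⊥ x i := by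
  ext a
  rw [mem_seqColon]
  exact ⟨hreg i hi a, fun ha => Ideal.mul_mem_left _ _ ha⟩

theorem mem_of_mul_mem_pow_sup {i : ℕ} (hi : i < d) {n : ℕ} {a : R}
    (ha : x i * a ∈ seqIdeal ⊥ x d ^ (n + 1) ⊔ seqIdeal ⊥ x i) :
    a ∈ seqIdeal ⊥ x d ^ n ⊔ seqIdeal ⊥ x i := by
  rw [← seqColon_of_regular hreg hi] at ha ⊢
  exact (isDSeq_of_regular hreg).mem_of_mul_mem_pow hi ha

theorem relLength_colon_step (b : Ideal R) {i : ℕ} (hi : i < d) (n : ℕ) :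
    relLength (modColon R (seqIdeal ⊥ x d ^ (n + 2) ⊔ seqIdeal ⊥ x i) b ⊓
        (seqIdeal ⊥ x d ^ (n + 1) ⊔ seqIdeal ⊥ x i)) (seqIdeal ⊥ x d ^ (n + 2) ⊔ seqIdeal ⊥ x i) ≤
      relLength (modColon R (seqIdeal ⊥ x d ^ (n + 1) ⊔ seqIdeal ⊥ x i) b ⊓
        (seqIdeal ⊥ x d ^ n ⊔ seqIdeal ⊥ x i)) (seqIdeal ⊥ x d ^ (n + 1) ⊔ seqIdeal ⊥ x i) +
      relLength (modColon R (seqIdeal ⊥ x d ^ (n + 2) ⊔ seqIdeal ⊥ x (i + 1)) b ⊓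
        (seqIdeal ⊥ x d ^ (n + 1) ⊔ seqIdeal ⊥ x (i + 1)))
          (seqIdeal ⊥ x d ^ (n + 2) ⊔ seqIdeal ⊥ x (i + 1)) := by
  set q := seqIdeal ⊥ x d with hq
  have hle : ∀ k, q ^ k ⊔ seqIdeal ⊥ x i ≤ q ^ k ⊔ seqIdeal ⊥ x (i + 1) := fun k =>
    sup_le_sup_left (seqIdeal_mono (Nat.le_succ i)) _
  have hxq : x i ∈ q := mem_seqIdeal hi
  have hmul : ∀ k a, a ∈ q ^ k ⊔ seqIdeal ⊥ x i → x i * a ∈ q ^ (k + 1) ⊔ seqIdeal ⊥ x i := by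
    intro k a ha
    obtain ⟨p, hp, s, hs, rfl⟩ := Submodule.mem_sup.mp ha
    rw [mul_add]
    refine add_mem (Ideal.mem_sup_left ?_) (Ideal.mem_sup_right (Ideal.mul_mem_left _ _ hs))
    rw [pow_succ']
    exact Ideal.mul_mem_mul hxq hp
  rw [relLength_eq_add (hle (n + 2))]
  refine add_le_add ?_ (relLength_mono (inf_le_inf ?_ (hle _)))
  · refine mul_relLength_le (x := x i) (fun a _ ha => hmul _ _ ha) fun a ha => ?_
    have ha2 : a ∈ q ^ (n + 2) ⊔ seqIdeal ⊥ x (i + 1) := ha.2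
    rw [seqIdeal_succ, ← sup_assoc, mem_sup_span_singleton] at ha2
    obtain ⟨t, ht⟩ := ha2
    have hsub : q ^ (n + 2) ⊔ seqIdeal ⊥ x i ≤ q ^ (n + 1) ⊔ seqIdeal ⊥ x i :=
      sup_le_sup_right (Ideal.pow_le_pow_right (by omega)) _
    refine ⟨t, ⟨fun r hr => ?_, ?_⟩, ht⟩
    · refine mem_of_mul_mem_pow_sup hreg hi ?_
      have h1 := sub_mem (ha.1.1 r hr) (Ideal.mul_mem_left _ r ht)
      have e : r • a - r * (a - x i * t) = x i * (r • t) := by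
        rw [smul_eq_mul, smul_eq_mul]
        ring
      rwa [e] at h1
    · refine mem_of_mul_mem_pow_sup hreg hi ?_
      have h1 := sub_mem ha.1.2 (hsub ht)
      rwa [sub_sub_cancel] at h1
  · intro a ha r hr
    exact hle _ (ha r hr)

theorem relLength_colon_le (b : Ideal R) (k : ℕ) : ∀ i, i + k + 1 = d → ∀ n,
    relLength (modColon R (seqIdeal ⊥ x d ^ (n + 1) ⊔ seqIdeal ⊥ x i) b ⊓
        (seqIdeal ⊥ x d ^ n ⊔ seqIdeal ⊥ x i)) (seqIdeal ⊥ x d ^ (n + 1) ⊔ seqIdeal ⊥ x i) ≤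
      ((n + k).choose k : ℕ∞) * relLength (modColon R (seqIdeal ⊥ x d) b) (seqIdeal ⊥ x d) := by
  set q := seqIdeal ⊥ x d with hq
  have h0 : ∀ i < d, relLength (modColon R (q ^ (0 + 1) ⊔ seqIdeal ⊥ x i) b ⊓
      (q ^ 0 ⊔ seqIdeal ⊥ x i)) (q ^ (0 + 1) ⊔ seqIdeal ⊥ x i) ≤ relLength (modColon R q b) q := by
    intro i hi
    have : q ^ (0 + 1) ⊔ seqIdeal ⊥ x i = q := by
      rw [zero_add, pow_one]
      exact sup_eq_left.mpr (seqIdeal_mono hi.le)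
    rw [this]
    exact relLength_mono inf_le_left
  induction k with
  | zero =>
    intro i hi n
    rw [Nat.choose_zero_right, Nat.cast_one, one_mul]
    induction n with
    | zero => exact h0 i (by omega)
    | succ n ihn =>
      refine (relLength_colon_step hreg b (by omega) n).trans ?_
      have hz : relLength (modColon R (q ^ (n + 2) ⊔ seqIdeal ⊥ x (i + 1)) b ⊓
          (q ^ (n + 1) ⊔ seqIdeal ⊥ x (i + 1))) (q ^ (n + 2) ⊔ seqIdeal ⊥ x (i + 1)) = 0 := by
        refine relLength_eq_zero (inf_le_right.trans ?_)
        rw [show i + 1 = d by omega, ← hq]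
        exact sup_le ((Ideal.pow_le_self (by omega)).trans le_sup_right) le_sup_right
      rw [hz, add_zero]
      exact ihn
  | succ k ih =>
    intro i hi n
    induction n with
    | zero =>
      rw [show 0 + (k + 1) = k + 1 from zero_add _, Nat.choose_self, Nat.cast_one, one_mul]
      exact h0 i (by omega)
    | succ n ihn =>
      refine (relLength_colon_step hreg b (by omega) n).trans ?_
      refine (add_le_add ihn (ih (i + 1) (by omega) (n + 1))).trans (le_of_eq ?_)
      rw [← add_mul, ← Nat.cast_add]
      congr 2
      rw [show n + 1 + (k + 1) = (n + 1 + k) + 1 by omega, Nat.choose_succ_succ,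
        show n + (k + 1) = n + 1 + k by omega]
      exact Nat.add_comm _ _

theorem colon_pow_le (hd : 0 < d) {b : Ideal R} (hb : x 0 ∈ b) (n : ℕ) :
    modColon R (seqIdeal ⊥ x d ^ (n + 1)) b ≤ seqIdeal ⊥ x d ^ n := by
  intro a ha
  have := mem_of_mul_mem_pow_sup hreg hd (n := n) (a := a) (Ideal.mem_sup_left (ha _ hb))
  rwa [seqIdeal, sup_bot_eq] at this

theorem relLength_colon_eq (hd : 0 < d) {b : Ideal R} (hb : x 0 ∈ b) (n : ℕ) :
    relLength (modColon R (seqIdeal ⊥ x d ^ (n + 1)) b) (seqIdeal ⊥ x d ^ (n + 1)) =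
      ((n + (d - 1)).choose (d - 1) : ℕ∞) *
        relLength (modColon R (seqIdeal ⊥ x d) b) (seqIdeal ⊥ x d) ∧
    relLength (seqIdeal ⊥ x d ^ n * modColon R (seqIdeal ⊥ x d) b) (seqIdeal ⊥ x d ^ (n + 1)) =
      ((n + (d - 1)).choose (d - 1) : ℕ∞) *
        relLength (modColon R (seqIdeal ⊥ x d) b) (seqIdeal ⊥ x d) := by
  have h1 := relLength_colon_le hreg b (d - 1) 0 (by omega) n
  have h2 := (isDSeq_of_regular hreg).choose_mul_relLength_le
    (modColon R (seqIdeal ⊥ x d) b) hd n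
  rw [seqColon_of_regular hreg (by omega), sup_eq_left.mpr (seqIdeal_mono (by omega))] at h2
  rw [seqIdeal, sup_bot_eq, sup_bot_eq, inf_eq_left.mpr (colon_pow_le hreg hd hb n)] at h1
  have h3 : seqIdeal ⊥ x d ^ n * modColon R (seqIdeal ⊥ x d) b ≤
      modColon R (seqIdeal ⊥ x d ^ (n + 1)) b := by
    refine Ideal.mul_le.mpr fun p hp a ha r hr => ?_
    rw [smul_eq_mul, mul_left_comm, pow_succ]
    exact Ideal.mul_mem_mul hp (ha r hr)
  exact ⟨le_antisymm h1 (h2.trans (relLength_mono h3)),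
    le_antisymm ((relLength_mono h3).trans h1) h2⟩

theorem relLength_pow_eq (hd : 0 < d) (n : ℕ) :
    relLength (seqIdeal ⊥ x d ^ n) (seqIdeal ⊥ x d ^ (n + 1)) =
      ((n + (d - 1)).choose (d - 1) : ℕ∞) * relLength ⊤ (seqIdeal ⊥ x d) := by
  have htop : ∀ c : Ideal R, modColon R c ⊥ = ⊤ := fun c => by
    refine eq_top_iff.mpr fun a _ r hr => ?_
    rw [(Submodule.mem_bot R).mp hr, zero_smul]
    exact zero_mem _
  have h1 := relLength_colon_le hreg ⊥ (d - 1) 0 (by omega) n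
  have h2 := (isDSeq_of_regular hreg).choose_mul_relLength_le ⊤ hd n
  rw [seqColon_of_regular hreg (by omega), sup_eq_left.mpr (seqIdeal_mono (by omega)),
    Ideal.mul_top] at h2
  rw [seqIdeal, sup_bot_eq, sup_bot_eq, htop, htop, top_inf_eq] at h1
  exact le_antisymm h1 h2

theorem relLength_top_pow_eq (hd : 0 < d) (n : ℕ) :
    relLength ⊤ (seqIdeal ⊥ x d ^ (n + 1)) =
      ((n + d).choose d : ℕ∞) * relLength ⊤ (seqIdeal ⊥ x d) := by
  induction n with
  | zero => simp
  | succ n ih =>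
    rw [relLength_eq_add (A := ⊤) (B' := seqIdeal ⊥ x d ^ (n + 1))
      (Ideal.pow_le_pow_right (by omega)), top_inf_eq, ih, relLength_pow_eq hreg hd, ← add_mul,
      ← Nat.cast_add]
    congr 2
    obtain ⟨k, rfl⟩ : ∃ k, d = k + 1 := ⟨d - 1, by omega⟩
    rw [Nat.add_sub_cancel, show n + 1 + (k + 1) = (n + 1 + k) + 1 by omega,
      Nat.choose_succ_succ, show n + (k + 1) = n + 1 + k by omega]

end RegularSequence

section Indexing

variable {R : Type u} [CommRing R]

theorem exists_nat_extension {s : ℕ} (x : Fin s → R) : ∃ y : ℕ → R, x = fun i : Fin s => y i :=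
  ⟨fun l => if h : l < s then x ⟨l, h⟩ else 0, by
    ext i
    simp⟩

variable {x : ℕ → R} {d : ℕ}

theorem span_range_eq_seqIdeal :
    Ideal.span (Set.range fun i : Fin d => x i) = seqIdeal ⊥ x d := by
  rw [seqIdeal_eq, bot_sup_eq]
  refine congrArg Ideal.span ?_
  ext a
  simp only [Set.mem_range, List.mem_map, List.mem_range, Set.mem_ofPred_eq]
  exact ⟨fun ⟨i, hi⟩ => ⟨i, i.2, hi⟩, fun ⟨i, hi, h⟩ => ⟨⟨i, hi⟩, h⟩⟩

theorem span_image_lt_eq (i : Fin d) :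
    Ideal.span ((fun j : Fin d => x j) '' {j | j < i}) = Ideal.ofList ((List.range i).map x) := by
  refine congrArg Ideal.span ?_
  ext a
  simp only [Set.mem_image, List.mem_map, List.mem_range, Set.mem_ofPred_eq]
  exact ⟨fun ⟨j, hj, h⟩ => ⟨j, hj, h⟩, fun ⟨j, hj, h⟩ => ⟨⟨j, hj.trans i.2⟩, hj, h⟩⟩

theorem span_image_gt_eq_tailIdeal (i : Fin d) :
    Ideal.span ((fun j : Fin d => x j) '' {j | i < j}) = tailIdeal x d (i + 1) := by
  refine congrArg Ideal.span ?_
  ext a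
  simp only [Set.mem_image, List.mem_map, List.mem_range'_1, Set.mem_ofPred_eq]
  exact ⟨fun ⟨j, hj, h⟩ => ⟨j, ⟨Nat.succ_le_of_lt hj, by omega⟩, h⟩,
    fun ⟨j, ⟨hj, hj'⟩, h⟩ => ⟨⟨j, by omega⟩, Nat.lt_of_succ_le hj, h⟩⟩

variable [IsLocalRing R] [IsNoetherianRing R]

theorem isParamList_iff : IsParamList ⊥ ((List.range d).map x) ↔
    (∀ i : Fin d, x i ∈ maximalIdeal R) ∧
      ∃ n, maximalIdeal R ^ n ≤ Ideal.span (Set.range fun i : Fin d => x i) := by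
  rw [span_range_eq_seqIdeal, seqIdeal_eq]
  constructor
  · intro h
    exact ⟨fun i => h.mem _ (List.mem_map_of_mem (List.mem_range.mpr i.2)), h.exists_pow_le⟩
  · rintro ⟨h1, n, h2⟩
    refine ⟨fun a ha => ?_, fun r hr => ⟨n, h2 (Ideal.pow_mem_pow hr n)⟩⟩
    obtain ⟨l, hl, rfl⟩ := List.mem_map.mp ha
    exact h1 ⟨l, List.mem_range.mp hl⟩

theorem isSOP_iff_isParamList (hdim : ringKrullDim R = d) :
    IsSOP R R (fun i : Fin d => x i) ↔ IsParamList ⊥ ((List.range d).map x) := by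
  rw [isSOP_iff, isParamList_iff, and_iff_right hdim]

theorem isCSOP_iff_isCSeq (hdim : ringKrullDim R = d) :
    IsCSOP R R (fun i : Fin d => x i) ↔ IsCSeq x d := by
  rw [isCSOP_iff hdim, ← and_assoc, ← isParamList_iff]
  refine ⟨fun ⟨h1, h2⟩ => ⟨h1, fun l hl => ?_⟩, fun h => ⟨h.param, fun i => ?_⟩⟩
  · have := h2 ⟨l, hl⟩
    rwa [span_image_gt_eq_tailIdeal] at this
  · rw [span_image_gt_eq_tailIdeal]
    exact h.mem_b i i.2

theorem isCParamIdeal_iff (hdim : ringKrullDim R = d) {q : Ideal R} :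
    IsCParamIdeal R q ↔ ∃ x : ℕ → R, IsCSeq x d ∧ q = seqIdeal ⊥ x d := by
  constructor
  · rintro ⟨s, x, hx, rfl⟩
    have hs : s = d := by
      have h := (isSOP_iff.mp hx.1).1
      rw [hdim] at h
      exact_mod_cast h.symm
    subst hs
    obtain ⟨y, rfl⟩ := exists_nat_extension x
    exact ⟨y, (isCSOP_iff_isCSeq hdim).mp hx, span_range_eq_seqIdeal⟩
  · rintro ⟨x, hx, rfl⟩
    exact ⟨d, _, (isCSOP_iff_isCSeq hdim).mpr hx, span_range_eq_seqIdeal.symm⟩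

end Indexing

section Socles

variable {R : Type u} [CommRing R]

/-- A linear equivalence restricts to the torsion submodules. -/
def torsionBySetEquiv {M N : Type*} [AddCommGroup M] [Module R M] [AddCommGroup N] [Module R N]
    (e : M ≃ₗ[R] N) (s : Set R) :
    Submodule.torsionBySet R M s ≃ₗ[R] Submodule.torsionBySet R N s :=
  e.ofSubmodules _ _ (by
    ext y
    simp only [Submodule.mem_map, Submodule.mem_torsionBySet_iff]
    constructor
    · rintro ⟨z, hz, rfl⟩ a
      rw [LinearEquiv.coe_coe, ← map_smul, hz a, map_zero]
    · intro hy
      refine ⟨e.symm y, fun a => ?_, e.apply_symm_apply y⟩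
      rw [← map_smul, hy a, map_zero])

variable [IsNoetherianRing R] {J : Ideal R} {M N : Type u}
  [AddCommGroup M] [Module R M] [AddCommGroup N] [Module R N]

/-- A linear equivalence induces an equivalence in local cohomology. -/
def LCH.mapEquiv (e : M ≃ₗ[R] N) (i : ℕ) : LCH J M i ≃ₗ[R] LCH J N i :=
  LinearEquiv.ofLinearMap (LCH.map J e.toLinearMap i) (LCH.map J e.symm.toLinearMap i)
    (LinearMap.ext fun y => by
      rw [LinearMap.comp_apply, ← LCH.map_comp, LinearEquiv.comp_coe, LinearEquiv.symm_trans_self,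
        LinearEquiv.refl_toLinearMap, LCH.map_id, LinearMap.id_apply])
    (LinearMap.ext fun y => by
      rw [LinearMap.comp_apply, ← LCH.map_comp, LinearEquiv.comp_coe, LinearEquiv.self_trans_symm,
        LinearEquiv.refl_toLinearMap, LCH.map_id, LinearMap.id_apply])

/-- The local cohomology in degree zero of a module killed by a power of `J`. -/
def LCH.evalEquiv (n : ℕ) (h : ∀ r ∈ J ^ n, ∀ y : M, r • y = 0) : LCH J M 0 ≃ₗ[R] M :=
  LinearEquiv.ofBijective (LCH.eval M)
    ⟨LCH.eval_injective, fun y => LCH.eval_range fun r hr => h r hr y⟩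

omit [IsNoetherianRing R] in
theorem relLength_modColon (b c : Ideal R) :
    relLength (modColon R c b) c =
      Module.length R (Submodule.torsionBySet R (R ⧸ c) (b : Set R)) := by
  refine (LinearEquiv.ofEq _ _ ?_).length_eq
  ext y
  obtain ⟨a, rfl⟩ := Submodule.Quotient.mk_surjective _ y
  rw [Submodule.mem_torsionBySet_iff, Submodule.mem_map]
  constructor
  · rintro ⟨a', ha', h⟩ r
    rw [← h, Submodule.mkQ_apply, ← Submodule.Quotient.mk_smul, Submodule.Quotient.mk_eq_zero]
    exact ha' r r.2
  · intro h
    refine ⟨a, fun r hr => ?_, rfl⟩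
    have := h ⟨r, hr⟩
    rwa [← Submodule.Quotient.mk_smul, Submodule.Quotient.mk_eq_zero] at this

end Socles

section CohenMacaulay

variable {R : Type u} [CommRing R] [IsLocalRing R] [IsNoetherianRing R] {x : ℕ → R} {d : ℕ}
  (hdim : ringKrullDim R = d) (hCM : IsCMLocal R)

include hdim in
theorem bIdeal_eq_top_of_isCMLocal (hCM : IsCMLocal R)
    (hx : IsParamList ⊥ ((List.range d).map x)) {k : ℕ} (hk : k ≤ d) :
    bIdeal R (R ⧸ tailIdeal x d k) = ⊤ := by
  rw [Ideal.eq_top_iff_one, mem_bIdeal_quotient_iff]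
  intro t y hy i a ha
  have hx' : IsParamList ⊥ ((List.range' k (d - k)).map x ++ (List.range k).map x) :=
    hx.of_mem_iff fun a => by
      simp only [List.mem_append, List.mem_map, List.mem_range, List.mem_range'_1]
      constructor
      · rintro (⟨l, hl, rfl⟩ | ⟨l, hl, rfl⟩) <;> exact ⟨l, by omega, rfl⟩
      · rintro ⟨l, hl, rfl⟩
        rcases lt_or_ge l k with h | h
        · exact Or.inr ⟨l, h, rfl⟩
        · exact Or.inl ⟨l, by omega, rfl⟩
  obtain ⟨hyd, hym, n, hn⟩ := isSOP_quotient_iff.mp hy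
  have hdim' : ringKrullDim (R ⧸ tailIdeal x d k) = k := by
    have := hx'.ringKrullDim_eq (by
      rw [ringKrullDim_quotient_bot hdim]
      simp [Nat.sub_add_cancel hk])
    rw [bot_sup_eq, List.length_map, List.length_range] at this
    exact this
  have ht : t = k := by
    rw [hdim'] at hyd
    exact_mod_cast hyd.symm
  subst ht
  obtain ⟨z, rfl⟩ := exists_nat_extension y
  rw [span_image_lt_eq] at ha ⊢
  rw [span_range_eq_seqIdeal, seqIdeal_eq, bot_sup_eq] at hn
  rw [one_mul]
  rw [tailIdeal, ← Ideal.ofList_append] at ha ⊢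
  have hsplit : (List.range t).map z =
      (List.range i).map z ++ z i :: (List.range' (i + 1) (t - (i + 1))).map z := by
    rw [← List.map_cons, ← List.map_append, ← List.range'_succ, List.range_eq_range',
      List.range_eq_range', show t - (i + 1) + 1 = t - i by omega]
    have := @List.range'_append_1 0 i (t - i)
    rw [zero_add, Nat.add_sub_cancel' i.2.le] at this
    rw [this]
  refine hCM.regular hdim (L' := (List.range' (i + 1) (t - (i + 1))).map z) ?_ ?_ ha
  · simp only [List.length_append, List.length_map, List.length_range, List.length_range']
    have := i.2
    omega
  · rw [List.append_assoc, ← hsplit]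
    refine ⟨fun a ha => ?_, fun r hr => ⟨n, ?_⟩⟩
    · rcases List.mem_append.mp ha with h | h
      · exact hx'.mem a (List.mem_append_left _ h)
      · obtain ⟨l, hl, rfl⟩ := List.mem_map.mp h
        exact hym ⟨l, List.mem_range.mp hl⟩
    · rw [bot_sup_eq, Ideal.ofList_append]
      exact hn (Ideal.pow_mem_pow hr n)

include hdim in
theorem isCSeq_of_isCMLocal (hCM : IsCMLocal R) (hx : IsParamList ⊥ ((List.range d).map x)) :
    IsCSeq x d :=
  ⟨hx, fun l hl => by
    rw [bIdeal_eq_top_of_isCMLocal hdim hCM hx (Nat.succ_le_of_lt hl), Ideal.top_pow]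
    trivial⟩

include hdim in
theorem regular_of_isCMLocal (hCM : IsCMLocal R) (hx : IsParamList ⊥ ((List.range d).map x)) :
    ∀ i < d, ∀ a, x i * a ∈ seqIdeal ⊥ x i → a ∈ seqIdeal ⊥ x i := by
  intro i hi a ha
  have h := (isCSeq_of_isCMLocal hdim hCM hx).mul_mem_of_bIdeal hdim hi le_rfl (z := 1) (a := a)
    (by rw [bIdeal_eq_top_of_isCMLocal hdim hCM hx le_rfl]; trivial)
    (by rwa [tailIdeal_self])
  rwa [tailIdeal_self, one_mul] at h

include hdim in
theorem rLength_eq_of_isCMLocal (hCM : IsCMLocal R) (hx : IsParamList ⊥ ((List.range d).map x))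
    {r : ℕ} (hr : rLength R d = r) :
    relLength (colonIdeal R (seqIdeal ⊥ x d)) (seqIdeal ⊥ x d) = r := by
  set m := maximalIdeal R with hm
  have hreg := regular_of_isCMLocal hdim hCM hx
  have hx' : ∀ k ≤ d, IsParamList ⊥ ((List.range k).map x ++ (List.range' k (d - k)).map x) := by
    intro k hk
    rw [← List.map_append, List.range_eq_range']
    have := @List.range'_append_1 0 k (d - k)
    rw [zero_add, Nat.add_sub_cancel' hk] at this
    rwa [this, ← List.range_eq_range']
  have hsub : ∀ k ≤ d, ∀ i < d - k, Subsingleton (LCH m (R ⧸ seqIdeal ⊥ x k) i) := by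
    intro k hk i hi
    have := (hCM.vanishing hdim ((List.range k).map x) ((List.range' k (d - k)).map x)
      (by simp; omega) (hx' k hk)).1 i (by simpa using hi)
    rwa [seqIdeal_eq, bot_sup_eq]
  have hchain : ∀ k ≤ d, Nonempty (Submodule.torsionBySet R (LCH m (R ⧸ seqIdeal ⊥ x k) (d - k))
      (m : Set R) ≃ₗ[R] Submodule.torsionBySet R (LCH m (R ⧸ (⊥ : Ideal R)) d) (m : Set R)) := by
    intro k
    induction k with
    | zero => intro _; exact ⟨LinearEquiv.refl _ _⟩
    | succ k ih =>
      intro hk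
      obtain ⟨e⟩ := ih (by omega)
      obtain ⟨e'⟩ := LCH.socle_equiv (J := m) (c := seqIdeal ⊥ x k) (x := x k)
        (hx.mem _ (List.mem_map_of_mem (List.mem_range.mpr (by omega))))
        (hreg k (by omega)) (p := d - (k + 1)) (hsub k (by omega) _ (by omega))
      rw [show d - (k + 1) + 1 = d - k by omega] at e'
      exact ⟨e'.trans e⟩
  obtain ⟨e⟩ := hchain d le_rfl
  rw [Nat.sub_self] at e
  obtain ⟨n, hn⟩ := hx.exists_pow_le
  rw [← seqIdeal_eq] at hn
  have e0 : LCH m (R ⧸ seqIdeal ⊥ x d) 0 ≃ₗ[R] (R ⧸ seqIdeal ⊥ x d) := by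
    refine LCH.evalEquiv n fun r hr y => ?_
    obtain ⟨a, rfl⟩ := Submodule.Quotient.mk_surjective _ y
    rw [← Submodule.Quotient.mk_smul, Submodule.Quotient.mk_eq_zero]
    exact Ideal.mul_mem_right _ _ (hn hr)
  have e1 : LCH m (R ⧸ (⊥ : Ideal R)) d ≃ₗ[R] Hmod R R d :=
    (LCH.mapEquiv (Submodule.quotEquivOfEqBot _ rfl) d).trans (lcEquiv m d)
  have e2 := ((torsionBySetEquiv e0 (m : Set R)).symm.trans e).trans
    (torsionBySetEquiv e1 (m : Set R))
  rw [colonIdeal, relLength_modColon, e2.length_eq]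
  exact moduleLength_eq_natCast_iff.mp hr

end CohenMacaulay

section ParameterExistence

variable {R : Type u} [CommRing R] [IsLocalRing R] [IsNoetherianRing R] {d : ℕ}

theorem exists_isParamList (hdim : ringKrullDim R = d) :
    ∃ x : ℕ → R, IsParamList ⊥ ((List.range d).map x) := by
  obtain ⟨s, hs, hcard⟩ := Ideal.exists_finset_card_eq_height_of_isNoetherianRing (maximalIdeal R)
  have hcard' : s.card = d := by
    have h := maximalIdeal_height_eq_ringKrullDim (R := R)
    rw [hdim, ← hcard] at h
    exact_mod_cast h
  have hrad : maximalIdeal R ≤ (Ideal.span (s : Set R)).radical := by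
    rw [← Ideal.sInf_minimalPrimes]
    refine le_sInf fun p hp => hs.2 hp.1 (le_maximalIdeal hp.1.1.ne_top)
  have hL : s.toList.length = d := by rw [Finset.length_toList, hcard']
  refine ⟨fun i => s.toList.getD i 0, ?_⟩
  have hmap : (List.range d).map (fun i => s.toList.getD i 0) = s.toList := by
    refine List.ext_getElem (by simp [hL]) fun i h1 h2 => ?_
    simp [List.getElem?_eq_getElem h2]
  rw [hmap]
  refine ⟨fun a ha => hs.1.2 (Ideal.subset_span (Finset.mem_toList.mp ha)), ?_⟩
  have : Ideal.ofList s.toList = Ideal.span (s : Set R) :=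
    congrArg Ideal.span (by ext; simp)
  rwa [bot_sup_eq, this]

theorem IsParamList.of_pow {x : ℕ → R} (h : IsParamList ⊥ ((List.range d).map x)) {y : ℕ → R}
    {k : ℕ → ℕ} (hk : ∀ i, k i ≠ 0) (hy : ∀ i, y i = x i ^ k i) :
    IsParamList ⊥ ((List.range d).map y) := by
  refine h.of_radical (fun a ha => ?_) bot_le fun a ha => ?_
  · obtain ⟨l, hl, rfl⟩ := List.mem_map.mp ha
    rw [hy]
    exact Ideal.pow_mem_of_mem _ (h.mem _ (List.mem_map_of_mem hl)) _ (Nat.pos_of_ne_zero (hk l))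
  · obtain ⟨l, hl, rfl⟩ := List.mem_map.mp ha
    refine ⟨k l, mem_sup_ofList ?_⟩
    rw [← hy]
    exact List.mem_map_of_mem hl

variable (hdim : ringKrullDim R = d) (hCM : IsCMLocal R)
include hdim hCM

/-- In a Cohen-Macaulay ring, the elements killed modulo `z₀², z₁², …` by `z₀` and `z₁` are
multiples of `z₀z₁`. -/
theorem exists_sub_mul_mem {z₀ z₁ : R} {T : List R} (hT : T.length + 2 = d)
    (h : IsParamList ⊥ (z₀ :: z₁ :: T)) {a : R}
    (h0 : z₀ * a ∈ Ideal.ofList T ⊔ Ideal.span {z₀ ^ 2} ⊔ Ideal.span {z₁ ^ 2})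
    (h1 : z₁ * a ∈ Ideal.ofList T ⊔ Ideal.span {z₀ ^ 2} ⊔ Ideal.span {z₁ ^ 2}) :
    ∃ s, a - z₀ * z₁ * s ∈ Ideal.ofList T ⊔ Ideal.span {z₀ ^ 2} ⊔ Ideal.span {z₁ ^ 2} := by
  have hz0 : z₀ ∈ maximalIdeal R := h.mem _ (by simp)
  have hz1 : z₁ ∈ maximalIdeal R := h.mem _ (by simp)
  have reg : ∀ u v : R, u ∈ maximalIdeal R → v ∈ maximalIdeal R →
      (∀ J : Ideal R, u ∈ J → v ∈ J → z₀ ∈ J.radical ∧ z₁ ∈ J.radical) → ∀ b,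
      v * b ∈ Ideal.ofList T ⊔ Ideal.span {u} → b ∈ Ideal.ofList T ⊔ Ideal.span {u} := by
    intro u v hu hv hJ b hb
    rw [sup_comm, ← Ideal.ofList_cons] at hb ⊢
    refine hCM.regular hdim (L := u :: T) (L' := []) (by simpa using hT) ?_ hb
    refine h.of_radical (fun c hc => ?_) bot_le fun c hc => ?_
    · simp only [List.mem_append, List.mem_cons, List.not_mem_nil, or_false] at hc
      rcases hc with (rfl | hc) | rfl
      · exact hu
      · exact h.mem _ (by simp [hc])
      · exact hv
    · have := hJ (⊥ ⊔ Ideal.ofList (u :: T ++ [v])) (mem_sup_ofList (by simp))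
        (mem_sup_ofList (by simp))
      simp only [List.mem_cons] at hc
      rcases hc with rfl | rfl | hc
      · exact this.1
      · exact this.2
      · exact Ideal.le_radical (mem_sup_ofList (by simp [hc]))
  have r1 := reg (z₁ ^ 2) z₀ (Ideal.pow_mem_of_mem _ hz1 _ two_pos) hz0
    fun J hu hv => ⟨Ideal.le_radical hv, 2, hu⟩
  have r2 := reg (z₀ ^ 2) z₁ (Ideal.pow_mem_of_mem _ hz0 _ two_pos) hz1
    fun J hu hv => ⟨⟨2, hu⟩, Ideal.le_radical hv⟩
  have r3 := reg z₁ z₀ hz1 hz0 fun J hu hv => ⟨Ideal.le_radical hv, Ideal.le_radical hu⟩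
  rw [sup_right_comm] at h0
  obtain ⟨t, ht⟩ := mem_sup_span_singleton.mp h0
  have ha : a - z₀ * t ∈ Ideal.ofList T ⊔ Ideal.span {z₁ ^ 2} :=
    r1 _ (by rwa [mul_sub, ← mul_assoc, ← pow_two])
  have ha' : a - z₀ * t ∈ Ideal.ofList T ⊔ Ideal.span {z₀ ^ 2} ⊔ Ideal.span {z₁ ^ 2} :=
    sup_le_sup_right (le_sup_left (b := Ideal.span {z₀ ^ 2})) (Ideal.span {z₁ ^ 2}) ha
  have h2 : z₁ * (z₀ * t) ∈ Ideal.ofList T ⊔ Ideal.span {z₀ ^ 2} ⊔ Ideal.span {z₁ ^ 2} := by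
    have := sub_mem h1 (Ideal.mul_mem_left _ z₁ ha')
    rwa [mul_sub, sub_sub_cancel] at this
  obtain ⟨s, hs⟩ := mem_sup_span_singleton.mp h2
  have h3 : z₀ * t - z₁ * s ∈ Ideal.ofList T ⊔ Ideal.span {z₀ ^ 2} :=
    r2 _ (by rwa [mul_sub, ← mul_assoc z₁ z₁ s, ← pow_two])
  obtain ⟨w, hw⟩ := mem_sup_span_singleton.mp h3
  have h4 : t - z₀ * w ∈ Ideal.ofList T ⊔ Ideal.span {z₁} := by
    refine r3 _ (mem_sup_span_singleton.mpr ⟨s, ?_⟩)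
    convert hw using 1
    ring
  obtain ⟨v, hv⟩ := mem_sup_span_singleton.mp h4
  refine ⟨v, ?_⟩
  have e : a - z₀ * z₁ * v = (a - z₀ * t) + z₀ * (t - z₀ * w - z₁ * v) + z₀ ^ 2 * w := by ring
  rw [e]
  exact add_mem (add_mem ha' (Ideal.mul_mem_left _ _ (Ideal.mem_sup_left (Ideal.mem_sup_left hv))))
    (Ideal.mul_mem_right _ _ (Ideal.mem_sup_left (Ideal.mem_sup_right
      (Ideal.mem_span_singleton_self _))))

/-- The parameter ideal `q = (z₀², z₁², z₂, …)` of a Cohen-Macaulay ring satisfies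
`(q : m)² = q (q : m)`. -/
theorem colonIdeal_sq_le {z₀ z₁ : R} {T : List R} (hT : T.length + 2 = d)
    (h : IsParamList ⊥ (z₀ :: z₁ :: T)) {q : Ideal R}
    (hq : q = Ideal.ofList T ⊔ Ideal.span {z₀ ^ 2} ⊔ Ideal.span {z₁ ^ 2}) :
    colonIdeal R q * colonIdeal R q ≤ q * colonIdeal R q := by
  have hz0 : z₀ ∈ maximalIdeal R := h.mem _ (by simp)
  have hz1 : z₁ ∈ maximalIdeal R := h.mem _ (by simp)
  have hex : ∀ a ∈ colonIdeal R q, ∃ s, a - z₀ * z₁ * s ∈ q := by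
    intro a ha
    have h0 := mem_colonIdeal.mp ha z₀ hz0
    have h1 := mem_colonIdeal.mp ha z₁ hz1
    rw [hq] at h0 h1 ⊢
    exact exists_sub_mul_mem hdim hCM hT h h0 h1
  have hqI : q ≤ colonIdeal R q := le_colonIdeal q
  have hz0q : z₀ ^ 2 ∈ q := by
    rw [hq]
    exact Ideal.mem_sup_left (Ideal.mem_sup_right (Ideal.mem_span_singleton_self _))
  have hz1q : z₁ ^ 2 ∈ q := by
    rw [hq]
    exact Ideal.mem_sup_right (Ideal.mem_span_singleton_self _)
  refine Ideal.mul_le.mpr fun a ha b hb => ?_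
  obtain ⟨s, hs⟩ := hex a ha
  obtain ⟨t, ht⟩ := hex b hb
  have hs' : z₀ * z₁ * s ∈ colonIdeal R q := by
    have := sub_mem ha (hqI hs)
    rwa [sub_sub_cancel] at this
  have e : a * b = (a - z₀ * z₁ * s) * b + (b - z₀ * z₁ * t) * (z₀ * z₁ * s) +
      z₀ ^ 2 * (z₁ ^ 2 * (s * t)) := by ring
  rw [e]
  exact add_mem (add_mem (Ideal.mul_mem_mul hs hb) (Ideal.mul_mem_mul ht hs'))
    (Ideal.mul_mem_mul hz0q (hqI (Ideal.mul_mem_right _ _ hz1q)))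

end ParameterExistence

section CohenMacaulayCoefficients

variable {R : Type u} [CommRing R] [IsLocalRing R] [IsNoetherianRing R] {d : ℕ}
  (hdim : ringKrullDim R = d) (hCM : IsCMLocal R) {x : ℕ → R}

theorem exists_relLength_top_eq (hx : IsParamList ⊥ ((List.range d).map x)) :
    ∃ L : ℕ, relLength ⊤ (seqIdeal ⊥ x d) = L := by
  obtain ⟨n, hn⟩ := hx.exists_pow_le
  rw [← seqIdeal_eq] at hn
  rw [relLength_top]
  refine ⟨(Module.length R (R ⧸ seqIdeal ⊥ x d)).toNat, (ENat.natCast_toNat ?_).symm⟩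
  refine Module.length_ne_top_iff.mpr (isFiniteLength_of_pow_smul (n := n) fun r hr y => ?_)
  obtain ⟨a, rfl⟩ := Submodule.Quotient.mk_surjective _ y
  rw [← Submodule.Quotient.mk_smul, Submodule.Quotient.mk_eq_zero]
  exact Ideal.mul_mem_right _ _ (hn hr)

include hdim hCM

theorem exists_isIrrCoeff_of_isCMLocal (hx : IsParamList ⊥ ((List.range d).map x)) (hd : 0 < d)
    {r : ℕ} (hr : rLength R d = r) :
    ∃ f, IsIrrCoeff R (seqIdeal ⊥ x d) d f ∧ f 0 = r := by
  have hreg := regular_of_isCMLocal hdim hCM hx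
  have h0 := rLength_eq_of_isCMLocal hdim hCM hx hr
  refine ⟨fun i => if i = 0 then r else 0, ⟨0, fun n _ => ?_⟩, rfl⟩
  refine ⟨(n + (d - 1)).choose (d - 1) * r, irMod_eq_natCast_iff.mpr ?_, ?_⟩
  · rw [colonIdeal, (relLength_colon_eq hreg hd (hx.mem _ (List.mem_map_of_mem
      (List.mem_range.mpr hd))) n).1]
    rw [colonIdeal] at h0
    rw [h0, Nat.cast_mul]
  · rw [Finset.sum_eq_single 0 (fun i _ hi => by simp [hi]) (fun h => by simp at h; omega)]
    rw [Nat.add_sub_assoc hd]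
    simp [mul_comm]

theorem exists_isHilbCoeff_of_isCMLocal {z : ℕ → R} (hz : IsParamList ⊥ ((List.range d).map z))
    (hd : 2 ≤ d) (hx0 : x 0 = z 0 ^ 2) (hx1 : x 1 = z 1 ^ 2) (hx2 : ∀ i, 2 ≤ i → x i = z i)
    {r : ℕ} (hr : rLength R d = r) :
    ∃ e e', IsHilbCoeff R (colonIdeal R (seqIdeal ⊥ x d)) d e ∧
      IsHilbCoeff R (seqIdeal ⊥ x d) d e' ∧ e 1 - e' 1 = r := by
  have hx : IsParamList ⊥ ((List.range d).map x) :=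
    hz.of_pow (k := fun i => if i < 2 then 2 else 1) (fun i => by split_ifs <;> simp)
      (fun i => by
        rcases lt_or_ge i 2 with h | h
        · rw [if_pos h]
          interval_cases i <;> assumption
        · rw [if_neg (by omega), pow_one, hx2 i h])
  have hreg := regular_of_isCMLocal hdim hCM hx
  have h0 := rLength_eq_of_isCMLocal hdim hCM hx hr
  obtain ⟨L, hL⟩ := exists_relLength_top_eq hx
  obtain ⟨k, rfl⟩ : ∃ k, d = k + 2 := ⟨d - 2, by omega⟩
  set q := seqIdeal ⊥ x (k + 2) with hq
  set I := colonIdeal R q with hI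
  have hrange : ∀ y : ℕ → R, (List.range (k + 2)).map y =
      y 0 :: y 1 :: (List.range' 2 k).map y := fun y => by
    rw [List.range_eq_range', List.range'_succ, List.range'_succ]
    rfl
  have hT : (List.range' 2 k).map x = (List.range' 2 k).map z := by
    refine List.map_congr_left fun i hi => hx2 i ?_
    rw [List.mem_range'_1] at hi
    exact hi.1
  have hII : I * I = q * I := by
    refine le_antisymm ?_ (Ideal.mul_mono_left (le_colonIdeal q))
    refine colonIdeal_sq_le hdim hCM (z₀ := z 0) (z₁ := z 1) (T := (List.range' 2 k).map z)
      (by simp) (by rw [← hrange]; exact hz) ?_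
    rw [hq, seqIdeal_eq, hrange, bot_sup_eq, Ideal.ofList_cons, Ideal.ofList_cons, hx0, hx1, hT]
    rw [← sup_assoc, sup_comm, sup_assoc]
  have hpow : ∀ n, I ^ (n + 1) = q ^ n * I := by
    intro n
    induction n with
    | zero => simp
    | succ n ih => rw [pow_succ, ih, mul_assoc, hII, ← mul_assoc, ← pow_succ]
  have htop := relLength_top_pow_eq hreg (by omega)
  have hle : ∀ n, q ^ (n + 1) ≤ I ^ (n + 1) := fun n => Ideal.pow_right_mono (le_colonIdeal q) _
  have key : ∀ n, ((n + (k + 2)).choose (k + 2) : ℕ∞) * L =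
      ((n + (k + 1)).choose (k + 1) : ℕ∞) * r + relLength ⊤ (I ^ (n + 1)) := by
    intro n
    rw [← hL, ← htop, relLength_eq_add (hle n), top_inf_eq]
    congr 1
    rw [hpow, hI, colonIdeal, (relLength_colon_eq hreg (by omega) (hx.mem _ (List.mem_map_of_mem
      (List.mem_range.mpr (by omega)))) n).2, ← h0]
    rfl
  refine ⟨fun i => if i = 0 then L else if i = 1 then r else 0, fun i => if i = 0 then L else 0,
    ⟨0, fun n _ => ?_⟩, ⟨0, fun n _ => ?_⟩, by simp⟩
  · have hfin : relLength ⊤ (I ^ (n + 1)) ≠ ⊤ := by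
      intro h
      have := key n
      rw [h, add_top, ← Nat.cast_mul] at this
      exact ENat.natCast_ne_top _ this
    obtain ⟨l, hl⟩ := ENat.ne_top_iff_exists.mp hfin
    refine ⟨l, moduleLength_quotient.mpr hl.symm, ?_⟩
    have := key n
    rw [← hl] at this
    have this' : (n + (k + 2)).choose (k + 2) * L = (n + (k + 1)).choose (k + 1) * r + l := by
      exact_mod_cast this
    have this'' : ((n + (k + 2)).choose (k + 2) : ℤ) * L =
      ((n + (k + 1)).choose (k + 1) : ℤ) * r + l := by exact_mod_cast this'
    rw [Finset.sum_range_succ', Finset.sum_range_succ', Finset.sum_eq_zero (fun i _ => by simp)]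
    simp only [zero_add, pow_one, one_ne_zero, if_true, if_false, pow_zero, Nat.sub_zero,
      Nat.add_sub_assoc (show 1 ≤ k + 2 by omega), show k + 2 - 1 = k + 1 by omega]
    linarith
  · refine ⟨(n + (k + 2)).choose (k + 2) * L, moduleLength_quotient.mpr ?_, ?_⟩
    · rw [htop, hL, Nat.cast_mul]
    · rw [Finset.sum_eq_single 0 (fun i _ hi => by simp [hi]) (fun h => by simp at h)]
      simp [mul_comm]

end CohenMacaulayCoefficients

section CompletionNoetherian

theorem isNoetherianRing_adicCompletion_of_surjective {A S : Type*} [CommRing A] [CommRing S]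
    (K : Ideal A) (I : Ideal S) (π : A →+* S) (hπ : Function.Surjective π) (hK : K.map π = I)
    [IsNoetherianRing (AdicCompletion K A)] : IsNoetherianRing (AdicCompletion I S) := by
  have hKn : ∀ n, K ^ n ≤ (I ^ n).comap π := fun n => by
    rw [← Ideal.map_le_iff_le_comap, Ideal.map_pow, hK]
  let f : (n : ℕ) → AdicCompletion K A →+* S ⧸ I ^ n := fun n =>
    (Ideal.quotientMap (I ^ n) π (hKn n)).comp (AdicCompletion.evalₐ K n : _ →+* _)
  have hfmk : ∀ n (p : AdicCompletion.AdicCauchySequence K A),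
      f n (AdicCompletion.mk K A p) = Ideal.Quotient.mk (I ^ n) (π (p.1 n)) := fun n p => by
    have h := congrArg (Ideal.quotientMap (I ^ n) π (hKn n)) (AdicCompletion.evalₐ_mk K n p)
    rw [Ideal.quotientMap_mk] at h
    exact h
  have hf : ∀ {m n : ℕ} (hle : m ≤ n), (Ideal.Quotient.factorPow I hle).comp (f n) = f m := by
    intro m n hle
    ext x
    obtain ⟨p, rfl⟩ := AdicCompletion.mk_surjective K A x
    rw [RingHom.comp_apply, hfmk, hfmk]
    have h1 := p.2 hle
    rw [SModEq.sub_mem, smul_eq_mul, Ideal.mul_top] at h1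
    change Ideal.Quotient.mk _ (π (p.1 n)) = _
    rw [eq_comm, Ideal.Quotient.eq, ← map_sub]
    exact hKn m h1
  refine isNoetherianRing_of_surjective _ _ (AdicCompletion.liftRingHom I f hf) fun y => ?_
  obtain ⟨r, rfl⟩ := AdicCompletion.mk_surjective I S y
  have hk : ∀ n, ∃ k ∈ K ^ n, π k = r.1 (n + 1) - r.1 n := fun n => by
    rw [← Ideal.mem_map_iff_of_surjective π hπ, Ideal.map_pow, hK, ← neg_mem_iff, neg_sub]
    have h1 := r.2 (Nat.le_succ n)
    rwa [SModEq.sub_mem, smul_eq_mul, Ideal.mul_top] at h1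
  choose k hk1 hk2 using hk
  obtain ⟨p0, hp0⟩ := hπ (r.1 0)
  let p : ℕ → A := fun n => Nat.rec p0 (fun n a => a + k n) n
  have hp : ∀ n, π (p n) = r.1 n := fun n => by
    induction n with
    | zero => exact hp0
    | succ n ih =>
      change π (p n + k n) = _
      rw [map_add, ih, hk2]
      ring
  let P : AdicCompletion.AdicCauchySequence K A := AdicCompletion.AdicCauchySequence.mk K A p
    fun n => by
      rw [SModEq.sub_mem, smul_eq_mul, Ideal.mul_top, ← neg_mem_iff, neg_sub]
      change p n + k n - p n ∈ _
      rw [add_sub_cancel_left]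
      exact hk1 n
  refine ⟨AdicCompletion.mk K A P, AdicCompletion.ext_evalₐ fun n => ?_⟩
  rw [AdicCompletion.evalₐ_liftRingHom, hfmk, AdicCompletion.evalₐ_mk]
  exact congrArg _ (hp n)

theorem isNoetherianRing_adicCompletion {R : Type*} [CommRing R] [IsNoetherianRing R]
    (I : Ideal R) : IsNoetherianRing (AdicCompletion I R) := by
  obtain ⟨s, hs⟩ := (IsNoetherian.noetherian I : I.FG)
  let n := s.card
  let g : Fin n → R := fun i => (s.equivFin.symm i : R)
  have : IsNoetherianRing (AdicCompletion (MvPolynomial.idealOfVars (Fin n) R)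
      (MvPolynomial (Fin n) R)) :=
    isNoetherianRing_of_surjective _ _
      (MvPowerSeries.toAdicCompletionAlgEquiv (Fin n) R).toRingEquiv.toRingHom
      (MvPowerSeries.toAdicCompletionAlgEquiv (Fin n) R).surjective
  refine isNoetherianRing_adicCompletion_of_surjective
    (MvPolynomial.idealOfVars (Fin n) R) I (MvPolynomial.aeval g : _ →ₐ[R] R).toRingHom
    (fun r => ⟨MvPolynomial.C r, by simp⟩) ?_
  change Ideal.map _ (Ideal.span (Set.range _)) = I
  rw [Ideal.map_span, ← hs, ← Set.range_comp]
  change Ideal.span _ = Ideal.span _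
  congr 1
  ext a
  constructor
  · rintro ⟨i, rfl⟩
    simp [g]
  · intro ha
    exact ⟨s.equivFin ⟨a, ha⟩, by simp [g]⟩

end CompletionNoetherian

section Unmixed

variable {R : Type u} [CommRing R] [IsLocalRing R] [IsNoetherianRing R] {d : ℕ}

theorem le_ringKrullDim_adicCompletion (hdim : ringKrullDim R = d) :
    (d : WithBot ℕ∞) ≤ ringKrullDim (AdicCompletion (maximalIdeal R) R) := by
  obtain ⟨l, hl⟩ := Order.le_krullDim_iff.mp
    (le_of_eq hdim.symm : ((d : ℕ) : WithBot ℕ∞) ≤ Order.krullDim (PrimeSpectrum R))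
  have hff : Module.FaithfullyFlat R (AdicCompletion (maximalIdeal R) R) :=
    Module.FaithfullyFlat.of_flat_of_isLocalHom
  obtain ⟨P, hP⟩ := PrimeSpectrum.comap_surjective_of_faithfullyFlat
    (A := R) (B := AdicCompletion (maximalIdeal R) R) l.last
  have hover : P.asIdeal.LiesOver l.last.asIdeal := ⟨by rw [← hP]; rfl⟩
  have hgd : Algebra.HasGoingDown R (AdicCompletion (maximalIdeal R) R) := inferInstance
  obtain ⟨L, hL, -⟩ := Ideal.exists_ltSeries_of_hasGoingDown l P.asIdeal
  rw [← hl, ← hL]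
  exact Order.LTSeries.length_le_krullDim L

theorem IsUnmixedRing.eq_zero_of_mul_eq_zero (hdim : ringKrullDim R = d) (hum : IsUnmixedRing R)
    {x : R} {L : List R} (hL : IsParamList ⊥ (x :: L)) (hlen : L.length < d) (a : R)
    (ha : x * a = 0) : a = 0 := by
  let φ := algebraMap R (AdicCompletion (maximalIdeal R) R)
  have hff : Module.FaithfullyFlat R (AdicCompletion (maximalIdeal R) R) :=
    Module.FaithfullyFlat.of_flat_of_isLocalHom
  have hinj : Function.Injective φ := FaithfulSMul.algebraMap_injective _ _
  have hN : IsNoetherianRing (AdicCompletion (maximalIdeal R) R) :=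
    isNoetherianRing_adicCompletion _
  by_contra hne
  have hne' : φ a ≠ 0 := fun h => hne (hinj (h.trans (map_zero φ).symm))
  obtain ⟨P, hP, hle⟩ := exists_le_isAssociatedPrime_of_isNoetherianRing
    (AdicCompletion (maximalIdeal R) R) (φ a) hne'
  have hxP : φ x ∈ P := hle <| by
    rw [Submodule.mem_colon_singleton, smul_eq_mul, ← map_mul, ha, map_zero]
    exact zero_mem _
  have hmax : maximalIdeal (AdicCompletion (maximalIdeal R) R) = (maximalIdeal R).map φ :=
    AdicCompletion.maximalIdeal_eq_map
  have hpar : IsParamList P (L.map φ) := by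
    refine ⟨fun b hb => ?_, ?_⟩
    · obtain ⟨c, hc, rfl⟩ := List.mem_map.mp hb
      rw [hmax]
      exact Ideal.mem_map_of_mem _ (hL.mem c (List.mem_cons_of_mem _ hc))
    · rw [hmax]
      refine (Ideal.map_mono hL.le_radical).trans ((Ideal.map_radical_le φ).trans
        (Ideal.radical_mono ?_))
      rw [bot_sup_eq, Ideal.map_ofList, List.map_cons, Ideal.ofList_cons]
      exact sup_le_sup_right ((Ideal.span_singleton_le_iff_mem _).mpr hxP) _
  have h1 := hpar.ringKrullDim_le
  rw [hum P hP, List.length_map] at h1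
  have h2 := (le_ringKrullDim_adicCompletion hdim).trans h1
  have h3 : d ≤ L.length := by exact_mod_cast h2
  omega

end Unmixed

section AwayDivision

variable {R : Type u} [CommRing R] {M : Type u} [AddCommGroup M] [Module R M]

/-- Division by `x` as a map to the localization at the powers of `x`. -/
def awayDiv (x : R) (M : Type u) [AddCommGroup M] [Module R M] : M →ₗ[R] AwayMod x M :=
  (LinearEquiv.ofBijective (x • (LinearMap.id : AwayMod x M →ₗ[R] AwayMod x M))
    away_bijective).symm.toLinearMap ∘ₗ awayMap x M

theorem smul_awayDiv (x : R) (m : M) : x • awayDiv x M m = awayMap x M m :=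
  (LinearEquiv.ofBijective (x • (LinearMap.id : AwayMod x M →ₗ[R] AwayMod x M))
    away_bijective).apply_symm_apply _

theorem awayDiv_smul (x : R) (m : M) : awayDiv x M (x • m) = awayMap x M m := by
  rw [map_smul, smul_awayDiv]

/-- Division by `x` followed by the projection to the cokernel of localization. -/
def awayStep (x : R) (M : Type u) [AddCommGroup M] [Module R M] : M →ₗ[R] AwayCoker x M :=
  (LinearMap.range (awayMap x M)).mkQ ∘ₗ awayDiv x M

theorem awayStep_smul (x : R) (m : M) : awayStep x M (x • m) = 0 := by
  refine (Submodule.Quotient.mk_eq_zero _).mpr ?_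
  rw [awayDiv_smul]
  exact ⟨m, rfl⟩

end AwayDivision

section KoszulStep

variable {R : Type u} [CommRing R]

/-- Maps contracting multiplication by `x` on a projective resolution. -/
structure SmulHomotopy {X : ModuleCat.{u} R} (P : ProjectiveResolution X) (x : R) where
  h : ∀ n, P.complex.X n ⟶ P.complex.X (n + 1)
  zero : h 0 ≫ P.complex.d 1 0 = x • 𝟙 _
  succ : ∀ n, P.complex.d (n + 1) n ≫ h n + h (n + 1) ≫ P.complex.d (n + 2) (n + 1) = x • 𝟙 _

theorem exists_smulHomotopy {X : ModuleCat.{u} R} (P : ProjectiveResolution X) {x : R}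
    (hx : x • 𝟙 X = 0) : Nonempty (SmulHomotopy P x) := by
  have hc : (x • 𝟙 P.complex) ≫ P.π = 0 := by
    ext : 1
    refine ModuleCat.hom_ext (LinearMap.ext fun a => ?_)
    have key : ∀ b : X, x • b = 0 := fun b => congrArg (fun t : X ⟶ X => t.hom b) hx
    exact (map_smul (P.π.f 0).hom x a).trans (key _)
  let H := ProjectiveResolution.liftHomotopyZero (P := P) (Q := P) (x • 𝟙 P.complex) hc
  refine ⟨fun n => H.hom n (n + 1), ?_, fun n => ?_⟩
  · have h := H.comm 0
    rw [Homotopy.dNext_zero_chainComplex, Homotopy.prevD_chainComplex] at h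
    simpa using h.symm
  · have h := H.comm (n + 1)
    rw [Homotopy.dNext_succ_chainComplex, Homotopy.prevD_chainComplex] at h
    simpa using h.symm

variable {J q : Ideal R} {P : ProjectiveResolution (ModuleCat.of R (R ⧸ q))} {x : R}
  {M : Type u} [AddCommGroup M] [Module R M]

theorem extPull_extMk_eq {I : Ideal R} (h : I ≤ q) (P' : ProjectiveResolution (ModuleCat.of R (R ⧸ I)))
    (P : ProjectiveResolution (ModuleCat.of R (R ⧸ q)))
    {n : ℕ} (f : P.complex.X n ⟶ ModuleCat.of R M) (hf : P.complex.d (n + 1) n ≫ f = 0) :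
    extPull h (ModuleCat.of R M) n (P.extMk f (n + 1) rfl hf) =
      P'.extMk ((resolutionHom P' P (quotFac h)).hom.f n ≫ f) (n + 1) rfl
        (by simp [← (resolutionHom P' P (quotFac h)).hom.comm_assoc, hf]) := by
  rw [extPull_apply, ProjectiveResolution.mk₀_comp_extMk]

theorem SmulHomotopy.d_comp (H : SmulHomotopy P x) {n : ℕ} {Y : ModuleCat.{u} R}
    (f : P.complex.X (n + 1) ⟶ Y) (hf : P.complex.d (n + 2) (n + 1) ≫ f = 0) :
    P.complex.d (n + 1) n ≫ H.h n ≫ f = x • f := by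
  have h := congrArg (fun t => t ≫ f) (H.succ n)
  simpa [hf] using h

theorem SmulHomotopy.step_cocycle (H : SmulHomotopy P x) {n : ℕ}
    (f : P.complex.X (n + 1) ⟶ ModuleCat.of R M) (hf : P.complex.d (n + 2) (n + 1) ≫ f = 0) :
    P.complex.d (n + 1) n ≫ (H.h n ≫ f ≫ ModuleCat.ofHom (awayStep x M)) = 0 := by
  have h := congrArg (fun t => t ≫ ModuleCat.ofHom (awayStep x M)) (H.d_comp f hf)
  simp only [Category.assoc] at h
  rw [h]
  ext a
  exact awayStep_smul x (f.hom a)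

theorem SmulHomotopy.extMk_comp_eq_zero (H : SmulHomotopy P x) {I : Ideal R} (hI : I ≤ q) {n : ℕ}
    (f : P.complex.X (n + 1) ⟶ ModuleCat.of R M) (hf : P.complex.d (n + 2) (n + 1) ≫ f = 0)
    (h0 : extPull hI _ n (P.extMk (H.h n ≫ f ≫ ModuleCat.ofHom (awayStep x M)) (n + 1) rfl
      (H.step_cocycle f hf)) = 0) :
    (extPull hI _ (n + 1) (P.extMk f (n + 2) rfl hf)).comp
      (Abelian.Ext.mk₀ (ModuleCat.ofHom (awayMap x M).rangeRestrict)) (add_zero _) = 0 := by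
  let P' := ProjectiveResolution.of (ModuleCat.of R (R ⧸ I))
  let φ := resolutionHom P' P (quotFac hI)
  rw [extPull_extMk_eq hI P' P] at h0 ⊢
  rw [P'.extMk_comp_mk₀, P'.extMk_eq_zero_iff _ _ _ _ n rfl]
  let D : ModuleCat.of R M ⟶ ModuleCat.of R (AwayMod x M) := ModuleCat.ofHom (awayDiv x M)
  let π : ModuleCat.of R (AwayMod x M) ⟶ ModuleCat.of R (AwayCoker x M) :=
    ModuleCat.ofHom (LinearMap.range (awayMap x M)).mkQ
  have hπ : Epi π := (ModuleCat.epi_iff_surjective _).mpr (Submodule.mkQ_surjective _)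
  have hlift : ∃ v : P'.complex.X n ⟶ ModuleCat.of R (AwayMod x M),
      P'.complex.d (n + 1) n ≫ v = 0 ∧ φ.hom.f n ≫ H.h n ≫ f ≫ D ≫ π = v ≫ π := by
    cases n with
    | zero =>
      refine ⟨0, by simp, ?_⟩
      rw [extMk_zero_eq_zero_iff] at h0
      rw [zero_comp]
      exact h0
    | succ n =>
      obtain ⟨w, hw⟩ := (P'.extMk_eq_zero_iff _ _ _ _ n rfl).mp h0
      refine ⟨P'.complex.d (n + 1) n ≫ Projective.factorThru w π, by simp, ?_⟩
      rw [Category.assoc, Projective.factorThru_comp, hw]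
      rfl
  obtain ⟨v, hv1, hv2⟩ := hlift
  let w : P'.complex.X n ⟶ ModuleCat.of R (AwayMod x M) := φ.hom.f n ≫ H.h n ≫ f ≫ D - v
  have hw : ∀ a, w.hom a ∈ LinearMap.range (awayMap x M) := fun a => by
    have h : w ≫ π = 0 := by
      simp only [w, Preadditive.sub_comp, Category.assoc, hv2, sub_self]
    exact (Submodule.Quotient.mk_eq_zero _).mp (congrArg (fun t => t.hom a) h)
  refine ⟨ModuleCat.ofHom (w.hom.codRestrict _ hw), ?_⟩
  have hdw : P'.complex.d (n + 1) n ≫ w =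
      (φ.hom.f (n + 1) ≫ f) ≫ ModuleCat.ofHom (awayMap x M) := by
    have h1 : x • (f ≫ D) = f ≫ ModuleCat.ofHom (awayMap x M) := by
      ext a
      exact smul_awayDiv x (f.hom a)
    have h2 := H.d_comp (f ≫ D) (by rw [← Category.assoc, hf, zero_comp])
    rw [h1] at h2
    simp only [w, Preadditive.comp_sub, hv1, sub_zero, Category.assoc, ← h2]
    exact (φ.hom.comm_assoc _ _ _).symm
  ext a
  exact congrArg (fun t => t.hom a) hdw

theorem SmulHomotopy.cls_eq_zero (H : SmulHomotopy P x) {N : ℕ} (hN : J ^ N ≤ q) {n : ℕ}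
    (f : P.complex.X (n + 1) ⟶ ModuleCat.of R M) (hf : P.complex.d (n + 2) (n + 1) ≫ f = 0)
    (hΓ : Subsingleton (LCH J (LinearMap.ker (awayMap x M)) (n + 1)))
    (h0 : LC.cls J _ n N (extPull hN _ n
      (P.extMk (H.h n ≫ f ≫ ModuleCat.ofHom (awayStep x M)) (n + 1) rfl
        (H.step_cocycle f hf))) = 0) :
    LC.cls J _ (n + 1) N (extPull hN _ (n + 1) (P.extMk f (n + 2) rfl hf)) = 0 := by
  obtain ⟨N', hN', h1⟩ := (LC.cls_eq_zero_iff _).mp h0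
  rw [extPull_extPull] at h1
  have h2 := H.extMk_comp_eq_zero _ f hf h1
  have hex := (LCH.les (J := J) (f := (LinearMap.ker (awayMap x M)).subtype)
    (g := (awayMap x M).rangeRestrict) (Submodule.injective_subtype _)
    (fun m => by
      rw [← LinearMap.coe_range, Submodule.range_subtype, SetLike.mem_coe, LinearMap.mem_ker]
      exact Subtype.ext_iff) (LinearMap.surjective_rangeRestrict _) (n + 1)).1
  rw [← LC.cls_extPull hN', extPull_extPull]
  obtain ⟨y, hy⟩ := (hex _).mp ((LCH.map_cls _ _ _ _).trans ((congrArg _ h2).trans (map_zero _)))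
  rw [← hy, Subsingleton.elim y 0, map_zero]

end KoszulStep

section Tower

variable {R : Type u} [CommRing R]

/-- Iterated cokernels of localization maps along a list of elements. -/
def awayTower : List R → ModuleCat.{u} R → ModuleCat.{u} R
  | [], M => M
  | x :: L, M => awayTower L (ModuleCat.of R (AwayCoker x M))

/-- Iterated division along a list of elements. -/
def awayTowerMap : (L : List R) → (M : ModuleCat.{u} R) → M →ₗ[R] awayTower L M
  | [], _ => LinearMap.id
  | x :: L, M => awayTowerMap L (ModuleCat.of R (AwayCoker x M)) ∘ₗ awayStep x M

theorem awayTowerMap_smul (L : List R) : ∀ (M : ModuleCat.{u} R) {y : R}, y ∈ L → ∀ m : M,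
    awayTowerMap L M (y • m) = 0 := by
  induction L with
  | nil => exact fun M y hy => absurd hy List.not_mem_nil
  | cons x L ih =>
    intro M y hy m
    change awayTowerMap L (ModuleCat.of R (AwayCoker x M)) (awayStep x M (y • m)) = 0
    rcases List.mem_cons.mp hy with rfl | hy
    · rw [awayStep_smul, map_zero]
    · rw [map_smul]
      exact ih (ModuleCat.of R (AwayCoker x M)) hy _

theorem awayTowerMap_eq_zero (L : List R) (M : ModuleCat.{u} R) {m : M}
    (hm : m ∈ Ideal.ofList L • (⊤ : Submodule R M)) : awayTowerMap L M m = 0 := by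
  suffices h : Ideal.ofList L • (⊤ : Submodule R M) ≤ LinearMap.ker (awayTowerMap L M) from h hm
  rw [Submodule.smul_le]
  intro r hr n _
  suffices h : Ideal.ofList L ≤ (LinearMap.ker (awayTowerMap L M)).colon {n} by
    exact Submodule.mem_colon_singleton.mp (h hr)
  refine Ideal.span_le.mpr fun y hy => Submodule.mem_colon_singleton.mpr ?_
  exact awayTowerMap_smul L M hy n

theorem awayTowerMap_eq_zero_of_smul_mem (L₁ L₂ : List R) {y : R} :
    ∀ (M : ModuleCat.{u} R) {a : M},
      y • a ∈ Ideal.ofList (L₁ ++ L₂) • (⊤ : Submodule R M) →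
      awayTowerMap (L₁ ++ y :: L₂) M a = 0 := by
  induction L₁ with
  | nil =>
    intro M a ha
    change awayTowerMap L₂ (ModuleCat.of R (AwayCoker y M)) (awayStep y M a) = 0
    refine awayTowerMap_eq_zero L₂ _ ?_
    rw [List.nil_append] at ha
    let e := (LinearEquiv.ofBijective (y • (LinearMap.id : AwayMod y M →ₗ[R] AwayMod y M))
      away_bijective).symm.toLinearMap
    have he : ∀ b : AwayMod y M, e (y • b) = b := fun b =>
      (LinearEquiv.ofBijective (y • (LinearMap.id : AwayMod y M →ₗ[R] AwayMod y M))
        away_bijective).symm_apply_apply b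
    have h1 := Submodule.smul_top_le_comap_smul_top (Ideal.ofList L₂)
      ((LinearMap.range (awayMap y M)).mkQ ∘ₗ e ∘ₗ e ∘ₗ awayMap y M) ha
    have h2 : ((LinearMap.range (awayMap y M)).mkQ ∘ₗ e ∘ₗ e ∘ₗ awayMap y M) (y • a) =
        awayStep y M a := by
      simp only [LinearMap.comp_apply, map_smul (awayMap y M)]
      rw [he]
      rfl
    rw [Submodule.mem_comap, h2] at h1
    exact h1
  | cons x L₁ ih =>
    intro M a ha
    refine ih (ModuleCat.of R (AwayCoker x M)) ?_
    rw [← map_smul]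
    rw [List.cons_append, Ideal.ofList_cons, Submodule.sup_smul] at ha
    obtain ⟨b, hb, c, hc, hbc⟩ := Submodule.mem_sup.mp ha
    rw [Submodule.ideal_span_singleton_smul, Submodule.mem_smul_pointwise_iff_exists] at hb
    obtain ⟨b, -, rfl⟩ := hb
    rw [← hbc, map_add, awayStep_smul, zero_add]
    exact Submodule.smul_top_le_comap_smul_top _ (awayStep x M) hc

theorem LCH.subsingleton_of_list_torsion [IsNoetherianRing R] {J : Ideal R} {L₀ L : List R} {N : ℕ}
    (hJ : ∀ y ∈ L₀ ++ L, y ∈ J) (hN : J ^ N ≤ Ideal.ofList (L₀ ++ L))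
    {M : Type u} [AddCommGroup M] [Module R M]
    (hM : ∀ y ∈ L₀, ∀ m : M, ∃ n, y ^ n • m = 0) {j : ℕ} (hj : L.length < j) :
    Subsingleton (LCH J M j) := by
  refine LCH.subsingleton_of_partial_torsion (x := (L₀ ++ L).get) (N := N)
    (fun l => hJ _ (List.get_mem _ _)) ?_ L.length L₀.length List.length_append.symm
    (fun l hl => ?_) j hj
  · refine hN.trans (le_of_eq ?_)
    change Ideal.span _ = Ideal.span _
    congr 1
    ext a
    exact List.mem_iff_get
  · refine hM _ ?_
    rw [List.get_eq_getElem, List.getElem_append_left hl]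
    exact List.getElem_mem _

theorem exists_augmentation_lift {q : Ideal R} (P : ProjectiveResolution (ModuleCat.of R (R ⧸ q))) :
    ∃ κ : P.complex.X 0, ∀ a, ∃ r : R, ∃ b, a = r • κ + (P.complex.d 1 0).hom b := by
  let π : P.complex.X 0 →ₗ[R] R ⧸ q := (P.π.f 0).hom
  have hsurj : Function.Surjective π :=
    (ModuleCat.epi_iff_surjective (P.π.f 0)).mp inferInstance
  obtain ⟨κ, hκ⟩ := hsurj (Ideal.Quotient.mk q 1)
  refine ⟨κ, fun a => ?_⟩
  obtain ⟨r, hr⟩ := Ideal.Quotient.mk_surjective (π a)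
  have h0 : π (a - r • κ) = 0 := by
    rw [map_sub, map_smul, hκ, ← hr, sub_eq_zero]
    exact (congrArg (Submodule.Quotient.mk (p := q)) (mul_one r)).symm
  obtain ⟨b, hb⟩ := ((ShortComplex.moduleCat_exact_iff _).mp P.exact₀) (a - r • κ) h0
  refine ⟨r, b, ?_⟩
  rw [show (P.complex.d 1 0).hom b = a - r • κ from hb]
  abel

theorem SmulHomotopy.d_mem {q : Ideal R} {X : ModuleCat.{u} R} {P : ProjectiveResolution X} {x : R}
    (H : SmulHomotopy P x) (hx : x ∈ q) {n : ℕ} (ω : P.complex.X n)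
    (hω : ∀ p, p + 1 = n → (P.complex.d n p).hom ω ∈ q • (⊤ : Submodule R _)) :
    (P.complex.d (n + 1) n).hom ((H.h n).hom ω) ∈ q • (⊤ : Submodule R _) := by
  cases n with
  | zero =>
    have h := congrArg (fun t => t.hom ω) H.zero
    exact (show (P.complex.d 1 0).hom ((H.h 0).hom ω) = x • ω from h) ▸
      Submodule.smul_mem_smul hx trivial
  | succ n =>
    have h : (H.h n).hom ((P.complex.d (n + 1) n).hom ω) +
        (P.complex.d (n + 2) (n + 1)).hom ((H.h (n + 1)).hom ω) = x • ω :=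
      congrArg (fun t => t.hom ω) (H.succ n)
    rw [← eq_sub_iff_add_eq'] at h
    rw [h]
    exact sub_mem (Submodule.smul_mem_smul hx trivial)
      (Submodule.smul_top_le_comap_smul_top q (H.h n).hom (hω n rfl))

theorem exists_tower_element [IsNoetherianRing R] {J q : Ideal R} {N : ℕ} (hN : J ^ N ≤ q)
    (P : ProjectiveResolution (ModuleCat.of R (R ⧸ q))) (L : List R) : ∀ L₀ : List R,
    (∀ y ∈ L₀ ++ L, y ∈ J) → (∀ y ∈ L, y ∈ q) → J ^ N ≤ Ideal.ofList (L₀ ++ L) →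
    ∃ ω : P.complex.X L.length,
      (∀ p, p + 1 = L.length → (P.complex.d L.length p).hom ω ∈ q • (⊤ : Submodule R _)) ∧
      ∀ (M : Type u) [AddCommGroup M] [Module R M], (∀ y ∈ L₀, ∀ m : M, ∃ n, y ^ n • m = 0) →
        ∀ (f : P.complex.X L.length ⟶ ModuleCat.of R M)
          (hf : P.complex.d (L.length + 1) L.length ≫ f = 0),
          awayTowerMap L (ModuleCat.of R M) (f.hom ω) = 0 →
          LC.cls J _ L.length N (extPull hN _ L.length (P.extMk f (L.length + 1) rfl hf)) = 0 := by
  induction L with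
  | nil =>
    intro L₀ _ _ _
    obtain ⟨κ, hκ⟩ := exists_augmentation_lift P
    refine ⟨κ, fun p hp => absurd hp (by simp), fun M _ _ _ f hf h0 => ?_⟩
    have hf0 : f = 0 := by
      ext a
      obtain ⟨r, b, rfl⟩ := hκ a
      have h1 : f.hom κ = 0 := h0
      have h2 : f.hom ((P.complex.d 1 0).hom b) = 0 := congrArg (fun t => t.hom b) hf
      rw [map_add, map_smul, h1, h2, smul_zero, add_zero]
      rfl
    have h3 := (extMk_zero_eq_zero_iff P f hf).mpr hf0
    exact (congrArg (fun t => LC.cls J (ModuleCat.of R M) 0 N (extPull hN _ 0 t)) h3).trans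
      (by simp only [map_zero])
  | cons x L ih =>
    intro L₀ hJ hq hN'
    have heq : (L₀ ++ [x]) ++ L = L₀ ++ x :: L := by simp
    obtain ⟨ω, hω, hcls⟩ := ih (L₀ ++ [x]) (by rwa [heq])
      (fun y hy => hq y (List.mem_cons_of_mem _ hy)) (by rwa [heq])
    have hxq : x ∈ q := hq x List.mem_cons_self
    obtain ⟨H⟩ := exists_smulHomotopy P (x := x) (by
      ext
      refine (Submodule.Quotient.mk_eq_zero q).mpr ?_
      change x * 1 ∈ q
      rwa [mul_one])
    refine ⟨(H.h L.length).hom ω, fun p hp => ?_, fun M _ _ hM f hf h0 => ?_⟩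
    · obtain rfl : p = L.length := by simpa using hp
      exact H.d_mem hxq ω hω
    · refine H.cls_eq_zero hN f hf ?_ ?_
      · refine LCH.subsingleton_of_list_torsion (L₀ := L₀ ++ [x]) (L := L) (by rwa [heq])
          (by rwa [heq]) (fun y hy m => ?_) (Nat.lt_succ_self _)
        rcases List.mem_append.mp hy with hy | hy
        · obtain ⟨n, hn⟩ := hM y hy m
          exact ⟨n, Subtype.ext hn⟩
        · obtain rfl := List.mem_singleton.mp hy
          obtain ⟨n, hn⟩ := awayMap_eq_zero_iff.mp (LinearMap.mem_ker.mp m.2)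
          exact ⟨n, Subtype.ext hn⟩
      · refine hcls (AwayCoker x M) (fun y hy m => ?_) _ (H.step_cocycle f hf) h0
        rcases List.mem_append.mp hy with hy | hy
        · exact awayCoker_torsion_of (hM y hy) m
        · obtain rfl := List.mem_singleton.mp hy
          exact awayCoker_torsion m

end Tower

section SocleBound

/-- Degree `n` cocycles of the complex computing `Ext` from a projective resolution. -/
def cocycles {R : Type u} [CommRing R] {X : ModuleCat.{u} R} (P : ProjectiveResolution X)
    (Y : ModuleCat.{u} R) (n : ℕ) : Submodule R (P.complex.X n ⟶ Y) :=
  LinearMap.ker (Linear.leftComp R Y (P.complex.d (n + 1) n))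

/-- The linear map from cocycles to `Ext` classes. -/
def cocycleClass {R : Type u} [CommRing R] {X : ModuleCat.{u} R} (P : ProjectiveResolution X)
    (Y : ModuleCat.{u} R) (n : ℕ) : cocycles P Y n →ₗ[R] Abelian.Ext X Y n where
  toFun f := P.extMk f.1 (n + 1) rfl f.2
  map_add' f g := (P.add_extMk f.1 g.1 (n + 1) rfl f.2 g.2).symm
  map_smul' r f := (smul_extMk P f.1 f.2 r).symm

variable {R : Type u} [CommRing R] [IsLocalRing R] [IsNoetherianRing R]

theorem length_socle_le_length_map_awayTowerMap (L : List R) (hL0 : L.length ≠ 0)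
    (hL : ∀ y ∈ L, y ∈ maximalIdeal R)
    {q : Ideal R} (hLq : q = Ideal.ofList L) (h : maximalIdeal R ≤ q.radical)
    (hs : SurjectiveOnSocles R (canonicalToLocalCohomology R (maximalIdeal R) q h L.length)) :
    Module.length R
        (Submodule.torsionBySet R (Hmod R R L.length) ((maximalIdeal R : Ideal R) : Set R)) ≤
      Module.length R
        (Submodule.map (awayTowerMap L (ModuleCat.of R R)) (colonIdeal R q)) := by
  obtain ⟨N, hN⟩ := Ideal.exists_pow_le_of_le_radical_of_fg h
    (IsNoetherian.noetherian (maximalIdeal R))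
  let P := ProjectiveResolution.of (ModuleCat.of R (R ⧸ q))
  obtain ⟨ω, hω, hcls⟩ := exists_tower_element hN P L [] hL
    (fun y hy => hLq ▸ Submodule.subset_span hy) (hLq ▸ hN)
  let Z : Submodule R (cocycles P (ModuleCat.of R R) L.length) :=
    (Submodule.torsionBySet R _ ((maximalIdeal R : Ideal R) : Set R)).comap
      (cocycleClass P (ModuleCat.of R R) L.length)
  let evalω : cocycles P (ModuleCat.of R R) L.length →ₗ[R] R :=
    { toFun := fun f => f.1.hom ω
      map_add' := fun _ _ => rfl
      map_smul' := fun _ _ => rfl }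
  let F : Z →ₗ[R] (localCohomology (maximalIdeal R) L.length).obj (ModuleCat.of R R) :=
    (lcToHmod (maximalIdeal R) L.length) ∘ₗ LC.cls (maximalIdeal R) _ L.length N ∘ₗ
      extPull hN _ L.length ∘ₗ cocycleClass P (ModuleCat.of R R) L.length ∘ₗ Z.subtype
  let G : Z →ₗ[R] awayTower L (ModuleCat.of R R) :=
    awayTowerMap L (ModuleCat.of R R) ∘ₗ evalω ∘ₗ Z.subtype
  refine (length_mono (P := LinearMap.range F) ?_).trans
    ((length_range_le F G fun f h0 => ?_).trans (length_mono ?_))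
  · intro y hy
    obtain ⟨z, hz, rfl⟩ := hs y hy
    obtain ⟨e, rfl⟩ := (extComparison (ModuleCat.of R (R ⧸ q)) (ModuleCat.of R R)
      L.length).surjective z
    obtain ⟨f, hf, rfl⟩ := P.extMk_surjective e (L.length + 1) rfl
    refine ⟨⟨⟨f, hf⟩, ?_⟩, lcToHmod_cls_extPull (maximalIdeal R) L.length hN h _⟩
    refine (Submodule.mem_torsionBySet_iff _ _).mpr fun r => ?_
    apply (extComparison (ModuleCat.of R (R ⧸ q)) (ModuleCat.of R R) L.length).injective
    rw [map_smul, map_zero]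
    exact (Submodule.mem_torsionBySet_iff _ _).mp hz r
  · have h1 := hcls R (by simp) f.1.1 f.1.2 h0
    exact (congrArg (lcToHmod (maximalIdeal R) L.length) h1).trans (map_zero _)
  · rintro _ ⟨f, rfl⟩
    refine ⟨f.1.1.hom ω, mem_colonIdeal.mpr fun r hr => ?_, rfl⟩
    have h1 := (Submodule.mem_torsionBySet_iff _ _).mp f.2 ⟨r, hr⟩
    have h2 : P.extMk (r • f.1.1) (L.length + 1) rfl (by
        rw [Linear.comp_smul, show P.complex.d (L.length + 1) L.length ≫ f.1.1 = 0 from f.1.2,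
          smul_zero]) = 0 := (smul_extMk P f.1.1 f.1.2 r).symm.trans h1
    obtain ⟨p, hp⟩ := Nat.exists_eq_succ_of_ne_zero hL0
    obtain ⟨g, hg⟩ := (P.extMk_eq_zero_iff _ _ _ _ p hp.symm).mp h2
    have h3 : r • f.1.1.hom ω = g.hom ((P.complex.d L.length p).hom ω) :=
      congrArg (fun t => t.hom ω) hg.symm
    have h4 := Submodule.smul_top_le_comap_smul_top q g.hom (hω p hp.symm)
    rw [Submodule.mem_comap, ← h3] at h4
    simpa using h4

theorem rLength_le_length_map_awayTowerMap {d : ℕ} {x : ℕ → R} (hdim : ringKrullDim R = d)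
    (hd : d ≠ 0) (hx : IsParamList ⊥ ((List.range d).map x))
    (hg : seqIdeal ⊥ x d ≤ maximalIdeal R ^ gInvariant R) {r : ℕ} (hr : rLength R d = r) :
    (r : ℕ∞) ≤ Module.length R (Submodule.map
      (awayTowerMap ((List.range d).map x) (ModuleCat.of R R))
        (colonIdeal R (seqIdeal ⊥ x d))) := by
  have hq : seqIdeal ⊥ x d = Ideal.ofList ((List.range d).map x) := by
    rw [seqIdeal_eq, bot_sup_eq]
  have hrad : maximalIdeal R ≤ (seqIdeal ⊥ x d).radical := by
    have := hx.le_radical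
    rwa [bot_sup_eq, ← hq] at this
  have hlen : ((List.range d).map x).length = d := by simp
  have hs : ∀ q : Ideal R, Ideal.span (Set.range fun i : Fin d => x i) = q →
      ∀ h : maximalIdeal R ≤ q.radical, SurjectiveOnSocles R
        (canonicalToLocalCohomology R (maximalIdeal R) q h ((List.range d).map x).length) := by
    rintro _ rfl h
    exact gProperty_gInvariant R d _ ((isSOP_iff_isParamList hdim).mpr hx)
      (fun i => hg (mem_seqIdeal i.2)) h _
  refine le_trans (le_of_eq ?_) (length_socle_le_length_map_awayTowerMap
    ((List.range d).map x) (by simpa [hlen] using hd) hx.mem hq hrad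
    (hs _ span_range_eq_seqIdeal hrad))
  rw [hlen]
  exact (moduleLength_eq_natCast_iff.mp hr).symm

end SocleBound

section Conclusion

variable {R : Type u} [CommRing R]

theorem awayTowerMap_eq_zero_of_mul_mem {x : ℕ → R} {d i : ℕ} (hi : i < d) {a : R}
    (ha : x i * a ∈ Ideal.ofList ((List.range i).map x ++
      (List.range' (i + 1) (d - (i + 1))).map x)) :
    awayTowerMap ((List.range d).map x) (ModuleCat.of R R) a = 0 := by
  have hsplit : (List.range d).map x =
      (List.range i).map x ++ x i :: (List.range' (i + 1) (d - (i + 1))).map x := by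
    rw [← List.map_cons, ← List.map_append, ← List.range'_succ, List.range_eq_range',
      List.range_eq_range', show d - (i + 1) + 1 = d - i by omega]
    congr 1
    have := List.range'_append (s := 0) (m := i) (n := d - i) (step := 1)
    simp only [one_mul, zero_add] at this
    rw [this, Nat.add_sub_of_le hi.le]
  rw [hsplit]
  refine awayTowerMap_eq_zero_of_smul_mem _ _ _ ?_
  rw [smul_eq_mul, Ideal.mul_top]
  exact ha

variable [IsLocalRing R] [IsNoetherianRing R] {x : ℕ → R} {d : ℕ}
  (hdim : ringKrullDim R = d) (hd : 2 ≤ d) (hx : IsCSeq x d)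
  (hreg : ∀ a, x (d - 1) * a = 0 → a = 0) (hCM : ¬ IsCMLocal R)

theorem IsUnmixedRing.last_regular (hdim : ringKrullDim R = d) (hd : 0 < d)
    (hum : IsUnmixedRing R) (hx : IsParamList ⊥ ((List.range d).map x)) :
    ∀ a, x (d - 1) * a = 0 → a = 0 := by
  refine fun a => hum.eq_zero_of_mul_eq_zero hdim (L := (List.range (d - 1)).map x)
    (hx.of_mem_iff fun b => ?_) (by simp [hd]) a
  obtain ⟨t, rfl⟩ := Nat.exists_eq_succ_of_ne_zero hd.ne'
  simp [List.range_succ, or_comm]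

include hdim hd hx hreg hCM

theorem IsCSeq.succ_rLength_le_relLength (hg : seqIdeal ⊥ x d ≤ maximalIdeal R ^ gInvariant R)
    {r : ℕ} (hr : rLength R d = r) :
    ((r + 1 : ℕ) : ℕ∞) ≤ relLength (colonIdeal R (seqIdeal ⊥ x d))
      (seqIdeal ⊥ x d ⊔ seqColon x (d - 1)) := by
  obtain ⟨s, hs, a, hsa, hma, ha⟩ := hx.exists_witness hdim (by omega) hreg hCM
  have hq : seqIdeal ⊥ x d = Ideal.ofList ((List.range d).map x) := by
    rw [seqIdeal_eq, bot_sup_eq]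
  have hker : seqIdeal ⊥ x d ⊔ seqColon x (d - 1) ⊔ Ideal.span {a} ≤
      LinearMap.ker (awayTowerMap ((List.range d).map x) (ModuleCat.of R R)) := by
    refine sup_le (sup_le ?_ ?_) ((Ideal.span_singleton_le_iff_mem _).mpr ?_)
    · intro b hb
      refine awayTowerMap_eq_zero _ _ ?_
      rw [smul_eq_mul, Ideal.mul_top, ← hq]
      exact hb
    · intro b hb
      refine awayTowerMap_eq_zero_of_mul_mem (i := d - 1) (by omega) ?_
      have hb' := mem_seqColon.mp hb
      rw [seqIdeal_eq, bot_sup_eq] at hb'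
      exact Ideal.span_mono (fun _ h => List.mem_append_left _ h) hb'
    · refine awayTowerMap_eq_zero_of_mul_mem (i := s) (by omega) ?_
      obtain ⟨t, ht⟩ := (mem_seqIdeal_tail (by omega)).mp hsa
      rw [seqIdeal_eq, bot_sup_eq] at ht
      rw [← sub_add_cancel (x s * a) (x (d - 1) * t)]
      refine add_mem (Ideal.span_mono (fun _ h => List.mem_append_left _ h) ht)
        (Ideal.mul_mem_right _ _ (Ideal.subset_span (List.mem_append_right _
          (List.mem_map_of_mem ?_))))
      rw [List.mem_range'_1]
      omega
  have h1 : (r : ℕ∞) ≤ relLength (colonIdeal R (seqIdeal ⊥ x d))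
      (seqIdeal ⊥ x d ⊔ seqColon x (d - 1) ⊔ Ideal.span {a}) :=
    (rLength_le_length_map_awayTowerMap hdim (by omega) hx.param hg hr).trans
      (length_le_relLength _ fun b _ hb => hker hb)
  have h2 : 1 ≤ relLength (Ideal.span {a}) (seqIdeal ⊥ x d ⊔ seqColon x (d - 1)) := by
    rw [Order.one_le_iff_ne_zero, relLength, Ne, Module.length_eq_zero_iff,
      Submodule.subsingleton_iff_eq_bot, ← LinearMap.le_ker_iff_map, Submodule.ker_mkQ,
      Ideal.span_singleton_le_iff_mem]
    exact ha
  refine le_trans ?_ (relLength_add_le le_sup_left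
    ((Ideal.span_singleton_le_iff_mem _).mpr (mem_colonIdeal.mpr hma)) le_sup_right)
  rw [add_comm r 1]
  push_cast
  exact add_le_add h2 h1

theorem IsCSeq.mul_colonIdeal_le :
    maximalIdeal R * colonIdeal R (seqIdeal ⊥ x d) ≤ maximalIdeal R * seqIdeal ⊥ x d :=
  Ideal.mul_le.mpr fun _ hy _ ha =>
    hx.mul_mem_of_socle hdim hd hreg hCM (mem_colonIdeal.mp ha) hy

theorem IsCSeq.colonIdeal_le_maximalIdeal :
    colonIdeal R (seqIdeal ⊥ x d) ≤ maximalIdeal R := by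
  refine le_maximalIdeal fun htop => ?_
  have h1 := hx.mul_colonIdeal_le hdim hd hreg hCM
  rw [htop, Ideal.mul_top] at h1
  have hqm : seqIdeal ⊥ x d ≤ maximalIdeal R := by
    rw [seqIdeal_eq, bot_sup_eq]
    exact Ideal.span_le.mpr hx.param.mem
  have h2 : maximalIdeal R = ⊥ :=
    Submodule.eq_bot_of_le_smul_of_le_jacobson_bot (maximalIdeal R) (maximalIdeal R)
      (IsNoetherian.noetherian _) (h1.trans (Ideal.mul_mono_right hqm))
      (maximalIdeal_le_jacobson _)
  have h4 : ringKrullDim R = 0 := by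
    have := IsLocalRing.isField_iff_maximalIdeal_eq.mpr h2
    exact ringKrullDim_eq_zero_of_isField this
  rw [hdim] at h4
  have : d = 0 := by exact_mod_cast h4
  omega

end Conclusion

theorem exists_isParamList_mem_pow {R : Type u} [CommRing R] [IsLocalRing R] [IsNoetherianRing R]
    {d : ℕ} (hdim : ringKrullDim R = d) (n : ℕ) :
    ∃ z : ℕ → R, IsParamList ⊥ ((List.range d).map z) ∧ ∀ i < d, z i ∈ maximalIdeal R ^ n := by
  obtain ⟨y, hy⟩ := exists_isParamList hdim
  refine ⟨fun i => y i ^ (n + 1), hy.of_pow (k := fun _ => n + 1) (by simp) (fun _ => rfl),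
    fun i hi => Ideal.pow_le_pow_right n.le_succ (Ideal.pow_mem_pow (hy.mem _
      (List.mem_map_of_mem (List.mem_range.mpr hi))) _)⟩

end

/-- For `R` unmixed of dimension `d ≥ 2`, TFAE: (1) `R` is Cohen-Macaulay;
(2) `f_0(q, R) ≤ r_d(R)` for some C-parameter ideal `q ⊆ m^(g(R))`;
(3) `e_1(q :_R m, R) - e_1(q, R) ≤ r_d(R)` for some C-parameter ideal `q ⊆ m^(g(R))`. -/
theorem statement_4 {R : Type u} [CommRing R] [IsLocalRing R] [IsNoetherianRing R]
    (hres : IsHomImageOfCM R)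
    (d : ℕ) (hd : 2 ≤ d) (hdim : ringKrullDim R = (d : WithBot ℕ∞))
    (hum : IsUnmixedRing R)
    (rd : ℕ) (hrd : rLength R d = (rd : WithBot ℕ∞)) :
    (IsCMLocal R ↔ ∃ q : Ideal R, IsCParamIdeal R q ∧ q ≤ maximalIdeal R ^ gInvariant R ∧
        ∃ f : ℕ → ℤ, IsIrrCoeff R q d f ∧ f 0 ≤ (rd : ℤ)) ∧
    (IsCMLocal R ↔ ∃ q : Ideal R, IsCParamIdeal R q ∧ q ≤ maximalIdeal R ^ gInvariant R ∧
        ∃ e e' : ℕ → ℤ, IsHilbCoeff R (colonIdeal R q) d e ∧ IsHilbCoeff R q d e' ∧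
          e 1 - e' 1 ≤ (rd : ℤ)) := by
  obtain ⟨z, hz, hzg⟩ := exists_isParamList_mem_pow hdim (gInvariant R)
  let x : ℕ → R := fun i => if i < 2 then z i ^ 2 else z i
  have hx : IsParamList ⊥ ((List.range d).map x) :=
    hz.of_pow (k := fun i => if i < 2 then 2 else 1) (fun i => by split_ifs <;> simp)
      (fun i => by simp only [x]; split_ifs <;> simp)
  have hxg : seqIdeal ⊥ x d ≤ maximalIdeal R ^ gInvariant R := by
    rw [← span_range_eq_seqIdeal]
    refine Ideal.span_le.mpr ?_
    rintro _ ⟨i, rfl⟩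
    simp only [x]
    split_ifs
    · exact Ideal.pow_mem_of_mem _ (hzg i i.2) _ two_pos
    · exact hzg i i.2
  have hparam (hCM : IsCMLocal R) : IsCParamIdeal R (seqIdeal ⊥ x d) :=
    (isCParamIdeal_iff hdim).mpr ⟨x, isCSeq_of_isCMLocal hdim hCM hx, rfl⟩
  refine ⟨⟨fun hCM => ?_, ?_⟩, ⟨fun hCM => ?_, ?_⟩⟩
  · obtain ⟨f, hf, h0⟩ := exists_isIrrCoeff_of_isCMLocal hdim hCM hx (by omega) hrd
    exact ⟨_, hparam hCM, hxg, f, hf, h0.le⟩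
  · rintro ⟨q, hq, hqg, f, hf, hle⟩
    by_contra hCM
    obtain ⟨y, hy, rfl⟩ := (isCParamIdeal_iff hdim).mp hq
    have hreg := hum.last_regular hdim (by omega) hy.param
    have h1 := (hy.isDSeq hdim).le_irrCoeff
      (hy.succ_rLength_le_relLength hdim hd hreg hCM hqg hrd) hd hf
    push_cast at h1
    omega
  · obtain ⟨e, e', he, he', h0⟩ := exists_isHilbCoeff_of_isCMLocal hdim hCM hz hd
      (show x 0 = z 0 ^ 2 from if_pos two_pos) (if_pos one_lt_two)
      (fun i hi => if_neg (by omega)) hrd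
    exact ⟨_, hparam hCM, hxg, e, e', he, he', h0.le⟩
  · rintro ⟨q, hq, hqg, e, e', he, he', hle⟩
    by_contra hCM
    obtain ⟨y, hy, rfl⟩ := (isCParamIdeal_iff hdim).mp hq
    have hreg := hum.last_regular hdim (by omega) hy.param
    have h1 := (hy.isDSeq hdim).le_hilbCoeff_sub
      (hy.succ_rLength_le_relLength hdim hd hreg hCM hqg hrd) hd
      (hy.mul_colonIdeal_le hdim hd hreg hCM)
      (hy.colonIdeal_le_maximalIdeal hdim hd hreg hCM) he he'
    push_cast at h1
    omega
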